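/- Let λ, μ ∈ ℝ with μ > 0 and 3λ + 2μ > 0, and let r₀, E₀ > 0 and D₀ > 1. There exists a constant c > 0, depending only on λ, μ, r₀, E₀, D₀, such that for every Lipschitz cavity C with parameters r₀, E₀, D₀ and every p > 0: there exists a weak solution u of the direct problem in Ω = ℝ³₋ \ C̄, this weak solution is unique (any two weak solutions coincide on Ω), and it satisfies ∫_Ω |u(x)|²/(1+|x|²) dx + ∫_Ω |∇u(x)|² dx ≤ c² p². -/

import Mathlib

open MeasureTheory Metric Set

noncomputable section

abbrev E3 := EuclideanSpace ℝ (Fin 3)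
abbrev E2 := EuclideanSpace ℝ (Fin 2)

/-- The open lower half-space `{x : x₃ < 0}`. -/
def lowerHalf : Set E3 := {x | x 2 < 0}

/-- The lower half-ball `B⁻_r(0) = {|x| < r, x₃ < 0}`. -/
def negBall (r : ℝ) : Set E3 := {x | ‖x‖ < r ∧ x 2 < 0}

/-- Jacobian matrix of a vector field: `(jac u x) i j = ∂uᵢ/∂xⱼ (x)`. -/
def jac (u : E3 → E3) (x : E3) : Matrix (Fin 3) (Fin 3) ℝ :=
  fun i j => fderiv ℝ u x (EuclideanSpace.single j 1) i

/-- Symmetric part of the Jacobian (strain tensor) `∇̂u`. -/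
def strain (u : E3 → E3) (x : E3) : Matrix (Fin 3) (Fin 3) ℝ :=
  fun i j => (jac u x i j + jac u x j i) / 2

/-- Squared Frobenius norm of a 3×3 matrix. -/
def frob2 (M : Matrix (Fin 3) (Fin 3) ℝ) : ℝ := ∑ i, ∑ j, (M i j)^2

/-- Divergence of a vector field. -/
def divg (u : E3 → E3) (x : E3) : ℝ := ∑ i, jac u x i i

/-- Projection on the first two coordinates. -/
def proj12 (x : E3) : E2 :=
  (x 0) • EuclideanSpace.single 0 1 + (x 1) • EuclideanSpace.single 1 1

/-- Embedding of the plane `{x₃ = 0}` into `ℝ³`: `x' ↦ (x'₁, x'₂, 0)`. -/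
def emb2 (x' : E2) : E3 :=
  (x' 0) • EuclideanSpace.single 0 1 + (x' 1) • EuclideanSpace.single 1 1

/-- Partial derivative of a scalar field in the k-th coordinate direction. -/
def pd (f : E3 → ℝ) (k : Fin 3) (x : E3) : ℝ := fderiv ℝ f x (EuclideanSpace.single k 1)

/-- `S` has boundary of Lipschitz class with constants r₀, E₀: at each boundary point `P`,
after a rigid change of coordinates sending `P` to `0`, the set is locally the open
epigraph of a Lipschitz function `ψ` with `ψ 0 = 0` and Lipschitz constant at most `E₀`. -/
def HasLipschitzBoundary (r₀ E₀ : ℝ) (S : Set E3) : Prop :=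
  ∀ P ∈ frontier S, ∃ (φ : E3 ≃ᵢ E3) (ψ : E2 → ℝ),
    φ P = 0 ∧ ψ 0 = 0 ∧ LipschitzOnWith (Real.toNNReal E₀) ψ (Metric.ball 0 r₀) ∧
    (φ '' S) ∩ Metric.ball 0 r₀ = {x ∈ Metric.ball (0 : E3) r₀ | ψ (proj12 x) < x 2}

/-- `S` has boundary of class C³ with constants r₀, E₀. -/
def HasC3Boundary (r₀ E₀ : ℝ) (S : Set E3) : Prop :=
  ∀ P ∈ frontier S, ∃ (φ : E3 ≃ᵢ E3) (ψ : E2 → ℝ),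
    φ P = 0 ∧ ψ 0 = 0 ∧ ContDiff ℝ 3 ψ ∧ fderiv ℝ ψ 0 = 0 ∧
    (∀ x' ∈ Metric.ball (0 : E2) r₀, ∀ k : ℕ, k ≤ 3 → ‖iteratedFDeriv ℝ k ψ x'‖ ≤ E₀) ∧
    (φ '' S) ∩ Metric.ball 0 r₀ = {x ∈ Metric.ball (0 : E3) r₀ | ψ (proj12 x) < x 2}

/-- Geometric a priori assumptions on a cavity: bounded open set, closure inside the lower
half-space, connected complement in the half-space, contained in `B⁻_{2D₀}(0)`, at distance
at least `D₀` from the plane `{x₃ = 0}`, with diameter less than `D₀`. -/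
def IsCavity (D₀ : ℝ) (C : Set E3) : Prop :=
  IsOpen C ∧ Bornology.IsBounded C ∧ closure C ⊆ lowerHalf ∧
  IsConnected (lowerHalf \ closure C) ∧ C ⊆ negBall (2*D₀) ∧
  (∀ x ∈ C, x 2 ≤ -D₀) ∧ Metric.diam C < D₀

/-- Lipschitz cavity with parameters r₀, E₀, D₀. -/
def IsLipschitzCavity (r₀ E₀ D₀ : ℝ) (C : Set E3) : Prop :=
  IsCavity D₀ C ∧ HasLipschitzBoundary r₀ E₀ C

/-- C³ cavity with parameters r₀, E₀, D₀. -/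
def IsC3Cavity (r₀ E₀ D₀ : ℝ) (C : Set E3) : Prop :=
  IsCavity D₀ C ∧ HasC3Boundary r₀ E₀ C

/-- Weak solution of the direct problem: `u` is C¹ on `Ω = ℝ³₋ \ C̄`, lies in the weighted
class, and satisfies the variational identity
`∫_Ω ℂ∇̂u : ∇̂v = −p ∫_C div v` for all smooth compactly supported test fields `v`. -/
def IsWeakSolution (lam mu p : ℝ) (C : Set E3) (u : E3 → E3) : Prop :=
  ContDiffOn ℝ 1 u (lowerHalf \ closure C) ∧
  IntegrableOn (fun x => ‖u x‖^2 / (1 + ‖x‖^2)) (lowerHalf \ closure C) ∧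
  IntegrableOn (fun x => frob2 (jac u x)) (lowerHalf \ closure C) ∧
  ∀ v : E3 → E3, ContDiff ℝ (⊤ : ℕ∞) v → HasCompactSupport v →
    ∫ x in lowerHalf \ closure C,
        (lam * divg u x * divg v x + 2 * mu * ∑ i, ∑ j, strain u x i j * strain v x i j)
      = -p * ∫ x in C, divg v x

section
open scoped ContDiff Topology ENNReal NNReal
open Filter

/-! ### Part 1 : calculus of partial derivatives -/

def lap (f : E3 → ℝ) (x : E3) : ℝ := ∑ k, pd (pd f k) k x

abbrev Sm (f : E3 → ℝ) : Prop := ContDiff ℝ ∞ f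

structure TestOn (O : Set E3) (φ : E3 → ℝ) : Prop where
  sm : Sm φ
  cs : HasCompactSupport φ
  ts : tsupport φ ⊆ O

lemma Sm.pd {f : E3 → ℝ} (hf : Sm f) (k : Fin 3) : Sm (pd f k) := by
  have : ContDiff ℝ ∞ (fderiv ℝ f) := hf.fderiv_right (by simp)
  exact this.clm_apply contDiff_const

lemma Sm.diff {f : E3 → ℝ} (hf : Sm f) : Differentiable ℝ f := hf.differentiable (by simp)

lemma Sm.lap {f : E3 → ℝ} (hf : Sm f) : Sm (lap f) := by
  unfold _root_.lap
  exact ContDiff.sum fun k _ => (hf.pd k).pd k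

lemma pd_zero_of_notMem {f : E3 → ℝ} {x : E3} (hx : x ∉ tsupport f) (k : Fin 3) : pd f k x = 0 := by
  have : fderiv ℝ f x = 0 := by
    by_contra h
    exact hx (support_fderiv_subset ℝ (f := f) h)
  simp [pd, this]

lemma tsupport_pd (f : E3 → ℝ) (k : Fin 3) : tsupport (pd f k) ⊆ tsupport f := by
  apply closure_minimal _ (isClosed_tsupport f)
  intro x hx
  by_contra h
  exact hx (pd_zero_of_notMem h k)

lemma tsupport_lap (f : E3 → ℝ) : tsupport (lap f) ⊆ tsupport f := by
  apply closure_minimal _ (isClosed_tsupport f)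
  intro x hx
  by_contra h
  apply hx
  unfold lap
  refine Finset.sum_eq_zero fun k _ => pd_zero_of_notMem (fun h' => h (tsupport_pd f k h')) k

lemma TestOn.pd {O : Set E3} {φ : E3 → ℝ} (h : TestOn O φ) (k : Fin 3) : TestOn O (pd φ k) :=
  ⟨h.sm.pd k, h.cs.mono' ((subset_tsupport _).trans (tsupport_pd φ k)), (tsupport_pd φ k).trans h.ts⟩

lemma TestOn.lap {O : Set E3} {φ : E3 → ℝ} (h : TestOn O φ) : TestOn O (lap φ) :=
  ⟨h.sm.lap, h.cs.mono' ((subset_tsupport _).trans (tsupport_lap φ)), (tsupport_lap φ).trans h.ts⟩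

lemma pd_add {f g : E3 → ℝ} (hf : Sm f) (hg : Sm g) (k : Fin 3) :
    pd (fun x => f x + g x) k = fun x => pd f k x + pd g k x := by
  funext x; simp only [pd]
  rw [fderiv_fun_add (hf.diff x) (hg.diff x)]; simp

lemma pd_sub {f g : E3 → ℝ} (hf : Sm f) (hg : Sm g) (k : Fin 3) :
    pd (fun x => f x - g x) k = fun x => pd f k x - pd g k x := by
  funext x; simp only [pd]
  rw [fderiv_fun_sub (hf.diff x) (hg.diff x)]; simp

lemma pd_const_mul {f : E3 → ℝ} (hf : Sm f) (c : ℝ) (k : Fin 3) :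
    pd (fun x => c * f x) k = fun x => c * pd f k x := by
  funext x; simp only [pd]
  rw [fderiv_const_mul (hf.diff x)]; simp

lemma pd_mul {f g : E3 → ℝ} (hf : Sm f) (hg : Sm g) (k : Fin 3) :
    pd (fun x => f x * g x) k = fun x => f x * pd g k x + pd f k x * g x := by
  funext x; simp only [pd]
  rw [fderiv_fun_mul (hf.diff x) (hg.diff x)]; simp; ring

lemma lap_sub {f g : E3 → ℝ} (hf : Sm f) (hg : Sm g) :
    lap (fun x => f x - g x) = fun x => lap f x - lap g x := by
  funext x; simp only [lap]
  rw [← Finset.sum_sub_distrib]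
  refine Finset.sum_congr rfl fun k _ => ?_
  rw [pd_sub hf hg, pd_sub (hf.pd k) (hg.pd k)]

lemma lap_const_mul {f : E3 → ℝ} (hf : Sm f) (c : ℝ) :
    lap (fun x => c * f x) = fun x => c * lap f x := by
  funext x; simp only [lap]
  rw [Finset.mul_sum]
  refine Finset.sum_congr rfl fun k _ => ?_
  rw [pd_const_mul hf, pd_const_mul (hf.pd k)]

lemma pd_comm {f : E3 → ℝ} (hf : Sm f) (j k : Fin 3) : pd (pd f j) k = pd (pd f k) j := by
  funext x
  have hd : Differentiable ℝ (fderiv ℝ f) := (hf.fderiv_right (m := ∞) (by simp)).differentiable (by simp)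
  have key : ∀ a b : Fin 3, pd (pd f a) b x
      = fderiv ℝ (fderiv ℝ f) x (EuclideanSpace.single b 1) (EuclideanSpace.single a 1) := by
    intro a b
    unfold pd
    rw [fderiv_clm_apply (hd x) (by fun_prop)]
    simp
  rw [key, key]
  exact ((hf.contDiffAt (x := x)).isSymmSndFDerivAt (n := ∞) (by simp only [minSmoothness_of_isRCLikeNormedField]; exact WithTop.coe_le_coe.2 le_top)) _ _

lemma pd_lap {f : E3 → ℝ} (hf : Sm f) (j : Fin 3) : pd (lap f) j = lap (pd f j) := by
  funext x
  have : lap f = fun x => ∑ k, pd (pd f k) k x := rfl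
  rw [this]
  have h1 : pd (fun x => ∑ k, pd (pd f k) k x) j x = ∑ k, pd (pd (pd f k) k) j x := by
    unfold pd
    rw [fderiv_fun_sum (fun k _ => ?_)]
    · simp
    · exact ((hf.pd k).pd k).diff x
  rw [h1, lap]
  refine Finset.sum_congr rfl fun k _ => ?_
  rw [pd_comm (hf.pd k) k j, pd_comm hf k j]

lemma Sm.comp_aff {f : E3 → ℝ} (hf : Sm f) (c : ℝ) (x : E3) : Sm (fun y => f (c • (y - x))) :=
  hf.comp (by fun_prop : ContDiff ℝ ∞ (fun y : E3 => c • (y - x)))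

lemma pd_aff {f : E3 → ℝ} (hf : Sm f) (c : ℝ) (x : E3) (k : Fin 3) :
    pd (fun y => f (c • (y - x))) k = fun y => c * pd f k (c • (y - x)) := by
  funext y
  have h1 : HasFDerivAt (fun y : E3 => c • (y - x)) (c • ContinuousLinearMap.id ℝ E3) y :=
    ((hasFDerivAt_id y).sub_const x).const_smul c
  have h2 := ((hf.diff (c • (y - x))).hasFDerivAt.comp y h1).fderiv
  simp only [pd]
  rw [show (fun y => f (c • (y - x))) = f ∘ (fun y => c • (y - x)) from rfl, h2]
  simp

lemma lap_aff {f : E3 → ℝ} (hf : Sm f) (c : ℝ) (x : E3) :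
    lap (fun y => f (c • (y - x))) = fun y => c ^ 2 * lap f (c • (y - x)) := by
  funext y; simp only [lap]
  rw [Finset.mul_sum]
  refine Finset.sum_congr rfl fun k _ => ?_
  rw [pd_aff hf, pd_const_mul ((hf.pd k).comp_aff c x), pd_aff (hf.pd k)]
  ring

lemma sm_radial {h : ℝ → ℝ} (hh : ContDiff ℝ ∞ h) : Sm (fun y => h (‖y‖ ^ 2)) :=
  hh.comp (contDiff_norm_sq ℝ)

lemma pd_radial {h : ℝ → ℝ} (hh : ContDiff ℝ ∞ h) (k : Fin 3) :
    pd (fun y => h (‖y‖ ^ 2)) k = fun y => 2 * y k * deriv h (‖y‖ ^ 2) := by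
  funext y
  have h1 : HasFDerivAt (fun y : E3 => ‖y‖ ^ 2) (2 • (innerSL ℝ y)) y :=
    (hasStrictFDerivAt_norm_sq y).hasFDerivAt
  have h2 : HasDerivAt h (deriv h (‖y‖ ^ 2)) (‖y‖ ^ 2) :=
    (hh.differentiable (by simp) _).hasDerivAt
  have h3 := (h2.comp_hasFDerivAt y h1).fderiv
  simp only [pd]
  rw [show (fun y : E3 => h (‖y‖ ^ 2)) = h ∘ (fun y => ‖y‖ ^ 2) from rfl, h3]
  simp [EuclideanSpace.inner_single_right]
  ring

lemma sm_coord (k : Fin 3) : Sm (fun y : E3 => y k) :=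
  (EuclideanSpace.proj (𝕜 := ℝ) k : E3 →L[ℝ] ℝ).contDiff

lemma pd_coord (k j : Fin 3) (x : E3) : pd (fun y : E3 => y k) j x = if k = j then 1 else 0 := by
  simp only [pd]
  rw [show (fun y : E3 => y k) = (EuclideanSpace.proj (𝕜 := ℝ) k : E3 →L[ℝ] ℝ) from rfl,
    ContinuousLinearMap.fderiv]
  simp

lemma contDiff_deriv {h : ℝ → ℝ} (hh : ContDiff ℝ ∞ h) : ContDiff ℝ ∞ (deriv h) :=
  ((contDiff_infty_iff_deriv).1 hh).2

lemma norm_sq_E3 (y : E3) : ‖y‖ ^ 2 = y 0 ^ 2 + y 1 ^ 2 + y 2 ^ 2 := by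
  rw [EuclideanSpace.norm_sq_eq]; simp [Fin.sum_univ_three]

lemma lap_radial {h : ℝ → ℝ} (hh : ContDiff ℝ ∞ h) :
    lap (fun y => h (‖y‖ ^ 2)) =
      fun y => (fun s => 6 * deriv h s + 4 * s * deriv (deriv h) s) (‖y‖ ^ 2) := by
  funext y
  have h1 := contDiff_deriv hh
  have : ∀ k, pd (pd (fun y : E3 => h (‖y‖ ^ 2)) k) k y
      = 2 * deriv h (‖y‖ ^ 2) + 4 * (y k) ^ 2 * deriv (deriv h) (‖y‖ ^ 2) := by
    intro k
    have e1 : Sm (fun y : E3 => 2 * y k) := contDiff_const.mul (sm_coord k)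
    rw [pd_radial hh, pd_mul e1 (sm_radial h1), pd_radial h1, pd_const_mul (sm_coord k)]
    simp only [pd_coord, if_true]
    ring
  simp only [lap, this, Fin.sum_univ_three]
  rw [norm_sq_E3]; ring

end

section
open scoped ContDiff Topology ENNReal NNReal
open Filter

/-! ### Part 2 : the biharmonic kernel -/

def hk (s : ℝ) : ℝ := √s * (1 - Real.smoothTransition (2 - 2 * s))
def bk (s : ℝ) : ℝ := 6 * deriv hk s + 4 * s * deriv (deriv hk) s
def kk (s : ℝ) : ℝ := 6 * deriv bk s + 4 * s * deriv (deriv bk) s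

lemma hk_eq_zero {s : ℝ} (hs : s ≤ 1/2) : hk s = 0 := by
  unfold hk; rw [Real.smoothTransition.one_of_one_le (by linarith)]; simp

lemma hk_eq_sqrt {s : ℝ} (hs : 1 ≤ s) : hk s = √s := by
  unfold hk; rw [Real.smoothTransition.zero_of_nonpos (by linarith)]; simp

lemma hk_smooth : ContDiff ℝ ∞ hk := by
  rw [contDiff_iff_contDiffAt]
  intro s
  rcases lt_or_ge s (1/2) with h | h
  · have : hk =ᶠ[𝓝 s] fun _ => 0 := by
      filter_upwards [Iio_mem_nhds h] with t ht using hk_eq_zero (le_of_lt ht)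
    exact (contDiffAt_const).congr_of_eventuallyEq this
  · have h1 : ContDiffAt ℝ ∞ (fun s : ℝ => √s) s := Real.contDiffAt_sqrt (by linarith)
    have h2 : ContDiffAt ℝ ∞ (fun s : ℝ => 1 - Real.smoothTransition (2 - 2 * s)) s := by
      have : ContDiff ℝ ∞ (fun s : ℝ => Real.smoothTransition (2 - 2 * s)) :=
        Real.smoothTransition.contDiff.comp (by fun_prop)
      exact (contDiff_const.sub this).contDiffAt
    exact h1.mul h2

lemma bk_smooth : ContDiff ℝ ∞ bk := by
  have h1 := contDiff_deriv hk_smooth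
  have h2 := contDiff_deriv h1
  unfold bk; fun_prop

lemma kk_smooth : ContDiff ℝ ∞ kk := by
  have h1 := contDiff_deriv bk_smooth
  have h2 := contDiff_deriv h1
  unfold kk; fun_prop

lemma deriv_eq_of_gt {f g : ℝ → ℝ} {g' : ℝ → ℝ} (h : ∀ s, 1 < s → f s = g s)
    (hg : ∀ s, 1 < s → HasDerivAt g (g' s) s) : ∀ s, 1 < s → deriv f s = g' s := by
  intro s hs
  have : f =ᶠ[𝓝 s] g := by
    filter_upwards [Ioi_mem_nhds hs] with t ht using h t ht
  rw [this.deriv_eq, (hg s hs).deriv]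

lemma rpow_der (a c : ℝ) (s : ℝ) (hs : 1 < s) :
    HasDerivAt (fun s : ℝ => c * s ^ a) (c * (a * s ^ (a - 1))) s :=
  (Real.hasDerivAt_rpow_const (Or.inl (by linarith))).const_mul c

lemma bk_eq {s : ℝ} (hs : 1 < s) : bk s = 2 * s ^ (-(1/2) : ℝ) := by
  have h0 : ∀ s, 1 < s → hk s = 1 * s ^ (1/2 : ℝ) := fun s hs => by
    rw [hk_eq_sqrt hs.le, Real.sqrt_eq_rpow, one_mul]
  have h1 := deriv_eq_of_gt h0 (fun s hs => rpow_der (1/2) 1 s hs)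
  have h1' : ∀ s, 1 < s → deriv hk s = (1/2) * s ^ (-(1/2) : ℝ) := fun s hs => by
    rw [h1 s hs]; norm_num
  have h2 := deriv_eq_of_gt h1' (fun s hs => rpow_der _ _ s hs)
  unfold bk
  rw [h1' s hs, h2 s hs]
  have : s ^ (-(1/2) : ℝ) = s * s ^ (-(1/2) - 1 : ℝ) := by
    rw [Real.rpow_sub_one (by linarith)]; field_simp
  rw [this]; ring

lemma dbk_eq {s : ℝ} (hs : 1 < s) : deriv bk s = - s ^ (-(3/2) : ℝ) := by
  have h1 := deriv_eq_of_gt (fun s hs => bk_eq hs) (fun s hs => rpow_der _ _ s hs) s hs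
  rw [h1]; norm_num; ring_nf

lemma kk_eq_zero' {s : ℝ} (hs : 1 < s) : kk s = 0 := by
  have h0 : ∀ s, 1 < s → deriv bk s = (-1) * s ^ (-(3/2) : ℝ) := fun s hs => by
    rw [dbk_eq hs]; ring
  have h1 := deriv_eq_of_gt h0 (fun s hs => rpow_der _ _ s hs) s hs
  unfold kk
  rw [dbk_eq hs, h1]
  have : s ^ (-(3/2) : ℝ) = s * s ^ (-(3/2) - 1 : ℝ) := by
    rw [Real.rpow_sub_one (by linarith)]; field_simp
  rw [this]; ring

def HH (y : E3) : ℝ := hk (‖y‖ ^ 2)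
def KK (y : E3) : ℝ := kk (‖y‖ ^ 2)

lemma HH_smooth : Sm HH := sm_radial hk_smooth
lemma KK_smooth : Sm KK := sm_radial kk_smooth
lemma lap_lap_HH : lap (lap HH) = KK := by
  have h1 : lap HH = fun y => bk (‖y‖ ^ 2) := lap_radial hk_smooth
  rw [h1, lap_radial bk_smooth]; rfl

lemma KK_zero {y : E3} (hy : 1 < ‖y‖) : KK y = 0 := kk_eq_zero' (by nlinarith)

lemma KK_supp : tsupport KK ⊆ closedBall 0 1 := by
  apply closure_minimal _ isClosed_closedBall
  intro y hy
  by_contra h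
  exact hy (KK_zero (by simpa using h))

lemma KK_cs : HasCompactSupport KK :=
  HasCompactSupport.of_support_subset_isCompact (isCompact_closedBall (0 : E3) 1)
    ((subset_tsupport _).trans KK_supp)

def kap : ℝ := ∫ y, KK y

lemma kap_ne : kap ≠ 0 := by
  unfold kap
  have h := integral_fun_norm_addHaar (volume : Measure E3) (fun r => kk (r ^ 2))
  have h' : (∫ y, KK y) = ∫ y : E3, (fun r => kk (r ^ 2)) ‖y‖ := rfl
  rw [h', h]
  have hdim : Module.finrank ℝ E3 = 3 := by simp
  rw [hdim]
  have hint : ∫ y in Ioi (0:ℝ), y ^ (3 - 1) • kk (y ^ 2) = ∫ y in (0:ℝ)..2, y ^ 2 * kk (y ^ 2) := by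
    rw [intervalIntegral.integral_of_le (by norm_num)]
    simp only [smul_eq_mul, Nat.reduceSub]
    apply setIntegral_eq_of_subset_of_forall_sdiff_eq_zero measurableSet_Ioi Ioc_subset_Ioi_self
    intro x hx
    have : 2 < x := by
      by_contra h; exact hx.2 ⟨hx.1, not_lt.1 h⟩
    rw [kk_eq_zero' (by nlinarith)]; simp
  have hF : ∀ x ∈ uIcc (0:ℝ) 2, HasDerivAt (fun r : ℝ => 2 * r ^ 3 * deriv bk (r ^ 2)) (x ^ 2 * kk (x ^ 2)) x := by
    intro x _
    have h1 : HasDerivAt (deriv bk) (deriv (deriv bk) (x ^ 2)) (x ^ 2) :=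
      ((contDiff_deriv bk_smooth).differentiable (by simp) _).hasDerivAt
    have h2 : HasDerivAt (fun r : ℝ => r ^ 2) (2 * x) x := by simpa using hasDerivAt_pow 2 x
    have h3 : HasDerivAt (fun r : ℝ => 2 * r ^ 3) (2 * (3 * x ^ 2)) x := by
      simpa using (hasDerivAt_pow 3 x).const_mul 2
    have h4 : HasDerivAt (fun r : ℝ => deriv bk (r ^ 2)) (deriv (deriv bk) (x ^ 2) * (2 * x)) x :=
      HasDerivAt.comp (h₂ := deriv bk) (h := fun r : ℝ => r ^ 2) x h1 h2
    have := h3.mul h4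
    refine this.congr_deriv ?_
    simp only [Function.comp, kk]; ring
  have hc : Continuous fun x : ℝ => x ^ 2 * kk (x ^ 2) := by
    have := kk_smooth.continuous
    fun_prop
  rw [hint, intervalIntegral.integral_eq_sub_of_hasDerivAt hF (hc.intervalIntegrable _ _)]
  rw [dbk_eq (by norm_num)]
  have h1 : (0:ℝ) < (2 ^ 2 : ℝ) ^ (-(3/2) : ℝ) := by positivity
  have h2 : 0 < (volume : Measure E3).real (ball 0 1) := by
    rw [measureReal_def]
    exact ENNReal.toReal_pos (measure_ball_pos _ _ one_pos).ne' measure_ball_lt_top.ne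
  simp only [smul_eq_mul, nsmul_eq_mul]
  have : 2 * (2:ℝ) ^ 3 * -(2 ^ 2 : ℝ) ^ (-(3/2) : ℝ) - 2 * 0 ^ 3 * deriv bk (0 ^ 2) < 0 := by
    nlinarith
  have := mul_neg_of_pos_of_neg h2 this
  push_cast
  intro h; linarith

end

section
open scoped ContDiff Topology ENNReal NNReal
open Filter

/-! ### Part 3 : Weyl lemma -/

def cnv (f k : E3 → ℝ) (x : E3) : ℝ := ∫ y, f y * k (x - y)

lemma cnv_eq (f k : E3 → ℝ) :
    cnv f k = convolution f k (ContinuousLinearMap.mul ℝ ℝ) volume := by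
  funext x; rfl

lemma cnv_sm {f k : E3 → ℝ} (hf : LocallyIntegrable f volume) (hk : Sm k)
    (hc : HasCompactSupport k) : Sm (cnv f k) := by
  rw [cnv_eq]
  exact hc.contDiff_convolution_right (ContinuousLinearMap.mul ℝ ℝ) hf hk

lemma cnv_pd {f k : E3 → ℝ} (hf : LocallyIntegrable f volume) (hk : Sm k)
    (hc : HasCompactSupport k) (j : Fin 3) : pd (cnv f k) j = cnv f (pd k j) := by
  funext x
  have h := hc.hasFDerivAt_convolution_right (ContinuousLinearMap.mul ℝ ℝ) hf (hk.of_le (by simp)) x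
  rw [← cnv_eq] at h
  simp only [pd]
  rw [h.fderiv, convolution_precompR_apply (ContinuousLinearMap.mul ℝ ℝ) hf (hc.fderiv ℝ)
    (hk.continuous_fderiv (by simp))]
  rfl

def kr (r : ℝ) (z : E3) : ℝ := r⁻¹ ^ 3 * KK (r⁻¹ • z)

lemma kr_even (r : ℝ) (z : E3) : kr r (-z) = kr r z := by
  simp [kr, KK, smul_neg]

lemma kr_sm (r : ℝ) : Sm (kr r) := by
  have : ContDiff ℝ ∞ (fun z : E3 => r⁻¹ • z) := by fun_prop
  exact contDiff_const.mul (KK_smooth.comp this)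

lemma kr_zero {r : ℝ} (hr : 0 < r) {z : E3} (hz : r < ‖z‖) : kr r z = 0 := by
  unfold kr; rw [KK_zero]; · simp
  rw [norm_smul, norm_inv, Real.norm_of_nonneg hr.le, inv_mul_eq_div, one_lt_div hr]; exact hz

lemma kr_cs {r : ℝ} (hr : 0 < r) : HasCompactSupport (kr r) := by
  apply HasCompactSupport.intro (isCompact_closedBall (0 : E3) r)
  intro z hz
  exact kr_zero hr (by simpa using hz)

lemma HH_eq {y : E3} (hy : 1 ≤ ‖y‖) : HH y = ‖y‖ := by
  unfold HH; rw [hk_eq_sqrt (by nlinarith), Real.sqrt_sq (norm_nonneg _)]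

/-- scaled H -/
def Hr (r : ℝ) (x y : E3) : ℝ := r * HH (r⁻¹ • (y - x))

lemma Hr_sm (r : ℝ) (x : E3) : Sm (Hr r x) := contDiff_const.mul (HH_smooth.comp_aff _ _)

lemma Hr_eq {r : ℝ} (hr : 0 < r) {x y : E3} (h : r ≤ ‖y - x‖) : Hr r x y = ‖y - x‖ := by
  unfold Hr
  have h1 : ‖r⁻¹ • (y - x)‖ = r⁻¹ * ‖y - x‖ := by
    rw [norm_smul, norm_inv, Real.norm_of_nonneg hr.le]
  rw [HH_eq, h1]
  · field_simp
  · rw [h1, inv_mul_eq_div, one_le_div hr]; exact h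

lemma lap_lap_Hr {r : ℝ} (hr : 0 < r) (x : E3) :
    lap (lap (Hr r x)) = fun y => kr r (x - y) := by
  unfold Hr
  rw [lap_const_mul (HH_smooth.comp_aff _ _), lap_aff HH_smooth,
    lap_const_mul (contDiff_const.mul (HH_smooth.lap.comp_aff _ _)),
    lap_const_mul (HH_smooth.lap.comp_aff _ _), lap_aff HH_smooth.lap, lap_lap_HH]
  funext y
  rw [← neg_sub y x, kr_even]
  unfold kr; field_simp

lemma closedBall_sub_of_le {x : E3} {r s : ℝ} {O : Set E3} (h : closedBall x s ⊆ O) (hrs : r ≤ s) :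
    closedBall x r ⊆ O := (closedBall_subset_closedBall hrs).trans h

def Biharm (O : Set E3) (f : E3 → ℝ) : Prop := ∀ φ, TestOn O φ → ∫ x, f x * lap (lap φ) x = 0

lemma integrable_mul_cs {f k : E3 → ℝ} (hf : LocallyIntegrable f volume) (hk : Continuous k)
    (hc : HasCompactSupport k) : Integrable (fun y => f y * k y) := by
  have := hf.integrable_smul_left_of_hasCompactSupport hk hc
  simpa [mul_comm] using this

lemma shift_cs {k : E3 → ℝ} (hc : HasCompactSupport k) (x : E3) :
    HasCompactSupport (fun y => k (x - y)) :=
  hc.comp_homeomorph (Homeomorph.subLeft x)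

lemma psi_indep {O : Set E3} {f : E3 → ℝ} (hf : LocallyIntegrable f volume) (hb : Biharm O f)
    {x : E3} {r s : ℝ} (hr : 0 < r) (hs : 0 < s) (h : closedBall x r ⊆ O) (h' : closedBall x s ⊆ O) :
    cnv f (kr r) x = cnv f (kr s) x := by
  have hm : closedBall x (max r s) ⊆ O := by
    rcases max_choice r s with h1 | h1 <;> rw [h1] <;> assumption
  have hz : ∀ y ∉ closedBall x (max r s), Hr r x y - Hr s x y = 0 := by
    intro y hy
    have : max r s < ‖y - x‖ := by simpa [dist_eq_norm] using hy
    rw [Hr_eq hr ((le_max_left _ _).trans this.le), Hr_eq hs ((le_max_right _ _).trans this.le), sub_self]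
  have hT : TestOn O (fun y => Hr r x y - Hr s x y) := by
    refine ⟨(Hr_sm r x).sub (Hr_sm s x), HasCompactSupport.intro (isCompact_closedBall x (max r s)) hz, ?_⟩
    refine (closure_minimal ?_ isClosed_closedBall).trans hm
    intro y hy; by_contra hh; exact hy (hz y hh)
  have h1 := hb _ hT
  rw [lap_sub (Hr_sm r x) (Hr_sm s x), lap_sub (Hr_sm r x).lap (Hr_sm s x).lap,
    lap_lap_Hr hr, lap_lap_Hr hs] at h1
  have hi : ∀ {r : ℝ}, 0 < r → Integrable (fun y => f y * kr r (x - y)) := fun {r} hr =>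
    integrable_mul_cs hf ((kr_sm r).continuous.comp (by fun_prop)) (shift_cs (kr_cs hr) x)
  simp only [mul_sub] at h1
  rw [integral_sub (hi hr) (hi hs)] at h1
  unfold cnv; linarith

lemma kr_int {r : ℝ} (hr : 0 < r) (x : E3) : ∫ y, kr r (x - y) = kap := by
  rw [integral_sub_left_eq_self (kr r) volume x]
  unfold kr
  rw [integral_const_mul, Measure.integral_comp_inv_smul]
  have : Module.finrank ℝ E3 = 3 := by simp
  rw [this, abs_of_pos (by positivity)]
  unfold kap; simp only [smul_eq_mul]; field_simp

lemma KK_bdd : ∃ M, 0 ≤ M ∧ ∀ y, |KK y| ≤ M := by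
  obtain ⟨M, hM⟩ := KK_cs.exists_bound_of_continuous KK_smooth.continuous
  exact ⟨M, (norm_nonneg _).trans (hM 0), hM⟩

lemma vol_cb (x : E3) {r : ℝ} (hr : 0 < r) :
    volume.real (closedBall x r) = r ^ 3 * volume.real (closedBall (0:E3) 1) := by
  rw [measureReal_def, Measure.addHaar_closedBall' _ _ hr.le, measureReal_def]
  simp [ENNReal.toReal_mul, hr.le]

lemma weyl_ae {O : Set E3} {f : E3 → ℝ} (hf : LocallyIntegrable f volume) (hb : Biharm O f) :
    ∀ᵐ x, ∀ r > 0, closedBall x r ⊆ O → cnv f (kr r) x = kap * f x := by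
  obtain ⟨M, hM0, hM⟩ := KK_bdd
  filter_upwards [IsUnifLocDoublingMeasure.ae_tendsto_average_norm_sub (μ := volume) hf 1] with x hx r hr hO
  have hδ0 : Tendsto (fun n : ℕ => r / ((n:ℝ) + 1)) atTop (𝓝 0) := 
    tendsto_const_nhds.div_atTop (tendsto_atTop_add_const_right _ _ tendsto_natCast_atTop_atTop)
  have hpos : ∀ n : ℕ, 0 < r / ((n:ℝ) + 1) := fun n => by positivity
  have hδ : Tendsto (fun n : ℕ => r / ((n:ℝ) + 1)) atTop (𝓝[>] 0) :=
    tendsto_nhdsWithin_iff.2 ⟨hδ0, Eventually.of_forall hpos⟩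
  have h1 := hx (fun _ : ℕ => x) (fun n : ℕ => r / ((n:ℝ) + 1)) hδ
    (Eventually.of_forall fun n => by simp; positivity)
  have key : ∀ n : ℕ, |cnv f (kr r) x - kap * f x| ≤
      M * volume.real (closedBall (0:E3) 1) * ⨍ y in closedBall x (r / ((n:ℝ) + 1)), ‖f y - f x‖ := by
    intro n
    set s := r / ((n:ℝ) + 1) with hs
    have hs0 : 0 < s := hpos n
    have hsr : s ≤ r := div_le_self hr.le (by linarith [(Nat.cast_nonneg n : (0:ℝ) ≤ n)])
    rw [psi_indep hf hb hr hs0 hO (closedBall_sub_of_le hO hsr)]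
    have hc : Continuous fun y => kr s (x - y) := (kr_sm s).continuous.comp (by fun_prop)
    have hi1 : Integrable (fun y => f y * kr s (x - y)) := integrable_mul_cs hf hc (shift_cs (kr_cs hs0) x)
    have hi2 : Integrable (fun y => kr s (x - y)) := hc.integrable_of_hasCompactSupport (shift_cs (kr_cs hs0) x)
    have e1 : cnv f (kr s) x - kap * f x = ∫ y, (f y - f x) * kr s (x - y) := by
      rw [← kr_int hs0 x]; unfold cnv
      rw [← integral_mul_const, ← integral_sub hi1 (hi2.mul_const _)]
      congr 1; funext y; ring
    have e2 : ∫ y, (f y - f x) * kr s (x - y) = ∫ y in closedBall x s, (f y - f x) * kr s (x - y) := by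
      symm
      apply setIntegral_eq_integral_of_forall_compl_eq_zero
      intro y hy
      have : s < ‖x - y‖ := by rw [← dist_eq_norm, dist_comm]; simpa using hy
      rw [kr_zero hs0 this, mul_zero]
    rw [e1, e2]
    have hfi : IntegrableOn (fun y => ‖f y - f x‖) (closedBall x s) := by
      have := (hf.integrableOn_isCompact (isCompact_closedBall x s)).sub
        (integrableOn_const (C := f x) (measure_closedBall_lt_top.ne))
      exact this.norm
    have e3 : ‖∫ y in closedBall x s, (f y - f x) * kr s (x - y)‖ ≤
        ∫ y in closedBall x s, s⁻¹ ^ 3 * M * ‖f y - f x‖ := by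
      apply norm_integral_le_of_norm_le (hfi.const_mul _)
      refine Eventually.of_forall fun y => ?_
      rw [norm_mul, mul_comm]
      apply mul_le_mul_of_nonneg_right _ (norm_nonneg _)
      unfold kr
      rw [norm_mul, Real.norm_of_nonneg (by positivity)]
      exact mul_le_mul_of_nonneg_left (hM _) (by positivity)
    refine e3.trans (le_of_eq ?_)
    rw [integral_const_mul, setAverage_eq, vol_cb x hs0, smul_eq_mul]
    have hv : volume.real (closedBall (0:E3) 1) ≠ 0 := by
      rw [measureReal_def]
      exact (ENNReal.toReal_pos (measure_closedBall_pos _ _ one_pos).ne' measure_closedBall_lt_top.ne).ne'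
    field_simp
  have h2 := ge_of_tendsto' (h1.const_mul (M * volume.real (closedBall (0:E3) 1))) key
  rw [mul_zero] at h2
  have := abs_nonpos_iff.1 h2
  linarith

lemma kr_pd {r : ℝ} (j : Fin 3) : pd (kr r) j = fun z => r⁻¹ ^ 4 * pd KK j (r⁻¹ • z) := by
  have h : kr r = fun z => r⁻¹ ^ 3 * (fun y => KK (r⁻¹ • (y - 0))) z := by funext z; simp [kr]
  rw [h, pd_const_mul (KK_smooth.comp_aff _ _), pd_aff KK_smooth]
  funext z; simp; ring

/-- the smooth representative -/
def wrep (O : Set E3) (f : E3 → ℝ) (x : E3) : ℝ :=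
  open Classical in
  if h : ∃ r > 0, closedBall x r ⊆ O then kap⁻¹ * cnv f (kr h.choose) x else 0

lemma wrep_eq {O : Set E3} {f : E3 → ℝ} (hf : LocallyIntegrable f volume) (hb : Biharm O f)
    {x : E3} {r : ℝ} (hr : 0 < r) (h : closedBall x r ⊆ O) : wrep O f x = kap⁻¹ * cnv f (kr r) x := by
  have h' : ∃ r > 0, closedBall x r ⊆ O := ⟨r, hr, h⟩
  unfold wrep
  rw [dif_pos h', psi_indep hf hb h'.choose_spec.1 hr h'.choose_spec.2 h]

lemma wrep_ev {O : Set E3} {f : E3 → ℝ} (hf : LocallyIntegrable f volume) (hb : Biharm O f)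
    {x : E3} {r : ℝ} (hr : 0 < r) (h : ball x r ⊆ O) :
    wrep O f =ᶠ[𝓝 x] fun z => kap⁻¹ * cnv f (kr (r/2)) z := by
  filter_upwards [ball_mem_nhds x (half_pos hr)] with z hz
  apply wrep_eq hf hb (half_pos hr)
  refine Subset.trans ?_ h
  intro w hw
  simp only [mem_ball, mem_closedBall] at *
  linarith [dist_triangle w z x]

lemma wrep_sm {O : Set E3} (hO : IsOpen O) {f : E3 → ℝ} (hf : LocallyIntegrable f volume)
    (hb : Biharm O f) : ContDiffOn ℝ ∞ (wrep O f) O := by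
  intro x hx
  obtain ⟨r, hr, h⟩ := Metric.isOpen_iff.1 hO x hx
  have h1 : Sm (fun z => kap⁻¹ * cnv f (kr (r/2)) z) :=
    contDiff_const.mul (cnv_sm hf (kr_sm _) (kr_cs (half_pos hr)))
  exact ((h1.contDiffAt).congr_of_eventuallyEq (wrep_ev hf hb hr h)).contDiffWithinAt

lemma wrep_ae {O : Set E3} (hO : IsOpen O) {f : E3 → ℝ} (hf : LocallyIntegrable f volume)
    (hb : Biharm O f) : ∀ᵐ x, x ∈ O → f x = wrep O f x := by
  filter_upwards [weyl_ae hf hb] with x hx hxO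
  obtain ⟨r, hr, h⟩ := Metric.nhds_basis_closedBall.mem_iff.1 (hO.mem_nhds hxO)
  rw [wrep_eq hf hb hr h, hx r hr h]
  field_simp [kap_ne]

lemma cs_lint {α : Type*} [MeasurableSpace α] {μ : Measure α} {f g : α → ℝ≥0∞}
    (hf : AEMeasurable f μ) (hg : AEMeasurable g μ) :
    (∫⁻ a, f a * g a ∂μ) ^ 2 ≤ (∫⁻ a, f a ^ 2 ∂μ) * ∫⁻ a, g a ^ 2 ∂μ := by
  have h := ENNReal.lintegral_mul_le_Lp_mul_Lq μ (Real.HolderConjugate.two_two) hf hg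
  have h2 := pow_le_pow_left' h 2
  refine h2.trans (le_of_eq ?_)
  rw [mul_pow, ← ENNReal.rpow_natCast, ← ENNReal.rpow_mul, ← ENNReal.rpow_natCast, ← ENNReal.rpow_mul]
  norm_num

lemma pdKK_bdd : ∃ M, 0 ≤ M ∧ ∀ j y, |pd KK j y| ≤ M := by
  have : ∀ j, ∃ M, 0 ≤ M ∧ ∀ y, |pd KK j y| ≤ M := fun j => by
    have ht : TestOn univ KK := ⟨KK_smooth, KK_cs, subset_univ _⟩
    obtain ⟨M, hM⟩ := (ht.pd j).cs.exists_bound_of_continuous (ht.pd j).sm.continuous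
    exact ⟨M, (norm_nonneg _).trans (hM 0), hM⟩
  choose M h0 h using this
  exact ⟨∑ j, M j, Finset.sum_nonneg fun j _ => h0 j, fun j y => (h j y).trans
    (Finset.single_le_sum (fun j _ => h0 j) (Finset.mem_univ j))⟩

lemma pd_congr {f g : E3 → ℝ} {x : E3} (h : f =ᶠ[𝓝 x] g) (j : Fin 3) : pd f j x = pd g j x := by
  simp only [pd]; rw [h.fderiv_eq]

/-- interior derivative estimate -/
lemma wrep_est : ∃ M : ℝ, 0 ≤ M ∧ ∀ (O : Set E3) (f : E3 → ℝ), LocallyIntegrable f volume →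
    Biharm O f → ∀ (x : E3) (r : ℝ), 0 < r → ball x r ⊆ O → ∀ j,
    ‖pd (wrep O f) j x‖ₑ ^ 2 ≤ ENNReal.ofReal (M * r⁻¹ ^ 5) * ∫⁻ y in ball x r, ‖f y‖ₑ ^ 2 := by
  obtain ⟨M, hM0, hM⟩ := pdKK_bdd
  set V := volume.real (ball (0:E3) 1) with hV
  have hV0 : 0 ≤ V := measureReal_nonneg
  refine ⟨(kap⁻¹ * 16 * M) ^ 2 * 1 * V, by positivity, ?_⟩
  intro O f hf hb x r hr hO j
  set s := r / 2 with hs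
  have hs0 : 0 < s := half_pos hr
  have hsm := cnv_sm hf (kr_sm s) (kr_cs hs0)
  have e1 : pd (wrep O f) j x = kap⁻¹ * ∫ y, f y * (s⁻¹ ^ 4 * pd KK j (s⁻¹ • (x - y))) := by
    rw [pd_congr (wrep_ev hf hb hr hO), pd_const_mul hsm, cnv_pd hf (kr_sm s) (kr_cs hs0), kr_pd]
    rfl
  have hz : ∀ y ∉ ball x r, f y * (s⁻¹ ^ 4 * pd KK j (s⁻¹ • (x - y))) = 0 := by
    intro y hy
    have h1 : r ≤ ‖x - y‖ := by rw [← dist_eq_norm, dist_comm]; simpa using hy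
    have : s⁻¹ • (x - y) ∉ tsupport KK := by
      intro h
      have := KK_supp h
      rw [mem_closedBall, dist_zero_right, norm_smul, norm_inv, Real.norm_of_nonneg hs0.le,
        inv_mul_eq_div, div_le_one hs0] at this
      linarith
    rw [pd_zero_of_notMem this]; simp
  have e2 : ‖pd (wrep O f) j x‖ₑ ≤ ENNReal.ofReal (|kap⁻¹| * s⁻¹ ^ 4 * M) * ∫⁻ y in ball x r, ‖f y‖ₑ * 1 := by
    rw [e1, ← setIntegral_eq_integral_of_forall_compl_eq_zero hz, enorm_mul,
      ← lintegral_const_mul' _ _ ENNReal.ofReal_ne_top]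
    refine (mul_le_mul_right (enorm_integral_le_lintegral_enorm _) _).trans ?_
    rw [← lintegral_const_mul' _ _ enorm_ne_top]
    apply lintegral_mono
    intro y
    simp only [mul_one]
    rw [enorm_mul, ← mul_assoc, mul_right_comm]
    gcongr
    rw [← enorm_mul, Real.enorm_eq_ofReal_abs]
    apply ENNReal.ofReal_le_ofReal
    rw [abs_mul, abs_mul, abs_of_pos (by positivity : 0 < s⁻¹ ^ 4), ← mul_assoc]
    exact mul_le_mul_of_nonneg_left (hM _ _) (by positivity)
  have e3 := cs_lint (μ := volume.restrict (ball x r)) (f := fun y => ‖f y‖ₑ) (g := fun _ => 1)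
    (hf.aestronglyMeasurable.restrict.enorm) aemeasurable_const
  refine (pow_le_pow_left' e2 2).trans ?_
  rw [mul_pow]
  refine (mul_le_mul_right e3 _).trans ?_
  rw [mul_comm (∫⁻ y in ball x r, ‖f y‖ₑ ^ 2), ← mul_assoc]
  apply mul_le_mul_left
  simp only [one_pow, lintegral_const, one_mul, Measure.restrict_apply_univ]
  rw [← ENNReal.ofReal_toReal (measure_ball_lt_top (μ := volume) (x := x) (r := r)).ne,
    ← ENNReal.ofReal_pow (by positivity), ← ENNReal.ofReal_mul (by positivity)]
  apply ENNReal.ofReal_le_ofReal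
  have hv : (volume (ball x r)).toReal = r ^ 3 * V := by
    rw [Measure.addHaar_ball _ _ hr.le, ENNReal.toReal_mul]
    simp [hV, measureReal_def, hr.le]
  rw [hv, mul_pow, mul_pow, sq_abs, hs]
  apply le_of_eq
  field_simp
  ring

end

section
open scoped ContDiff Topology ENNReal NNReal
open Filter

/-! ### Part 4 : integration by parts and the weighted interior estimate -/

lemma mul_test_c1 {O : Set E3} (hO : IsOpen O) {g φ : E3 → ℝ} (hg : ContDiffOn ℝ 1 g O) (hφ : TestOn O φ) :
    ContDiff ℝ 1 (fun x => g x * φ x) := by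
  rw [contDiff_iff_contDiffAt]
  intro x
  by_cases hx : x ∈ O
  · exact (hg.contDiffAt (hO.mem_nhds hx)).mul (hφ.sm.of_le (by simp)).contDiffAt
  · have hx' : x ∉ tsupport φ := fun h => hx (hφ.ts h)
    have : (fun x => g x * φ x) =ᶠ[𝓝 x] fun _ => 0 := by
      filter_upwards [notMem_tsupport_iff_eventuallyEq.1 hx'] with y hy
      rw [hy]; simp
    exact contDiffAt_const.congr_of_eventuallyEq this

lemma int_pd_zero {G : E3 → ℝ} (hG : ContDiff ℝ 1 G) (hc : HasCompactSupport G) (k : Fin 3) :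
    ∫ x, pd G k x = 0 := by
  have hi : Integrable (fun x => fderiv ℝ G x (EuclideanSpace.single k 1)) := by
    apply Continuous.integrable_of_hasCompactSupport
    · exact (hG.continuous_fderiv (by simp)).clm_apply continuous_const
    · exact hc.fderiv_apply ℝ _
  have h := integral_mul_fderiv_eq_neg_fderiv_mul_of_integrable (𝕜 := ℝ) (μ := volume)
    (f := G) (g := fun _ : E3 => (1:ℝ)) (v := EuclideanSpace.single k 1) (by simpa using hi) (by simp)
    (by simpa using hG.continuous.integrable_of_hasCompactSupport hc)
    (fun x _ => hG.differentiable (by simp) x) (fun x _ => by fun_prop)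
  simp at h
  exact h

lemma mul_pd_test_c {O : Set E3} (hO : IsOpen O) {g φ : E3 → ℝ} (hg : ContinuousOn g O) (hφ : TestOn O φ) :
    Continuous (fun x => g x * φ x) := by
  rw [continuous_iff_continuousAt]
  intro x
  by_cases hx : x ∈ O
  · exact (hg.continuousAt (hO.mem_nhds hx)).mul hφ.sm.continuous.continuousAt
  · have hx' : x ∉ tsupport φ := fun h => hx (hφ.ts h)
    have : (fun x => g x * φ x) =ᶠ[𝓝 x] fun _ => 0 := by
      filter_upwards [notMem_tsupport_iff_eventuallyEq.1 hx'] with y hy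
      rw [hy]; simp
    exact continuousAt_const.congr this.symm

lemma mul_test_int {O : Set E3} (hO : IsOpen O) {g φ : E3 → ℝ} (hg : ContinuousOn g O) (hφ : TestOn O φ) :
    Integrable (fun x => g x * φ x) :=
  (mul_pd_test_c hO hg hφ).integrable_of_hasCompactSupport hφ.cs.mul_left

lemma pd_contOn {O : Set E3} (hO : IsOpen O) {g : E3 → ℝ} (hg : ContDiffOn ℝ 1 g O) (k : Fin 3) :
    ContinuousOn (pd g k) O :=
  (hg.continuousOn_fderiv_of_isOpen hO (by simp)).clm_apply continuousOn_const

lemma ibp {O : Set E3} (hO : IsOpen O) {g φ : E3 → ℝ} (hg : ContDiffOn ℝ 1 g O) (hφ : TestOn O φ)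
    (k : Fin 3) : ∫ x, g x * pd φ k x = - ∫ x, pd g k x * φ x := by
  have h := int_pd_zero (mul_test_c1 hO hg hφ) hφ.cs.mul_left k
  have e : (fun x => pd (fun x => g x * φ x) k x) = fun x => g x * pd φ k x + pd g k x * φ x := by
    funext x
    by_cases hx : x ∈ O
    · have h1 : DifferentiableAt ℝ g x := (hg.contDiffAt (hO.mem_nhds hx)).differentiableAt (by simp)
      simp only [pd]
      rw [fderiv_fun_mul h1 (hφ.sm.diff x)]; simp; ring
    · have hx' : x ∉ tsupport φ := fun h => hx (hφ.ts h)
      have : (fun x => g x * φ x) =ᶠ[𝓝 x] fun _ => 0 := by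
        filter_upwards [notMem_tsupport_iff_eventuallyEq.1 hx'] with y hy
        rw [hy]; simp
      rw [pd_congr this, pd_zero_of_notMem hx', image_eq_zero_of_notMem_tsupport hx']
      simp [pd]
  rw [e, integral_add (mul_test_int hO hg.continuousOn (hφ.pd k))
    (mul_test_int hO (pd_contOn hO hg k) hφ)] at h
  linarith

/-- a continuous function on an open set orthogonal to all test functions vanishes -/
lemma ae_zero_of_test {O : Set E3} (hO : IsOpen O) {g : E3 → ℝ} (hg : LocallyIntegrableOn g O)
    (h : ∀ φ, TestOn O φ → ∫ x, g x * φ x = 0) : ∀ᵐ x, x ∈ O → g x = 0 := by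
  apply hO.ae_eq_zero_of_integral_contDiff_smul_eq_zero hg
  intro φ h1 h2 h3
  have := h φ ⟨h1, h2, h3⟩
  simpa [mul_comm] using this

lemma zero_of_ae {O : Set E3} (hO : IsOpen O) {g : E3 → ℝ} (hg : ContinuousOn g O)
    (h : ∀ᵐ x, x ∈ O → g x = 0) : ∀ x ∈ O, g x = 0 := by
  have h1 : g =ᵐ[volume.restrict O] (fun _ => (0:ℝ)) := (ae_restrict_iff' hO.measurableSet).2 h
  exact Measure.eqOn_open_of_ae_eq h1 hO hg continuousOn_const

lemma zero_of_test {O : Set E3} (hO : IsOpen O) {g : E3 → ℝ} (hg : ContinuousOn g O)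
    (h : ∀ φ, TestOn O φ → ∫ x, g x * φ x = 0) : ∀ x ∈ O, g x = 0 :=
  zero_of_ae hO hg (ae_zero_of_test hO (hg.locallyIntegrableOn hO.measurableSet) h)

lemma JJ : ∃ M : ℝ, 0 ≤ M ∧ ∀ (O : Set E3) (f : E3 → ℝ), IsOpen O → Oᶜ.Nonempty →
    LocallyIntegrable f volume → Biharm O f → ∀ j,
    ∫⁻ x in O, ENNReal.ofReal (infDist x Oᶜ) ^ 2 * ‖pd (wrep O f) j x‖ₑ ^ 2 ≤
      ENNReal.ofReal M * ∫⁻ x in O, ‖f x‖ₑ ^ 2 := by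
  obtain ⟨M, hM0, hM⟩ := wrep_est
  set V := volume.real (ball (0:E3) 1) with hV
  have hV0 : 0 ≤ V := measureReal_nonneg
  refine ⟨M * 32 * (27/8) * V, by positivity, ?_⟩
  intro O f hO hne hf hb j
  set d : E3 → ℝ := fun x => infDist x Oᶜ with hd
  have hdc : Continuous d := continuous_infDist_pt _
  have hdpos : ∀ x ∈ O, 0 < d x := fun x hx =>
    (hO.isClosed_compl.notMem_iff_infDist_pos hne).1 (by simpa using hx)
  have hball : ∀ x, ball x (d x / 2) ⊆ O := fun x y hy => by
    by_contra h
    have h1 : d x ≤ dist x y := infDist_le_dist_of_mem h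
    rw [mem_ball, dist_comm] at hy
    have := dist_nonneg (x := x) (y := y)
    linarith
  have hlip : ∀ x y, d x ≤ d y + dist x y := fun x y => infDist_le_infDist_add_dist
  set W : E3 × E3 → ℝ≥0∞ := fun z => {z : E3 × E3 | dist z.2 z.1 < d z.1 / 2}.indicator
    (fun z => ENNReal.ofReal (M * 32 * (d z.1)⁻¹ ^ 3)) z with hW
  have hWm : Measurable W := by
    apply Measurable.indicator
    · have := hdc.measurable
      fun_prop
    · apply IsOpen.measurableSet
      exact isOpen_lt (by fun_prop) (by fun_prop)
  have s1 : ∀ x ∈ O, ENNReal.ofReal (d x) ^ 2 * ‖pd (wrep O f) j x‖ₑ ^ 2 ≤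
      ∫⁻ y in O, W (x, y) * ‖f y‖ₑ ^ 2 := by
    intro x hx
    have h0 := hdpos x hx
    refine (mul_le_mul_right (hM O f hf hb x (d x / 2) (half_pos h0) (hball x) j) _).trans ?_
    rw [← mul_assoc, ← ENNReal.ofReal_pow h0.le, ← ENNReal.ofReal_mul (by positivity),
      ← lintegral_const_mul' _ _ ENNReal.ofReal_ne_top]
    refine le_trans ?_ (lintegral_mono_set (hball x))
    apply setLIntegral_mono_ae' measurableSet_ball
    refine Eventually.of_forall fun y hy => ?_
    have : W (x, y) = ENNReal.ofReal (M * 32 * (d x)⁻¹ ^ 3) := by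
      rw [hW]; simp only
      rw [indicator_of_mem]; exact hy
    rw [this]
    apply mul_le_mul_left
    apply ENNReal.ofReal_le_ofReal
    apply le_of_eq; field_simp; ring
  refine (setLIntegral_mono_ae' hO.measurableSet (Eventually.of_forall s1)).trans ?_
  rw [lintegral_lintegral_swap]
  swap
  · apply AEMeasurable.mul
    · exact hWm.aemeasurable
    · have h1 : AEMeasurable (fun y => ‖f y‖ₑ ^ 2) (volume.restrict O) :=
        (hf.aestronglyMeasurable.restrict.enorm).pow_const 2
      exact h1.comp_snd
  rw [← lintegral_const_mul' _ _ ENNReal.ofReal_ne_top]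
  apply setLIntegral_mono_ae' hO.measurableSet
  refine Eventually.of_forall fun y hy => ?_
  rw [lintegral_mul_const]
  swap
  · exact hWm.comp (by fun_prop)
  apply mul_le_mul_left
  have h0 := hdpos y hy
  have hle : ∀ x, W (x, y) ≤ (ball y (d y)).indicator
      (fun _ => ENNReal.ofReal (M * 32 * (27/8) * (d y)⁻¹ ^ 3)) x := by
    intro x
    rw [hW]; simp only
    by_cases hx : dist y x < d x / 2
    · rw [indicator_of_mem (by exact hx)]
      have h1 := hlip y x
      have h2 := hlip x y
      have h4 := dist_comm x y
      rw [indicator_of_mem]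
      · apply ENNReal.ofReal_le_ofReal
        have h3 : (d x)⁻¹ ≤ (3/2) * (d y)⁻¹ := by
          have : (2/3) * d y ≤ d x := by linarith
          have h5 := inv_anti₀ (by positivity) this
          rw [mul_inv] at h5; norm_num at h5 ⊢; linarith
        have h6 : 0 ≤ (d x)⁻¹ := inv_nonneg.2 (by linarith [dist_nonneg (x := y) (y := x)])
        calc M * 32 * (d x)⁻¹ ^ 3 ≤ M * 32 * ((3/2) * (d y)⁻¹) ^ 3 := by gcongr
          _ = _ := by ring
      · rw [mem_ball]; linarith
    · rw [indicator_of_notMem (by exact hx)]; exact zero_le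
  refine (lintegral_mono hle).trans ?_
  refine (setLIntegral_le_lintegral _ _).trans ?_
  rw [lintegral_indicator measurableSet_ball, setLIntegral_const, Measure.addHaar_ball _ _ h0.le,
    ← ENNReal.ofReal_toReal (measure_ball_lt_top (μ := volume) (x := (0:E3)) (r := 1)).ne,
    ← ENNReal.ofReal_mul (by positivity), ← ENNReal.ofReal_mul (by positivity)]
  apply ENNReal.ofReal_le_ofReal
  have : (volume (ball (0:E3) 1)).toReal = V := rfl
  rw [this]
  simp only [finrank_euclideanSpace, Fintype.card_fin]
  apply le_of_eq; field_simp

end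

section
open scoped ContDiff Topology ENNReal NNReal
open Filter

/-! ### Part 5 : Hardy inequality along lines -/

lemma hardy1 {f f' : ℝ → ℝ} {a b : ℝ} (hab : a ≤ b) (hf : ∀ t ∈ Icc a b, HasDerivAt f (f' t) t)
    (hc : ContinuousOn f' (Icc a b)) :
    ∫ t in a..b, f t ^ 2 ≤ 2 * (b - a) * f b ^ 2 + 4 * ∫ t in a..b, (t - a) ^ 2 * f' t ^ 2 := by
  have hfc : ContinuousOn f (Icc a b) := fun t ht => (hf t ht).continuousAt.continuousWithinAt
  have hu : uIcc a b = Icc a b := uIcc_of_le hab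
  have i1 : IntervalIntegrable (fun t => f t ^ 2) volume a b :=
    ContinuousOn.intervalIntegrable (by rw [hu]; fun_prop)
  have i2 : IntervalIntegrable (fun t => 2 * (t - a) * f t * f' t) volume a b :=
    ContinuousOn.intervalIntegrable (by rw [hu]; fun_prop)
  have i3 : IntervalIntegrable (fun t => (t - a) ^ 2 * f' t ^ 2) volume a b :=
    ContinuousOn.intervalIntegrable (by rw [hu]; fun_prop)
  have h1 : ∀ t ∈ uIcc a b, HasDerivAt (fun t => (t - a) * f t ^ 2) (f t ^ 2 + 2 * (t - a) * f t * f' t) t := by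
    intro t ht
    rw [hu] at ht
    have := ((hasDerivAt_id t).sub_const a).mul ((hf t ht).pow 2)
    refine this.congr_deriv ?_
    simp; ring
  have h2 := intervalIntegral.integral_eq_sub_of_hasDerivAt h1 (i1.add i2)
  rw [intervalIntegral.integral_add i1 i2] at h2
  have h3 : ∫ t in a..b, -(2 * (t - a) * f t * f' t) ≤
      ∫ t in a..b, ((1/2) * f t ^ 2 + 2 * ((t - a) ^ 2 * f' t ^ 2)) := by
    apply intervalIntegral.integral_mono_on hab i2.neg ((i1.const_mul _).add (i3.const_mul _))
    intro t _
    simp only [Pi.neg_apply]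
    nlinarith [sq_nonneg (f t + 2 * (t - a) * f' t)]
  rw [intervalIntegral.integral_neg, intervalIntegral.integral_add (i1.const_mul _) (i3.const_mul _),
    intervalIntegral.integral_const_mul, intervalIntegral.integral_const_mul] at h3
  simp at h2
  linarith

lemma hardy2 {f f' : ℝ → ℝ} {a B : ℝ} (hB : 0 < B) (hf : ∀ t ∈ Icc a (a + 2 * B), HasDerivAt f (f' t) t)
    (hc : ContinuousOn f' (Icc a (a + 2 * B))) :
    ∫ t in a..(a+B), f t ^ 2 ≤ 4 * (∫ t in (a+B)..(a+2*B), f t ^ 2) +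
      4 * ∫ t in a..(a+2*B), (t - a) ^ 2 * f' t ^ 2 := by
  have hfc : ContinuousOn f (Icc a (a+2*B)) := fun t ht => (hf t ht).continuousAt.continuousWithinAt
  have i1 : IntervalIntegrable (fun t => f t ^ 2) volume a (a+2*B) :=
    ContinuousOn.intervalIntegrable (by rw [uIcc_of_le (by linarith)]; fun_prop)
  have i3 : IntervalIntegrable (fun t => (t - a) ^ 2 * f' t ^ 2) volume a (a+2*B) :=
    ContinuousOn.intervalIntegrable (by rw [uIcc_of_le (by linarith)]; fun_prop)
  have hsub : ∀ {b}, b ∈ Icc (a+B) (a+2*B) → uIcc a b ⊆ uIcc a (a+2*B) := by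
    intro b hb
    rw [uIcc_of_le (by linarith [hb.1]), uIcc_of_le (by linarith)]
    exact Icc_subset_Icc_right hb.2
  have key : ∀ b ∈ Icc (a+B) (a+2*B), ∫ t in a..(a+B), f t ^ 2 ≤
      4 * B * f b ^ 2 + 4 * ∫ t in a..(a+2*B), (t - a) ^ 2 * f' t ^ 2 := by
    intro b hb
    have hab : a ≤ b := by linarith [hb.1]
    have h1 := hardy1 hab (fun t ht => hf t ⟨ht.1, ht.2.trans hb.2⟩) (hc.mono (Icc_subset_Icc_right hb.2))
    have h2 : ∫ t in a..(a+B), f t ^ 2 ≤ ∫ t in a..b, f t ^ 2 :=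
      intervalIntegral.integral_mono_interval le_rfl (by linarith) hb.1
        (Eventually.of_forall fun t => by positivity) (i1.mono_set (hsub hb))
    have h3 : ∫ t in a..b, (t - a) ^ 2 * f' t ^ 2 ≤ ∫ t in a..(a+2*B), (t - a) ^ 2 * f' t ^ 2 :=
      intervalIntegral.integral_mono_interval le_rfl hab hb.2
        (Eventually.of_forall fun t => by positivity) i3
    have h4 : 2 * (b - a) * f b ^ 2 ≤ 4 * B * f b ^ 2 := by
      apply mul_le_mul_of_nonneg_right _ (sq_nonneg _); linarith [hb.2]
    linarith
  have i4 : IntervalIntegrable (fun t => f t ^ 2) volume (a+B) (a+2*B) := i1.mono_set (by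
    rw [uIcc_of_le (by linarith), uIcc_of_le (by linarith)]
    exact Icc_subset_Icc_left (by linarith))
  have h := intervalIntegral.integral_mono_on (a := a+B) (b := a+2*B) (by linarith)
    intervalIntegrable_const ((i4.const_mul (4*B)).add (intervalIntegrable_const)) key
  rw [intervalIntegral.integral_add (i4.const_mul _) intervalIntegrable_const,
    intervalIntegral.integral_const_mul] at h
  simp only [intervalIntegral.integral_const, smul_eq_mul] at h
  have h5 : a + 2 * B - (a + B) = B := by ring
  rw [h5] at h
  have h6 : B * (∫ t in a..(a+B), f t ^ 2) ≤ B * (4 * (∫ t in (a+B)..(a+2*B), f t ^ 2) +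
      4 * ∫ t in a..(a+2*B), (t - a) ^ 2 * f' t ^ 2) := by linarith
  exact le_of_mul_le_mul_left h6 hB

lemma enorm_sq_eq (r : ℝ) : ‖r‖ₑ ^ 2 = ENNReal.ofReal (r ^ 2) := by
  rw [Real.enorm_eq_ofReal_abs, ← ENNReal.ofReal_pow (abs_nonneg _), sq_abs]

lemma ofReal_int_Ioc {g : ℝ → ℝ} {a b : ℝ} (hab : a ≤ b) (hg : ContinuousOn g (Icc a b))
    (h0 : ∀ t, 0 ≤ g t) :
    ENNReal.ofReal (∫ t in a..b, g t) = ∫⁻ t in Ioc a b, ENNReal.ofReal (g t) := by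
  rw [intervalIntegral.integral_of_le hab]
  exact ofReal_integral_eq_lintegral_ofReal
    ((hg.integrableOn_Icc).mono_set Ioc_subset_Icc_self) (Eventually.of_forall h0)

lemma hardy3 {f f' : ℝ → ℝ} {a B : ℝ} (hB : 0 < B) (hf : ∀ t ∈ Icc a (a + 2 * B), HasDerivAt f (f' t) t)
    (hc : ContinuousOn f' (Icc a (a + 2 * B))) :
    ∫⁻ t in Ioc a (a+B), ‖f t‖ₑ ^ 2 ≤ 4 * (∫⁻ t in Ioc (a+B) (a+2*B), ‖f t‖ₑ ^ 2) +
      4 * ∫⁻ t in Ioc a (a+2*B), ENNReal.ofReal (t - a) ^ 2 * ‖f' t‖ₑ ^ 2 := by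
  have hfc : ContinuousOn f (Icc a (a+2*B)) := fun t ht => (hf t ht).continuousAt.continuousWithinAt
  have h := ENNReal.ofReal_le_ofReal (hardy2 hB hf hc)
  have e : ∫⁻ t in Ioc a (a+2*B), ENNReal.ofReal (t - a) ^ 2 * ‖f' t‖ₑ ^ 2 =
      ∫⁻ t in Ioc a (a+2*B), ENNReal.ofReal ((t - a) ^ 2 * f' t ^ 2) := by
    apply setLIntegral_congr_fun measurableSet_Ioc
    intro t ht
    simp only
    rw [enorm_sq_eq, ENNReal.ofReal_mul (by positivity), ENNReal.ofReal_pow (p := t - a) (by linarith [ht.1])]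
  rw [e]
  simp only [enorm_sq_eq]
  have hfc2 : ContinuousOn (fun t => f t ^ 2) (Icc a (a+2*B)) := hfc.pow 2
  rw [← ofReal_int_Ioc (by linarith) (hfc2.mono (Icc_subset_Icc_right (by linarith))) (fun t => by positivity),
    ← ofReal_int_Ioc (by linarith) (hfc2.mono (Icc_subset_Icc_left (by linarith))) (fun t => by positivity),
    ← ofReal_int_Ioc (by linarith) (by fun_prop) (fun t => by positivity)]
  refine h.trans (le_of_eq ?_)
  have p1 : 0 ≤ ∫ t in (a+B)..(a+2*B), f t ^ 2 :=
    intervalIntegral.integral_nonneg (by linarith) fun t _ => by positivity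
  have p2 : 0 ≤ ∫ t in a..(a+2*B), (t - a) ^ 2 * f' t ^ 2 :=
    intervalIntegral.integral_nonneg (by linarith) fun t _ => by positivity
  rw [ENNReal.ofReal_add (by positivity) (by positivity), ENNReal.ofReal_mul (by norm_num),
    ENNReal.ofReal_mul (by norm_num)]
  norm_num

lemma window {g : E3 → ℝ≥0∞} (hg : Measurable g) (ν : E3) {L : ℝ} :
    ∫⁻ y, ∫⁻ t in Ioc 0 L, g (y + t • ν) = ENNReal.ofReal L * ∫⁻ x, g x := by
  rw [lintegral_lintegral_swap]
  · simp only [lintegral_add_right_eq_self g, setLIntegral_const, Real.volume_Ioc, sub_zero]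
    rw [mul_comm]
  · apply Measurable.aemeasurable
    apply hg.comp; fun_prop

/-- squared gradient as an extended nonnegative real -/
def gsq (F : E3 → ℝ) (x : E3) : ℝ≥0∞ := ∑ k, ‖pd F k x‖ₑ ^ 2

lemma meas_pd (F : E3 → ℝ) (k : Fin 3) : Measurable (pd F k) := measurable_fderiv_apply_const ℝ F _

lemma meas_gsq (F : E3 → ℝ) : Measurable (gsq F) :=
  Finset.measurable_sum _ fun k _ => ((meas_pd F k).enorm.pow_const 2)

lemma fderiv_eq_sum (F : E3 → ℝ) (x v : E3) : fderiv ℝ F x v = ∑ k, v k * pd F k x := by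
  have : v = ∑ k, v k • EuclideanSpace.single k (1:ℝ) := by
    ext i; simp [Finset.sum_apply, Pi.single_apply]
  conv_lhs => rw [this]
  simp [pd]

lemma gsq_eq (F : E3 → ℝ) (x : E3) : gsq F x = ENNReal.ofReal (∑ k, pd F k x ^ 2) := by
  unfold gsq
  rw [ENNReal.ofReal_sum_of_nonneg (fun k _ => sq_nonneg _)]
  simp [enorm_sq_eq]

lemma fderiv_le_gsq (F : E3 → ℝ) (x : E3) {v : E3} (hv : ‖v‖ ≤ 1) : ‖fderiv ℝ F x v‖ₑ ^ 2 ≤ gsq F x := by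
  rw [gsq_eq, enorm_sq_eq, fderiv_eq_sum]
  apply ENNReal.ofReal_le_ofReal
  refine (Finset.sum_mul_sq_le_sq_mul_sq _ _ _).trans ?_
  have : ∑ k, v k ^ 2 ≤ 1 := by
    have := EuclideanSpace.norm_sq_eq v
    simp at this; rw [← this]; exact pow_le_one₀ (norm_nonneg _) hv
  nlinarith [Finset.sum_nonneg (fun k (_ : k ∈ Finset.univ) => sq_nonneg (pd F k x))]

lemma meas_ind {N : Set E3} (hN : IsOpen N) {F : E3 → ℝ} (hF : ContinuousOn F N) :
    Measurable (N.indicator F) := by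
  classical
  rw [← piecewise_eq_indicator]
  exact hF.measurable_piecewise continuousOn_const hN.measurableSet

lemma Hd {ν : E3} {B c : ℝ} (hB : 0 < B) (hc : 0 < c) (hν : ‖ν‖ ≤ 1) {A N Z : Set E3}
    (hA : MeasurableSet A) (hN : IsOpen N) (hZ : MeasurableSet Z) (hZN : Z ⊆ N) {F : E3 → ℝ}
    (hF : ContDiffOn ℝ 1 F N) {w : E3 → ℝ} (hw : Measurable w)
    (h1 : ∀ y ∈ A, ∀ t ∈ Icc 0 (2*B), y + t • ν ∈ N)
    (h2 : ∀ y ∈ A, ∀ t ∈ Ioc B (2*B), y + t • ν ∈ Z)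
    (h3 : ∀ y ∈ A, ∀ t ∈ Icc 0 (2*B), c * t ≤ w (y + t • ν)) :
    ∫⁻ x in A, ‖F x‖ₑ ^ 2 ≤ 12 * (∫⁻ x in Z, ‖F x‖ₑ ^ 2) +
      ENNReal.ofReal (12 * c⁻¹ ^ 2) * ∫⁻ x in N, ENNReal.ofReal (w x) ^ 2 * gsq F x := by
  have hAN : A ⊆ N := fun y hy => by simpa using h1 y hy 0 ⟨le_rfl, by linarith⟩
  have hFm := meas_ind hN hF.continuousOn
  set gA : E3 → ℝ≥0∞ := A.indicator (fun x => ‖N.indicator F x‖ₑ ^ 2) with hgA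
  set gZ : E3 → ℝ≥0∞ := Z.indicator (fun x => ‖N.indicator F x‖ₑ ^ 2) with hgZ
  set gN : E3 → ℝ≥0∞ := N.indicator (fun x => ENNReal.ofReal (w x) ^ 2 * gsq F x) with hgN
  have mA : Measurable gA := (hFm.enorm.pow_const 2).indicator hA
  have mZ : Measurable gZ := (hFm.enorm.pow_const 2).indicator hZ
  have mN : Measurable gN :=
    ((hw.ennreal_ofReal.pow_const 2).mul (meas_gsq F)).indicator hN.measurableSet
  have eA : ∫⁻ x in A, ‖F x‖ₑ ^ 2 = ∫⁻ x, gA x := by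
    rw [hgA, lintegral_indicator hA]
    exact setLIntegral_congr_fun hA fun x hx => by rw [indicator_of_mem (hAN hx)]
  have eZ : ∫⁻ x in Z, ‖F x‖ₑ ^ 2 = ∫⁻ x, gZ x := by
    rw [hgZ, lintegral_indicator hZ]
    exact setLIntegral_congr_fun hZ fun x hx => by rw [indicator_of_mem (hZN hx)]
  have eN : ∫⁻ x in N, ENNReal.ofReal (w x) ^ 2 * gsq F x = ∫⁻ x, gN x := by
    rw [hgN, lintegral_indicator hN.measurableSet]
  -- one line
  have line : ∀ y, ∫⁻ t in Ioc 0 B, gA (y + t • ν) ≤ 4 * (∫⁻ t in Ioc 0 (3*B), gZ (y + t • ν)) +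
      ENNReal.ofReal (4 * c⁻¹ ^ 2) * ∫⁻ t in Ioc 0 (3*B), gN (y + t • ν) := by
    intro y
    set R := 4 * (∫⁻ t in Ioc 0 (3*B), gZ (y + t • ν)) +
      ENNReal.ofReal (4 * c⁻¹ ^ 2) * ∫⁻ t in Ioc 0 (3*B), gN (y + t • ν) with hR
    set T := {t : ℝ | t ∈ Ioc 0 B ∧ y + t • ν ∈ A} with hT
    have step : ∀ a ∈ T, ∫⁻ t in Ioc a B, gA (y + t • ν) ≤ R := by
      intro a ha
      have hin : ∀ t ∈ Icc a (a+2*B), y + t • ν ∈ N ∧ c * (t - a) ≤ w (y + t • ν) := by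
        intro t ht
        have e : y + t • ν = (y + a • ν) + (t - a) • ν := by rw [sub_smul]; abel
        rw [e]
        exact ⟨h1 _ ha.2 _ ⟨by linarith [ht.1], by linarith [ht.2]⟩,
          h3 _ ha.2 _ ⟨by linarith [ht.1], by linarith [ht.2]⟩⟩
      have hinZ : ∀ t ∈ Ioc (a+B) (a+2*B), y + t • ν ∈ Z := by
        intro t ht
        have e : y + t • ν = (y + a • ν) + (t - a) • ν := by rw [sub_smul]; abel
        rw [e]
        exact h2 _ ha.2 _ ⟨by linarith [ht.1], by linarith [ht.2]⟩
      have hder : ∀ t ∈ Icc a (a+2*B), HasDerivAt (fun t : ℝ => F (y + t • ν)) (fderiv ℝ F (y + t • ν) ν) t := by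
        intro t ht
        have d1 : HasFDerivAt F (fderiv ℝ F (y + t • ν)) (y + t • ν) :=
          ((hF.contDiffAt (hN.mem_nhds (hin t ht).1)).differentiableAt (by simp)).hasFDerivAt
        have d2 : HasDerivAt (fun t : ℝ => y + t • ν) ν t := by
          simpa using ((hasDerivAt_id t).smul_const ν).const_add y
        exact d1.comp_hasDerivAt t d2
      have hcont : ContinuousOn (fun t : ℝ => fderiv ℝ F (y + t • ν) ν) (Icc a (a+2*B)) := by
        have d0 := hF.continuousOn_fderiv_of_isOpen hN (by simp)
        exact (d0.comp (by fun_prop) fun t ht => (hin t ht).1).clm_apply continuousOn_const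
      have H := hardy3 hB hder hcont
      have l1 : ∫⁻ t in Ioc a B, gA (y + t • ν) ≤ ∫⁻ t in Ioc a (a+B), ‖F (y + t • ν)‖ₑ ^ 2 := by
        refine (lintegral_mono_set (Ioc_subset_Ioc_right (by linarith [ha.1.1] : B ≤ a + B))).trans ?_
        apply lintegral_mono
        intro t
        simp only [hgA]
        by_cases h : y + t • ν ∈ A
        · rw [indicator_of_mem h, indicator_of_mem (hAN h)]
        · rw [indicator_of_notMem h]; exact zero_le
      have l2 : ∫⁻ t in Ioc (a+B) (a+2*B), ‖F (y + t • ν)‖ₑ ^ 2 ≤ ∫⁻ t in Ioc 0 (3*B), gZ (y + t • ν) := by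
        refine le_trans ?_ (lintegral_mono_set (Ioc_subset_Ioc (by linarith [ha.1.1] : 0 ≤ a + B)
          (by linarith [ha.1.2] : a + 2*B ≤ 3*B)))
        apply setLIntegral_mono_ae' measurableSet_Ioc
        refine Eventually.of_forall fun t ht => ?_
        simp only [hgZ]
        rw [indicator_of_mem (hinZ t ht), indicator_of_mem (hZN (hinZ t ht))]
      have l3 : ∫⁻ t in Ioc a (a+2*B), ENNReal.ofReal (t - a) ^ 2 * ‖fderiv ℝ F (y + t • ν) ν‖ₑ ^ 2 ≤
          ENNReal.ofReal (c⁻¹ ^ 2) * ∫⁻ t in Ioc 0 (3*B), gN (y + t • ν) := by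
        rw [← lintegral_const_mul' _ _ ENNReal.ofReal_ne_top]
        refine le_trans ?_ (lintegral_mono_set (Ioc_subset_Ioc (by linarith [ha.1.1] : 0 ≤ a)
          (by linarith [ha.1.2] : a + 2*B ≤ 3*B)))
        apply setLIntegral_mono_ae' measurableSet_Ioc
        refine Eventually.of_forall fun t ht => ?_
        simp only [hgN]
        have hh := hin t ⟨ht.1.le, ht.2⟩
        rw [indicator_of_mem hh.1, ← mul_assoc]
        refine mul_le_mul' ?_ (fderiv_le_gsq F _ hν)
        rw [ENNReal.ofReal_pow (by positivity), ← mul_pow, ← ENNReal.ofReal_mul (by positivity)]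
        apply pow_le_pow_left'
        apply ENNReal.ofReal_le_ofReal
        rw [inv_mul_eq_div, le_div_iff₀ hc]; linarith [hh.2]
      refine l1.trans (H.trans ?_)
      rw [hR]
      refine add_le_add (mul_le_mul_right l2 _) ?_
      refine (mul_le_mul_right l3 _).trans (le_of_eq ?_)
      rw [← mul_assoc, ENNReal.ofReal_mul (by norm_num)]; norm_num
    by_cases hTn : T.Nonempty
    swap
    · have : ∫⁻ t in Ioc 0 B, gA (y + t • ν) = 0 := by
        rw [setLIntegral_congr_fun (g := fun _ => 0) measurableSet_Ioc]
        · simp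
        · intro t ht
          simp only [hgA]
          rw [indicator_of_notMem]
          intro h; exact hTn ⟨t, ht, h⟩
      rw [this]; exact zero_le
    have hbd : BddBelow T := ⟨0, fun t ht => ht.1.1.le⟩
    obtain ⟨u, hu1, hu2, hu3⟩ := exists_seq_tendsto_sInf hTn hbd
    -- restrict to t > inf
    have e1 : ∫⁻ t in Ioc 0 B, gA (y + t • ν) ≤ ∫⁻ t in ⋃ n, Ioc (u n) B, gA (y + t • ν) := by
      have : ∫⁻ t in Ioc 0 B, gA (y + t • ν) ≤ ∫⁻ t in Ioc (sInf T) B, gA (y + t • ν) := by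
        rw [← lintegral_indicator measurableSet_Ioc, ← lintegral_indicator measurableSet_Ioc]
        apply lintegral_mono_ae
        have hne : ∀ᵐ t : ℝ, t ≠ sInf T := by
          simp [ae_iff]
        filter_upwards [hne] with t ht
        by_cases h : t ∈ Ioc 0 B
        · rw [indicator_of_mem h]
          by_cases h' : y + t • ν ∈ A
          · rw [indicator_of_mem]
            exact ⟨lt_of_le_of_ne (csInf_le hbd ⟨h, h'⟩) ht.symm, h.2⟩
          · simp only [hgA]; rw [indicator_of_notMem h']; exact zero_le
        · rw [indicator_of_notMem h]; exact zero_le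
      refine this.trans (lintegral_mono_set ?_)
      intro t ht
      obtain ⟨n, hn⟩ := (hu2.eventually_lt_const ht.1).exists
      exact mem_iUnion.2 ⟨n, hn, ht.2⟩
    refine e1.trans ?_
    rw [setLIntegral_iUnion_of_directed]
    · exact iSup_le fun n => step _ (hu3 n)
    · apply Monotone.directed_le
      intro n m hnm
      exact Ioc_subset_Ioc_left (hu1 hnm)
  have tot := lintegral_mono (μ := (volume : Measure E3)) line
  rw [window mA] at tot
  have m1 : Measurable fun y => ∫⁻ t in Ioc 0 (3*B), gZ (y + t • ν) :=
    Measurable.lintegral_prod_right' (f := fun p : E3 × ℝ => gZ (p.1 + p.2 • ν)) (mZ.comp (by fun_prop))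
  rw [lintegral_add_left (m1.const_mul _), lintegral_const_mul _ m1,
    lintegral_const_mul' _ _ ENNReal.ofReal_ne_top, window mZ, window mN] at tot
  rw [eA, eZ, eN]
  have hB0 : ENNReal.ofReal B ≠ 0 := by simpa using hB
  have hBt : ENNReal.ofReal B ≠ ⊤ := ENNReal.ofReal_ne_top
  rw [← ENNReal.mul_le_mul_iff_right hB0 hBt]
  refine tot.trans (le_of_eq ?_)
  rw [ENNReal.ofReal_mul (by norm_num : (0:ℝ) ≤ 3), ENNReal.ofReal_mul (by norm_num : (0:ℝ) ≤ 4),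
    ENNReal.ofReal_mul (by norm_num : (0:ℝ) ≤ 12)]
  have e3 : ENNReal.ofReal 3 = 3 := by norm_num
  have e4 : ENNReal.ofReal 4 = 4 := by norm_num
  have e12 : ENNReal.ofReal 12 = 12 := by norm_num
  rw [e3, e4, e12]
  ring

end

section
open scoped ContDiff Topology ENNReal NNReal
open Filter
open scoped Pointwise

/-! ### Part 6 : geometry of Lipschitz cavities -/

/-- at every boundary point there is an outward cone condition -/
def ConeC (C : Set E3) (r t₀ c : ℝ) : Prop :=
  ∀ P ∈ frontier C, ∃ ν : E3, ‖ν‖ = 1 ∧ ∀ y ∉ C, dist y P < r → ∀ t, 0 < t → t ≤ t₀ →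
    ∀ z, dist z (y + t • ν) < c * t → z ∉ C

lemma proj12_norm_le (x : E3) : ‖proj12 x‖ ≤ ‖x‖ := by
  apply le_of_sq_le_sq _ (norm_nonneg _) 
  rw [norm_sq_E3, EuclideanSpace.norm_sq_eq]
  simp [proj12, Fin.sum_univ_two]
  positivity

lemma proj12_sub (x y : E3) : proj12 x - proj12 y = proj12 (x - y) := by
  ext i; fin_cases i <;> simp [proj12]

lemma coord_le_norm (x : E3) (i : Fin 3) : |x i| ≤ ‖x‖ := by
  have := EuclideanSpace.norm_eq x
  exact PiLp.norm_apply_le x i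

lemma star_of_lip {r₀ E₀ : ℝ} (hr : 0 < r₀) (hE : 0 < E₀) {C : Set E3}
    (h : HasLipschitzBoundary r₀ E₀ C) : ConeC C (r₀/2) (r₀/4) (1/(2*(1+E₀))) := by
  intro P hP
  obtain ⟨φ, ψ, h0, hψ0, hL, hC⟩ := h P hP
  set A := φ.toRealAffineIsometryEquiv with hA
  have hAφ : ∀ x, A x = φ x := fun x => rfl
  set L := A.linearIsometryEquiv with hLdef
  have hmap : ∀ x v, φ (x + v) = φ x + L v := by
    intro x v
    have := A.map_vadd x v
    rw [← hAφ, ← hAφ]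
    simpa [add_comm] using this
  refine ⟨L.symm (-EuclideanSpace.single 2 1), by simp, ?_⟩
  intro y hy hyP t ht0 ht z hz hzC
  have hc0 : (0:ℝ) < 1/(2*(1+E₀)) := by positivity
  set c := 1/(2*(1+E₀)) with hc
  have hc1 : c * (1 + E₀) = 1/2 := by rw [hc]; field_simp
  have hc2 : c ≤ 1 := by nlinarith
  set Y := φ y with hY
  have hYn : ‖Y‖ < r₀/2 := by
    rw [← dist_zero_right, ← h0, hY, φ.dist_eq]; exact hyP
  set h' := φ z - (Y - t • EuclideanSpace.single 2 1) with hh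
  have hz1 : φ z = Y - t • EuclideanSpace.single 2 1 + h' := by rw [hh]; abel
  have hhn : ‖h'‖ < c * t := by
    rw [hh, ← dist_eq_norm]
    have : Y - t • EuclideanSpace.single 2 1 = φ (y + t • L.symm (-EuclideanSpace.single 2 1)) := by
      rw [hmap]; simp [hY, sub_eq_add_neg]
    rw [this, φ.dist_eq]; exact hz
  have hct : c * t ≤ t := by nlinarith
  have hzn : ‖φ z‖ < r₀ := by
    rw [hz1]
    calc _ ≤ ‖Y‖ + ‖t • (EuclideanSpace.single 2 1 : E3)‖ + ‖h'‖ :=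
          (norm_add_le _ _).trans (add_le_add_left (norm_sub_le _ _) _)
      _ < r₀ := by
        rw [norm_smul]; simp [abs_of_pos ht0]; linarith
  have hY2 : Y 2 ≤ ψ (proj12 Y) := by
    by_contra hcon
    have : Y ∈ (φ '' C) ∩ ball 0 r₀ := by
      rw [hC]; exact ⟨by simp; linarith, not_le.1 hcon⟩
    obtain ⟨y', hy', e⟩ := this.1
    exact hy (φ.injective e ▸ hy')
  have hz2 : ψ (proj12 (φ z)) < (φ z) 2 := by
    have : φ z ∈ (φ '' C) ∩ ball 0 r₀ := ⟨⟨z, hzC, rfl⟩, by simpa using hzn⟩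
    rw [hC] at this; exact this.2
  have e3 : proj12 (φ z) - proj12 Y = proj12 h' := by
    rw [proj12_sub, hz1]
    ext i; fin_cases i <;> simp [proj12]
  have hlip := hL.dist_le_mul (proj12 Y) (by simp; exact (proj12_norm_le _).trans_lt (by linarith))
    (proj12 (φ z)) (by simp; exact (proj12_norm_le _).trans_lt hzn)
  rw [Real.coe_toNNReal _ hE.le, dist_comm (proj12 Y), dist_eq_norm (proj12 (φ z)), e3, Real.dist_eq] at hlip
  have h5 : (φ z) 2 = Y 2 - t + h' 2 := by rw [hz1]; simp
  have h6 := (abs_le.1 (coord_le_norm h' 2)).2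
  have h7 := (le_abs_self _).trans hlip
  have h8 : E₀ * ‖proj12 h'‖ ≤ E₀ * ‖h'‖ := mul_le_mul_of_nonneg_left (proj12_norm_le _) hE.le
  have h9 : ‖h'‖ * (1 + E₀) ≤ c * t * (1 + E₀) := mul_le_mul_of_nonneg_right hhn.le (by linarith)
  nlinarith

lemma disj_closure {C : Set E3} {x : E3} {s : ℝ} (h : ∀ z, dist z x < s → z ∉ C) :
    ∀ z, dist z x < s → z ∉ closure C := by
  intro z hz hzC
  obtain ⟨w, hw1, hw2⟩ := mem_closure_iff.1 hzC (ball x s) isOpen_ball hz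
  exact h w hw1 hw2

lemma frontier_null {C : Set E3} (hC : IsOpen C) {r t₀ c : ℝ} (hr : 0 < r) (ht : 0 < t₀) (hc : 0 < c)
    (h : ConeC C r t₀ c) : volume (frontier C) = 0 := by
  apply measure_null_of_locally_null
  intro P hP
  obtain ⟨ν, hν, hs⟩ := h P hP
  refine ⟨ball P r ∩ frontier C, ?_, ?_⟩
  · exact inter_mem (mem_nhdsWithin_of_mem_nhds (ball_mem_nhds _ hr)) self_mem_nhdsWithin
  · have key : ∀ y ∈ ball P r ∩ frontier C, ∀ y' ∈ ball P r ∩ frontier C, ∀ t, 0 < t → t ≤ t₀ → y + t • ν ≠ y' := by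
      intro y hy y' hy' t h0 h1 e
      have hyC : y ∉ C := by
        rw [hC.frontier_eq] at hy; exact hy.2.2
      have := disj_closure (hs y hyC hy.1 t h0 h1) y' (by rw [e, dist_self]; positivity)
      exact this (frontier_subset_closure hy'.2)
    apply Measure.addHaar_eq_zero_of_disjoint_translates volume
      (u := fun n : ℕ => (t₀ / ((n:ℝ)+1)) • ν)
    · rw [isBounded_iff_forall_norm_le]
      refine ⟨t₀, ?_⟩
      rintro _ ⟨n, rfl⟩
      have h1 : t₀ / ((n:ℝ)+1) ≤ t₀ := div_le_self ht.le (by linarith [(Nat.cast_nonneg n : (0:ℝ) ≤ n)])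
      simp only
      rw [norm_smul, hν, mul_one, Real.norm_of_nonneg (by positivity)]; exact h1
    · have hlt : ∀ m n : ℕ, m < n → Disjoint (({(t₀ / ((m:ℝ)+1)) • ν} : Set E3) + ball P r ∩ frontier C)
          (({(t₀ / ((n:ℝ)+1)) • ν} : Set E3) + ball P r ∩ frontier C) := by
        intro m n hmn
        rw [Set.disjoint_left]
        rintro x hx hx'
        simp only [singleton_add, mem_image] at hx hx'
        obtain ⟨y, hy, rfl⟩ := hx
        obtain ⟨y', hy', e⟩ := hx'
        have h1 : t₀ / ((n:ℝ)+1) < t₀ / ((m:ℝ)+1) := by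
          apply div_lt_div_of_pos_left ht (by positivity)
          have : (m:ℝ) < n := by exact_mod_cast hmn
          linarith
        have h2 : t₀ / ((m:ℝ)+1) ≤ t₀ := div_le_self ht.le (by linarith [(Nat.cast_nonneg m : (0:ℝ) ≤ m)])
        have h3 : 0 < t₀ / ((n:ℝ)+1) := by positivity
        refine key y hy y' hy' (t₀ / ((m:ℝ)+1) - t₀ / ((n:ℝ)+1)) (by linarith) (by linarith) ?_
        rw [sub_smul]
        have : y' = (t₀ / ((m:ℝ)+1)) • ν + y - (t₀ / ((n:ℝ)+1)) • ν := by rw [← e]; abel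
        rw [this]; abel
      intro m n hmn
      rcases lt_or_gt_of_ne hmn with h1 | h1
      · exact hlt m n h1
      · exact (hlt n m h1).symm
    · exact measurableSet_ball.inter isClosed_frontier.measurableSet

end

section
open scoped ContDiff Topology ENNReal NNReal
open Filter

/-! ### Part 7 : chains of balls -/

lemma sq_add_le (a b : ℝ≥0∞) : (a + b) ^ 2 ≤ 2 * a ^ 2 + 2 * b ^ 2 := by
  have := ENNReal.rpow_add_le_mul_rpow_add_rpow a b (p := 2) (by norm_num)
  norm_num at this
  rw [mul_add] at this
  exact this

lemma line_ftc {N : Set E3} (hN : IsOpen N) {F : E3 → ℝ} (hF : ContDiffOn ℝ 1 F N) {x v : E3}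
    (h : ∀ t ∈ Icc (0:ℝ) 1, x + t • v ∈ N) :
    ‖F (x + v) - F x‖ₑ ^ 2 ≤ ∫⁻ t in Ioc (0:ℝ) 1, ‖fderiv ℝ F (x + t • v) v‖ₑ ^ 2 := by
  have hder : ∀ t ∈ uIcc (0:ℝ) 1, HasDerivAt (fun t : ℝ => F (x + t • v)) (fderiv ℝ F (x + t • v) v) t := by
    intro t ht
    rw [uIcc_of_le zero_le_one] at ht
    have d1 : HasFDerivAt F (fderiv ℝ F (x + t • v)) (x + t • v) :=
      ((hF.contDiffAt (hN.mem_nhds (h t ht))).differentiableAt (by simp)).hasFDerivAt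
    have d2 : HasDerivAt (fun t : ℝ => x + t • v) v t := by
      simpa using ((hasDerivAt_id t).smul_const v).const_add x
    exact d1.comp_hasDerivAt t d2
  have hcont : ContinuousOn (fun t : ℝ => fderiv ℝ F (x + t • v) v) (Icc 0 1) := by
    have d0 := hF.continuousOn_fderiv_of_isOpen hN (by simp)
    exact (d0.comp (by fun_prop) fun t ht => h t ht).clm_apply continuousOn_const
  have e := intervalIntegral.integral_eq_sub_of_hasDerivAt hder
    (ContinuousOn.intervalIntegrable (by rw [uIcc_of_le zero_le_one]; exact hcont))
  simp only [one_smul, zero_smul, add_zero] at e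
  rw [← e, intervalIntegral.integral_of_le zero_le_one]
  refine (pow_le_pow_left' (enorm_integral_le_lintegral_enorm _) 2).trans ?_
  have hm : AEMeasurable (fun t : ℝ => ‖fderiv ℝ F (x + t • v) v‖ₑ) (volume.restrict (Ioc 0 1)) :=
    ((hcont.mono Ioc_subset_Icc_self).aemeasurable measurableSet_Ioc).enorm
  have := cs_lint (μ := volume.restrict (Ioc (0:ℝ) 1)) hm (aemeasurable_const (b := (1:ℝ≥0∞)))
  simpa using this

lemma nbr {N : Set E3} (hN : IsOpen N) {F : E3 → ℝ} (hF : ContDiffOn ℝ 1 F N) {γ v : E3} {η : ℝ}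
    (h : ∀ x ∈ ball γ η, ∀ t ∈ Icc (0:ℝ) 1, x + t • v ∈ N) (hv : ‖v‖ ≤ 1) :
    ∫⁻ x in ball γ η, ‖F x‖ₑ ^ 2 ≤ 2 * (∫⁻ x in ball (γ + v) η, ‖F x‖ₑ ^ 2) + 2 * ∫⁻ x in N, gsq F x := by
  have hFm := meas_ind hN hF.continuousOn
  set gN : E3 → ℝ≥0∞ := N.indicator (gsq F) with hgN
  have mN : Measurable gN := (meas_gsq F).indicator hN.measurableSet
  set g1 : E3 → ℝ≥0∞ := (ball (γ + v) η).indicator (fun x => ‖N.indicator F x‖ₑ ^ 2) with hg1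
  have m1 : Measurable g1 := (hFm.enorm.pow_const 2).indicator measurableSet_ball
  have hpt : ∀ x ∈ ball γ η, ‖F x‖ₑ ^ 2 ≤ 2 * g1 (x + v) + 2 * ∫⁻ t in Ioc (0:ℝ) 1, gN (x + t • v) := by
    intro x hx
    have hxv : x + v ∈ ball (γ + v) η := by simpa using hx
    have hxN : x + v ∈ N := by simpa using h x hx 1 (by simp)
    have e1 : g1 (x + v) = ‖F (x + v)‖ₑ ^ 2 := by
      rw [hg1, indicator_of_mem hxv, indicator_of_mem hxN]
    rw [e1]
    have e2 : ‖F x‖ₑ ≤ ‖F (x + v)‖ₑ + ‖F (x + v) - F x‖ₑ := by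
      calc ‖F x‖ₑ = ‖F (x + v) - (F (x + v) - F x)‖ₑ := by congr 1; ring
        _ ≤ _ := enorm_sub_le
    refine (pow_le_pow_left' e2 2).trans ((sq_add_le _ _).trans ?_)
    gcongr
    refine (line_ftc hN hF (h x hx)).trans ?_
    apply setLIntegral_mono_ae' measurableSet_Ioc
    refine Eventually.of_forall fun t ht => ?_
    rw [hgN, indicator_of_mem (h x hx t ⟨ht.1.le, ht.2⟩)]
    exact fderiv_le_gsq F _ hv
  refine (setLIntegral_mono_ae' measurableSet_ball (Eventually.of_forall hpt)).trans ?_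
  refine (setLIntegral_le_lintegral _ _).trans ?_
  rw [lintegral_add_left (by fun_prop), lintegral_const_mul _ (by fun_prop), lintegral_const_mul' _ _ (by norm_num),
    window mN, lintegral_add_right_eq_self g1 v]
  rw [hg1, hgN, lintegral_indicator measurableSet_ball, lintegral_indicator hN.measurableSet]
  simp only [ENNReal.ofReal_one, one_mul]
  gcongr with x
  by_cases hx : x ∈ N
  · simp [hx]
  · simp [hx]

lemma walk_bound {V : Type*} [Fintype V] (G : SimpleGraph V) (a : V → ℝ≥0∞) (M : ℝ≥0∞)
    (h : ∀ u v, G.Adj u v → a u ≤ 2 * a v + M) {u v : V} (hr : G.Reachable u v) :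
    a u ≤ 2 ^ (Fintype.card V) * (a v + M) := by
  classical
  have key : ∀ {u v : V} (p : G.Walk u v), a u + M ≤ 2 ^ p.length * (a v + M) := by
    intro u v p
    induction p with
    | nil => simp
    | cons hadj p ih =>
      rw [SimpleGraph.Walk.length_cons, pow_succ, mul_comm (2 ^ _), mul_assoc]
      refine (add_le_add_left (h _ _ hadj) M).trans ?_
      rw [add_assoc, ← two_mul, ← mul_add]
      gcongr
  obtain ⟨p⟩ := hr
  have h1 := key (p.toPath : G.Walk u v)
  have h2 : (p.toPath : G.Walk u v).length ≤ Fintype.card V := (p.toPath.2.length_lt).le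
  refine le_self_add.trans (h1.trans ?_)
  gcongr
  norm_num

/-! geometry -/

def Om (C : Set E3) : Set E3 := lowerHalf \ closure C

def dd (C : Set E3) (x : E3) : ℝ := infDist x (Om C)ᶜ

lemma isOpen_lowerHalf : IsOpen lowerHalf := by
  have : lowerHalf = (fun x : E3 => x 2) ⁻¹' Iio 0 := rfl
  rw [this]; exact isOpen_Iio.preimage (by fun_prop)

lemma isOpen_Om (C : Set E3) : IsOpen (Om C) := isOpen_lowerHalf.sdiff isClosed_closure

lemma Om_compl_ne (C : Set E3) : (Om C)ᶜ.Nonempty := ⟨0, by simp [Om, lowerHalf]⟩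

lemma dd_low {C : Set E3} {x : E3} {s : ℝ} (h : ∀ z, dist z x < s → z ∉ C) (h2 : x 2 ≤ -s) : s ≤ dd C x := by
  refine (le_infDist (Om_compl_ne C)).2 fun z hz => ?_
  by_contra hcon
  rw [not_le, dist_comm] at hcon
  apply hz
  refine ⟨?_, disj_closure h z hcon⟩
  have h3 := coord_le_norm (z - x) 2
  rw [← dist_eq_norm] at h3
  have := (abs_le.1 h3).2
  simp at this
  show z 2 < 0
  linarith

lemma dd_lip (C : Set E3) (x y : E3) : dd C x ≤ dd C y + dist x y := infDist_le_infDist_add_dist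

lemma dd_cont (C : Set E3) : Continuous (dd C) := continuous_infDist_pt _

lemma mem_Om_of_dd {C : Set E3} {x : E3} (h : 0 < dd C x) : x ∈ Om C := by
  by_contra hx
  have : dd C x = 0 := infDist_zero_of_mem hx
  linarith

lemma dd_pos {C : Set E3} {x : E3} (h : x ∈ Om C) : 0 < dd C x :=
  ((isOpen_Om C).isClosed_compl.notMem_iff_infDist_pos (Om_compl_ne C)).1 (by simpa using h)

lemma dd_ball {C : Set E3} {x z : E3} (h : dist z x < dd C x) : z ∈ Om C := by
  apply mem_Om_of_dd
  have := dd_lip C x z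
  rw [dist_comm] at h
  linarith

/-- exterior points without nearby frontier points stay away from `C` -/
lemma far_of_frontier {C : Set E3} {x : E3} {s : ℝ} (hx : x ∉ closure C)
    (h : ∀ P ∈ frontier C, s ≤ dist x P) : ∀ z, dist z x < s → z ∉ C := by
  intro z hz hzC
  have hne : (closure C)ᶜ ≠ univ := by
    intro h'
    have : z ∈ (closure C)ᶜ := by rw [h']; trivial
    exact this (subset_closure hzC)
  obtain ⟨y, hy, e⟩ := exists_mem_frontier_infDist_compl_eq_dist (show x ∈ (closure C)ᶜ from hx) hne
  rw [frontier_compl] at hy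
  have h1 := h y (frontier_closure_subset hy)
  have h2 : infDist x (closure C)ᶜᶜ ≤ dist x z := infDist_le_dist_of_mem (by simpa using subset_closure hzC)
  rw [dist_comm] at hz
  linarith

/-- geometric admissibility of C -/
structure Adm (D : ℝ) (C : Set E3) : Prop where
  op : IsOpen C
  bd : ∀ x ∈ closure C, ‖x‖ ≤ 2 * D
  dp : ∀ x ∈ closure C, x 2 ≤ -D
  cn : IsPreconnected (Om C)

lemma Adm.of_cavity {D : ℝ} {C : Set E3} (h : IsCavity D C) : Adm D C := by
  obtain ⟨h1, h2, h3, h4, h5, h6, h7⟩ := h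
  refine ⟨h1, ?_, ?_, h4.isPreconnected⟩
  · intro x hx
    have : closure C ⊆ closedBall 0 (2 * D) :=
      closure_minimal (fun y hy => by simpa using (h5 hy).1.le) isClosed_closedBall
    simpa using this hx
  · intro x hx
    have hc : IsClosed {x : E3 | x 2 ≤ -D} := isClosed_le (by fun_prop) continuous_const
    exact closure_minimal (fun y hy => h6 y hy) hc hx

end

section
open scoped ContDiff Topology ENNReal NNReal
open Filter

/-! ### Part 8 : the inequality (Q) -/

def mm (C : Set E3) (x : E3) : ℝ := min (dd C x) 1

lemma mm_meas (C : Set E3) : Measurable (mm C) := ((dd_cont C).min continuous_const).measurable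

/-- weighted Dirichlet integral -/
def WI (C : Set E3) (F : E3 → ℝ) : ℝ≥0∞ := ∫⁻ x in Om C, ENNReal.ofReal (mm C x) ^ 2 * gsq F x

def Far (D : ℝ) : Set E3 := {x | x 2 < 0 ∧ 4 * D < ‖x‖}

lemma net (R η : ℝ) (hη : 0 < η) : ∃ Γ : Finset E3, ∀ x ∈ closedBall (0:E3) R, ∃ γ ∈ Γ, dist x γ < η := by
  obtain ⟨t, ht, hf, hc⟩ := (isCompact_closedBall (0:E3) R).finite_cover_balls hη
  refine ⟨hf.toFinset, fun x hx => ?_⟩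
  have := hc hx
  simp only [mem_iUnion] at this
  obtain ⟨γ, h1, h2⟩ := this
  exact ⟨γ, by simpa using h1, h2⟩

lemma coord_add_le (x v : E3) : (x + v) 2 ≤ x 2 + ‖v‖ := by
  have := (abs_le.1 (coord_le_norm v 2)).2
  simp; linarith

lemma coord_dist (x z : E3) : x 2 ≤ z 2 + dist x z := by
  have := coord_add_le z (x - z)
  rw [dist_eq_norm]; simpa using this

lemma dd_le_coord (C : Set E3) (x : E3) (hx : x 2 ≤ 0) : dd C x ≤ - x 2 := by
  have h : x + (- x 2) • EuclideanSpace.single 2 (1:ℝ) ∈ (Om C)ᶜ := by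
    intro h; have := h.1; simp [lowerHalf] at this
  refine (infDist_le_dist_of_mem h).trans ?_
  rw [dist_eq_norm]
  simp [norm_smul, abs_of_nonpos hx]

lemma near_bound {D r t0 c B : ℝ} (hD : 1 < D) (hr : 0 < r) (hrD : r ≤ D/4) (hc : 0 < c)
    (hc2 : c ≤ 1/2) (hB : 0 < B) (hBr : B ≤ r/8) (hBt : B ≤ t0/2) (hB1 : B ≤ 1)
    {C : Set E3} (hC : Adm D C) (hcone : ConeC C r t0 c) {F : E3 → ℝ}
    (hF : ContDiffOn ℝ 1 F (Om C)) {γ : E3} (hγ : ‖γ‖ ≤ 6*D + r/4) :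
    ∫⁻ x in Om C ∩ ball γ (r/4), ‖F x‖ₑ ^ 2 ≤
      12 * (∫⁻ x in {x | c * B ≤ dd C x} ∩ closedBall 0 (7*D), ‖F x‖ₑ ^ 2) +
      ENNReal.ofReal (12 * c⁻¹ ^ 2) * WI C F := by
  have hcB : 0 < c * B := by positivity
  have hcB' : c * B ≤ B / 2 := by nlinarith
  have mZ : MeasurableSet ({x | c * B ≤ dd C x} ∩ closedBall 0 (7*D)) :=
    (isClosed_le continuous_const (dd_cont C)).measurableSet.inter measurableSet_closedBall
  have hZN : ({x | c * B ≤ dd C x} ∩ closedBall 0 (7*D)) ⊆ Om C := fun x hx =>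
    mem_Om_of_dd (hcB.trans_le hx.1)
  have mA : MeasurableSet (Om C ∩ ball γ (r/4)) := (isOpen_Om C).measurableSet.inter measurableSet_ball
  -- general application of Hd
  have app : ∀ ν : E3, ‖ν‖ = 1 → (∀ y ∈ Om C ∩ ball γ (r/4), ∀ t, 0 < t → t ≤ 2*B → c * t ≤ dd C (y + t • ν)) →
      ∫⁻ x in Om C ∩ ball γ (r/4), ‖F x‖ₑ ^ 2 ≤
      12 * (∫⁻ x in {x | c * B ≤ dd C x} ∩ closedBall 0 (7*D), ‖F x‖ₑ ^ 2) +
      ENNReal.ofReal (12 * c⁻¹ ^ 2) * WI C F := by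
    intro ν hν H
    refine Hd hB hc hν.le mA (isOpen_Om C) mZ hZN hF (mm_meas C) ?_ ?_ ?_
    · intro y hy t ht
      rcases ht.1.eq_or_lt with h0 | h0
      · rw [← h0]; simpa using hy.1
      · exact mem_Om_of_dd ((mul_pos hc h0).trans_le (H y hy t h0 ht.2))
    · intro y hy t ht
      have h0 : 0 < t := hB.trans ht.1
      refine ⟨le_trans ?_ (H y hy t h0 ht.2), ?_⟩
      · have := ht.1; gcongr
      · have h1 : ‖y‖ ≤ ‖γ‖ + r/4 := by
          have := norm_le_norm_add_norm_sub' y γ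
          have h2 := hy.2
          rw [mem_ball, dist_eq_norm] at h2
          linarith
        have h3 : ‖y + t • ν‖ ≤ ‖y‖ + t := by
          refine (norm_add_le _ _).trans ?_
          rw [norm_smul, hν, Real.norm_of_nonneg h0.le, mul_one]
        have := ht.2
        rw [mem_closedBall_zero_iff]; linarith
    · intro y hy t ht
      rcases ht.1.eq_or_lt with h0 | h0
      · rw [← h0]; simp only [mul_zero]
        exact le_min infDist_nonneg zero_le_one
      · refine le_min (H y hy t h0 ht.2) ?_
        have := ht.2
        nlinarith
  by_cases ha : ∃ P ∈ frontier C, dist γ P < r/2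
  · obtain ⟨P, hP, hγP⟩ := ha
    obtain ⟨ν, hν, hs⟩ := hcone P hP
    refine app ν hν ?_
    intro y hy t h0 h1
    have hyC : y ∉ C := fun h => hy.1.2 (subset_closure h)
    have hyP : dist y P < 3*r/4 := by
      have := dist_triangle y γ P
      have := mem_ball.1 hy.2
      linarith
    refine dd_low (hs y hyC (by linarith) t h0 (by linarith)) ?_
    have e1 := coord_add_le y (t • ν)
    rw [norm_smul, hν, Real.norm_of_nonneg h0.le, mul_one] at e1
    have e2 := coord_dist y P
    have e3 := hC.dp P (frontier_subset_closure hP)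
    nlinarith
  · push Not at ha
    by_cases hb : -D/4 ≤ γ 2
    · refine app (-EuclideanSpace.single 2 (1:ℝ)) (by simp) ?_
      intro y hy t h0 h1
      have ey : (y + t • (-EuclideanSpace.single 2 (1:ℝ)) : E3) 2 = y 2 - t := by simp; ring
      have hy2 : y 2 < 0 := hy.1.1
      refine dd_low ?_ ?_
      · intro z hz hzC
        have e3 := hC.dp z (subset_closure hzC)
        have e4 := coord_dist (y + t • (-EuclideanSpace.single 2 (1:ℝ))) z
        rw [ey, dist_comm] at e4
        have e5 := coord_dist γ y
        have e6 := mem_ball.1 hy.2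
        rw [dist_comm] at e6
        nlinarith
      · rw [ey]; nlinarith
    · push Not at hb
      have hsub : Om C ∩ ball γ (r/4) ⊆ {x | c * B ≤ dd C x} ∩ closedBall 0 (7*D) := by
        intro y hy
        have e6 := mem_ball.1 hy.2
        refine ⟨?_, ?_⟩
        · refine dd_low (far_of_frontier hy.1.2 fun P hP => ?_) ?_
          · have := ha P hP
            have := dist_triangle γ y P
            rw [dist_comm γ y] at this
            linarith
          · have := coord_dist y γ
            linarith
        · rw [mem_closedBall_zero_iff]
          have := norm_le_norm_add_norm_sub' y γ
          rw [dist_eq_norm] at e6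
          linarith
      refine (lintegral_mono_set hsub).trans (le_trans ?_ le_self_add)
      conv_lhs => rw [← one_mul (∫⁻ x in _, _)]
      gcongr
      norm_num

/-! graph -/

def gr (C : Set E3) (Γ : Finset E3) (η : ℝ) : SimpleGraph Γ where
  Adj a b := a ≠ b ∧ dist (a:E3) b ≤ η ∧ 4*η ≤ dd C a ∧ 4*η ≤ dd C b
  symm := ⟨fun a b h => ⟨h.1.symm, by rw [dist_comm]; exact h.2.1, h.2.2.2, h.2.2.1⟩⟩
  loopless := ⟨fun a h => h.1 rfl⟩

/-- `x` and `y` have linked labels -/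
def Lk (C : Set E3) (Γ : Finset E3) (η : ℝ) (x y : E3) : Prop :=
  ∀ a b : Γ, dist x a < η/4 → dist y b < η/4 → (gr C Γ η).Reachable a b

lemma lk_near {C : Set E3} {Γ : Finset E3} {η : ℝ} (hη : 0 < η) {x y : E3} (hx : 5*η ≤ dd C x)
    (hxy : dist x y < η/4) : Lk C Γ η x y := by
  intro a b ha hb
  by_cases hab : a = b
  · rw [hab]
  · apply SimpleGraph.Adj.reachable
    refine ⟨hab, ?_, ?_, ?_⟩
    · have h1 := dist_triangle4 (a:E3) x y b
      rw [dist_comm (a:E3) x] at h1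
      linarith
    · have := dd_lip C x a
      linarith
    · have := dd_lip C x b
      have := dist_triangle x y b
      linarith

lemma lk_trans {C : Set E3} {Γ : Finset E3} {η : ℝ} {x y z : E3} (hy : ∃ γ ∈ Γ, dist y γ < η/4)
    (h1 : Lk C Γ η x y) (h2 : Lk C Γ η y z) : Lk C Γ η x z := by
  obtain ⟨γ, hγ, h⟩ := hy
  intro a b ha hb
  exact (h1 a ⟨γ, hγ⟩ ha h).trans (h2 ⟨γ, hγ⟩ b h hb)

lemma lk_symm {C : Set E3} {Γ : Finset E3} {η : ℝ} {x y : E3} 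
    (h1 : Lk C Γ η x y) : Lk C Γ η y x := fun a b ha hb => (h1 b a hb ha).symm

lemma lk_of_preconn {C : Set E3} {Γ : Finset E3} {η : ℝ} (hη : 0 < η) {S : Set E3} (hS : IsPreconnected S)
    (hd : ∀ x ∈ S, 5*η ≤ dd C x) (hn : ∀ x ∈ S, ∃ γ ∈ Γ, dist x γ < η/4) {x y : E3} (hx : x ∈ S) (hy : y ∈ S) :
    Lk C Γ η x y := by
  refine hS.induction₂ (Lk C Γ η) ?_ ?_ ?_ hx hy
  · intro x hx
    filter_upwards [mem_nhdsWithin_of_mem_nhds (ball_mem_nhds x (show 0 < η/4 by positivity))] with y hy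
    rw [mem_ball, dist_comm] at hy
    exact lk_near hη (hd x hx) hy
  · intro x y z hx hy hz h1 h2
    exact lk_trans (hn y hy) h1 h2
  · intro x y _ _ h
    exact lk_symm h

end

section
open scoped ContDiff Topology ENNReal NNReal
open Filter

/-! ### Part 9 : connectivity -/

def TT (R δ : ℝ) (x : E3) : E3 :=
  (R / max R ‖x‖) • x - (max 0 (((R / max R ‖x‖) • x) 2 + δ)) • EuclideanSpace.single 2 (1:ℝ)

lemma TT_cont {R δ : ℝ} (hR : 0 < R) : Continuous (TT R δ) := by
  have h : Continuous fun x : E3 => R / max R ‖x‖ :=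
    continuous_const.div (by fun_prop) fun x => (lt_max_of_lt_left hR).ne'
  unfold TT
  have h1 : Continuous fun x : E3 => (R / max R ‖x‖) • x := h.smul continuous_id
  have h2 : Continuous fun x : E3 => ((R / max R ‖x‖) • x) 2 := (by fun_prop : Continuous fun x : E3 => x 2).comp h1
  fun_prop

lemma TT_fix {R δ : ℝ} (hR : 0 < R) {x : E3} (h1 : ‖x‖ ≤ R) (h2 : x 2 ≤ -δ) : TT R δ x = x := by
  unfold TT
  rw [max_eq_left h1, div_self hR.ne', one_smul, max_eq_left (by linarith)]
  simp

lemma TT_prop {D R δ : ℝ} (hD : 0 < D) (hR : 2*D < R) (hδ : 0 < δ) (hδD : δ < D) {C : Set E3} (hC : Adm D C)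
    {x : E3} (hx : x ∈ Om C) : TT R δ x ∉ closure C ∧ TT R δ x 2 ≤ -δ ∧ ‖TT R δ x‖ ≤ R + δ := by
  have hR0 : 0 < R := by linarith
  set y := (R / max R ‖x‖) • x with hy
  have hm : 0 < max R ‖x‖ := lt_max_of_lt_left hR0
  have hyn : ‖y‖ ≤ R := by
    rw [hy, norm_smul, Real.norm_of_nonneg (by positivity), div_mul_eq_mul_div, div_le_iff₀ hm]
    gcongr
    exact le_max_right _ _
  have hy2 : y 2 < 0 := by
    have h : x 2 < 0 := hx.1
    rw [hy]; simp only [PiLp.smul_apply, smul_eq_mul]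
    exact mul_neg_of_pos_of_neg (by positivity) h
  have hyC : y ∉ closure C := by
    rcases le_total ‖x‖ R with h | h
    · rw [hy, max_eq_left h, div_self hR0.ne', one_smul]; exact hx.2
    · intro hc
      have h1 := hC.bd y hc
      have hx0 : 0 < ‖x‖ := hR0.trans_le h
      rw [hy, max_eq_right h, norm_smul, Real.norm_of_nonneg (by positivity), div_mul_cancel₀ _ hx0.ne'] at h1
      linarith
  have hT : TT R δ x = y - (max 0 (y 2 + δ)) • EuclideanSpace.single 2 (1:ℝ) := rfl
  rw [hT]
  rcases le_total (y 2) (-δ) with h | h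
  · rw [max_eq_left (by linarith)]
    simp only [zero_smul, sub_zero]
    exact ⟨hyC, h, by linarith⟩
  · rw [max_eq_right (by linarith)]
    have e : (y - (y 2 + δ) • EuclideanSpace.single 2 (1:ℝ) : E3) 2 = -δ := by simp
    have h0 : 0 ≤ y 2 + δ := by linarith
    refine ⟨fun hc => ?_, e.le, ?_⟩
    · have := hC.dp _ hc
      rw [e] at this; linarith
    · refine (norm_sub_le _ _).trans ?_
      rw [norm_smul (y 2 + δ), Real.norm_of_nonneg h0]
      simp only [PiLp.norm_single, norm_one, mul_one]; linarith

def CD (C : Set E3) (r t0 c : ℝ) (P ν : E3) : Prop :=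
  ‖ν‖ = 1 ∧ ∀ y ∉ C, dist y P < r → ∀ t, 0 < t → t ≤ t0 → ∀ z, dist z (y + t • ν) < c * t → z ∉ C

def Rp (C : Set E3) (r t0 c τ : ℝ) (x x' : E3) : Prop :=
  (x' = x ∧ 2*τ ≤ dd C x) ∨ ∃ P ν, CD C r t0 c P ν ∧ dist x P < r/2 ∧ x' = x + τ • ν

lemma conn {D r t0 c τ η : ℝ} (hD : 1 < D) (hr : 0 < r) (hrD : r ≤ D/4) (hc : 0 < c) (hc2 : c ≤ 1/2) 
    (hτ : 0 < τ) (hτr : τ ≤ r/16) (hτt : τ ≤ t0) (hη : η = c*τ/10) {C : Set E3} (hC : Adm D C) (hcone : ConeC C r t0 c)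
    {Γ : Finset E3} (hΓ : ∀ x ∈ closedBall (0:E3) (9*D), ∃ γ ∈ Γ, dist x γ < η/4)
    {x y : E3} (hx : 8*τ ≤ dd C x) (hx' : ‖x‖ ≤ 8*D) (hy : 8*τ ≤ dd C y) (hy' : ‖y‖ ≤ 8*D) : Lk C Γ η x y := by
  have hη0 : 0 < η := by rw [hη]; positivity
  set S := TT (8*D) (8*τ) '' Om C with hS
  have hSp : IsPreconnected S := hC.cn.image _ (TT_cont (by linarith)).continuousOn
  have hSx : ∀ x ∈ S, x ∉ closure C ∧ x 2 ≤ -(8*τ) ∧ ‖x‖ ≤ 8*D+8*τ := by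
    rintro _ ⟨z, hz, rfl⟩
    exact TT_prop (by linarith) (by linarith) (by positivity) (by linarith) hC hz
  have hmem : ∀ x, 8*τ ≤ dd C x → ‖x‖ ≤ 8*D → x ∈ S := by
    intro x h1 h2
    have hxO := mem_Om_of_dd (show 0 < dd C x by linarith)
    refine ⟨x, hxO, TT_fix (by linarith) h2 ?_⟩
    have := dd_le_coord C x (le_of_lt hxO.1)
    linarith
  -- linking inside convex sets
  have hcv : ∀ (Q : Set E3), Convex ℝ Q → (∀ x ∈ Q, 5*η ≤ dd C x) → (∀ x ∈ Q, ‖x‖ ≤ 9*D) → 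
      ∀ x ∈ Q, ∀ y ∈ Q, Lk C Γ η x y := by
    intro Q hQ h1 h2 x hx y hy
    exact lk_of_preconn hη0 hQ.isPreconnected h1 (fun z hz => hΓ z (by simpa using h2 z hz)) hx hy
  have h5 : 5*η = c*τ/2 := by rw [hη]; ring
  have hcτ : c*τ ≤ τ/2 := by nlinarith
  have hlink : ∀ x ∈ S, ∀ y ∈ S, dist x y < c*τ/2 → ∀ x' y', Rp C r t0 c τ x x' → Rp C r t0 c τ y y' → 
      Lk C Γ η x' y' := by
    -- the deep case
    have deep : ∀ x ∈ S, ∀ y ∈ S, dist x y < c*τ/2 → 2*τ ≤ dd C x → ∀ y', Rp C r t0 c τ y y' → 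
      Lk C Γ η x y' := by
      intro x hx y hy hxy hdx y' hy'
      refine hcv (closedBall x (3*τ/2)) (convex_closedBall _ _) ?_ ?_ x (mem_closedBall_self (by positivity)) y' ?_
      · intro z hz
        have := dd_lip C x z
        rw [mem_closedBall, dist_comm] at hz
        linarith
      · intro z hz
        rw [mem_closedBall, dist_eq_norm] at hz
        have := norm_le_norm_add_norm_sub' z x
        have := (hSx x hx).2.2
        linarith
      · rw [mem_closedBall, dist_comm]
        rcases hy' with ⟨rfl, _⟩ | ⟨P, ν, hν, _, rfl⟩
        · linarith
        · have h1 := dist_triangle x y (y + τ • ν)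
          have h2 : dist y (y + τ • ν) = τ := by
            rw [dist_self_add_right, norm_smul, hν.1, Real.norm_of_nonneg hτ.le, mul_one]
          linarith
    intro x hx y hy hxy x' y' hx' hy'
    rcases hx' with ⟨rfl, hd⟩ | ⟨P, ν, hν, hP, rfl⟩
    · exact deep _ hx y hy hxy hd y' hy'
    rcases hy' with ⟨rfl, hd⟩ | ⟨P', ν', hν', hP', rfl⟩
    · exact lk_symm (deep _ hy x hx (by rw [dist_comm]; exact hxy) hd _ (Or.inr ⟨P, ν, hν, hP, rfl⟩))
    -- the cone-cone case
    have hxs := hSx x hx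
    have hys := hSx y hy
    have nC : ∀ {P ν y : E3} (hν : CD C r t0 c P ν) (hP : dist y P < r) (hyC : y ∉ C) {s : ℝ} (h0 : 0 ≤ s) (h1 : s ≤ τ), y + s • ν ∉ C := by
      intro P ν y hν hP hyC s h0 h1
      rcases h0.eq_or_lt with h | h
      · rw [← h]; simpa using hyC
      · exact hν.2 y hyC hP s h (by linarith) _ (by rw [dist_self]; positivity)
    have dI : ∀ {P ν y : E3} (hν : CD C r t0 c P ν) (hP : dist y P < r) (hyC : y ∉ C) (hy2 : y 2 ≤ -(7*τ)), c*τ ≤ dd C (y + τ • ν) := by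
      intro P ν y hν hP hyC hy2
      refine dd_low (hν.2 y hyC hP τ hτ hτt) ?_
      have := coord_add_le y (τ • ν)
      rw [norm_smul, hν.1, Real.norm_of_nonneg hτ.le, mul_one] at this
      linarith
    have hxP' : dist x P' < r/2 + c*τ/2 := by
      have := dist_triangle x y P'
      linarith
    have hxC : x ∉ C := fun h => hxs.1 (subset_closure h)
    have nsm : ∀ {ν : E3} (h : ‖ν‖ = 1) {s : ℝ} (h0 : 0 ≤ s), ‖s • ν‖ = s := by
      intro ν h s h0
      rw [norm_smul, h, Real.norm_of_nonneg h0, mul_one]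
    have dist_add : ∀ (y v P : E3), dist (y + v) P ≤ dist y P + ‖v‖ := by
      intro y v P
      have := dist_triangle (y+v) y P
      rw [dist_self_add_left] at this
      linarith
    have hseg : ∀ a b v : E3, ∀ z ∈ segment ℝ a (a + τ • v), ∃ s, 0 ≤ s ∧ s ≤ τ ∧ z = a + s • v := by
      intro a b v z hz
      rw [segment_eq_image'] at hz
      obtain ⟨θ, hθ, rfl⟩ := hz
      refine ⟨θ * τ, by have := hθ.1; positivity, by have := hθ.2; nlinarith, ?_⟩
      simp [smul_smul]
    have step : ∀ {P P' ν ν' : E3}, CD C r t0 c P ν → CD C r t0 c P' ν' → dist x P < r/2 + c*τ/2 → dist x P' < r/2 + c*τ/2 → 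
        Lk C Γ η (x + τ • ν) (x + τ • ν + τ • ν') := by
      intro P P' ν ν' hν hν' hP hP'
      refine hcv (segment ℝ (x + τ • ν) (x + τ • ν + τ • ν')) (convex_segment _ _) ?_ ?_ _ (left_mem_segment _ _ _) _ (right_mem_segment _ _ _)
      · intro z hz
        obtain ⟨s, h0, h1, rfl⟩ := hseg _ 0 _ z hz
        have e : x + τ • ν + s • ν' = x + s • ν' + τ • ν := by abel
        rw [e, h5]
        have := nsm hν'.1 h0
        have e1 := dist_add x (s • ν') P
        have e2 := coord_add_le x (s • ν')
        have := dI hν (by linarith) (nC hν' (by linarith) hxC h0 h1) (by linarith)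
        linarith
      · intro z hz
        obtain ⟨s, h0, h1, rfl⟩ := hseg _ 0 _ z hz
        have := nsm hν'.1 h0
        have := nsm hν.1 hτ.le
        have := norm_add₃_le (a := x) (b := τ • ν) (c := s • ν')
        linarith [hxs.2.2]
    have hPx : dist x P < r/2 + c*τ/2 := by nlinarith
    have l1 := step hν hν' hPx hxP'
    have l2 := step hν' hν hxP' hPx
    have e : x + τ • ν' + τ • ν = x + τ • ν + τ • ν' := by abel
    rw [e] at l2
    have nb : ∀ {z : E3}, ‖z‖ ≤ 9*D → ∃ γ ∈ Γ, dist z γ < η/4 := fun {z} h => hΓ z (by simpa using h)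
    have l3 : Lk C Γ η (x + τ • ν') (y + τ • ν') := by
      refine hcv (ball (x + τ • ν') (c*τ/2)) (convex_ball _ _) ?_ ?_ _ (mem_ball_self (by positivity)) _ ?_
      · intro z hz
        have h1 := dI hν' (by linarith) hxC (by linarith)
        have h2 := dd_lip C (x + τ • ν') z
        rw [mem_ball, dist_comm] at hz
        linarith
      · intro z hz
        rw [mem_ball, dist_eq_norm] at hz
        have := norm_le_norm_add_norm_sub' z (x + τ • ν')
        have := norm_add_le x (τ • ν')
        have := nsm hν'.1 hτ.le
        linarith [hxs.2.2]
      · rw [mem_ball, dist_add_right, dist_comm]; exact hxy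
    have n1 := nsm hν.1 hτ.le
    have n2 := nsm hν'.1 hτ.le
    refine lk_trans (nb ?_) l1 (lk_trans (nb ?_) (lk_symm l2) l3)
    · have := norm_add₃_le (a := x) (b := τ • ν) (c := τ • ν')
      linarith [hxs.2.2]
    · have := norm_add_le x (τ • ν')
      linarith [hxs.2.2]
  have hex : ∀ x ∈ S, ∃ x', Rp C r t0 c τ x x' ∧ ‖x'‖ ≤ 9*D := by
    intro x hx
    obtain ⟨h1, h2, h3⟩ := hSx x hx
    by_cases ha : ∃ P ∈ frontier C, dist x P < r/2
    · obtain ⟨P, hP, hd⟩ := ha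
      obtain ⟨ν, hν⟩ := hcone P hP
      refine ⟨_, Or.inr ⟨P, ν, hν, hd, rfl⟩, ?_⟩
      have h4 : ‖τ • ν‖ = τ := by rw [norm_smul, hν.1, Real.norm_of_nonneg hτ.le, mul_one]
      have := norm_add_le x (τ • ν)
      linarith
    · push Not at ha
      refine ⟨x, Or.inl ⟨rfl, dd_low (far_of_frontier h1 fun P hP => ?_) (by linarith)⟩, by linarith⟩
      have := ha P hP
      linarith
  have main := hSp.induction₂ (fun x y => ∀ x' y', Rp C r t0 c τ x x' → Rp C r t0 c τ y y' → Lk C Γ η x' y') ?_ ?_ ?_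
    (hmem x hx hx') (hmem y hy hy')
  · exact main x y (Or.inl ⟨rfl, by linarith⟩) (Or.inl ⟨rfl, by linarith⟩)
  · intro x hx
    filter_upwards [self_mem_nhdsWithin, mem_nhdsWithin_of_mem_nhds (ball_mem_nhds x (show 0 < c*τ/2 by positivity))] with y hyS hy
    rw [mem_ball, dist_comm] at hy
    exact hlink x hx y hyS hy
  · intro x y z hx hy hz h1 h2 x' z' hx' hz'
    obtain ⟨y', hy', hn⟩ := hex y hy
    exact lk_trans (hΓ y' (by simpa using hn)) (h1 x' y' hx' hy') (h2 y' z' hy' hz')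
  · intro x y _ _ h x' y' hx' hy'
    exact lk_symm (h y' x' hy' hx')

end

section
open scoped ContDiff Topology ENNReal NNReal
open Filter

/-! ### Part 10 : (Q) -/

lemma cover_bound {α : Type*} (Γ : Finset α) (B : α → Set E3) {A : Set E3} (hA : A ⊆ ⋃ γ ∈ Γ, B γ) 
    {g : E3 → ℝ≥0∞} {K : ℝ≥0∞} (h : ∀ γ ∈ Γ, ∫⁻ x in B γ, g x ≤ K) : ∫⁻ x in A, g x ≤ (Γ.card : ℝ≥0∞) * K := by
  refine (lintegral_mono_set hA).trans ?_
  have h1 : volume.restrict (⋃ γ ∈ Γ, B γ) ≤ ∑ γ ∈ Γ, volume.restrict (B γ) := by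
    classical
    clear hA h
    induction Γ using Finset.induction_on with
    | empty => simp
    | insert a s ha ih =>
      rw [Finset.set_biUnion_insert, Finset.sum_insert ha]
      refine (Measure.restrict_union_le _ _).trans ?_
      gcongr
  refine (lintegral_mono' h1 le_rfl).trans ?_
  rw [lintegral_finsetSum_measure]
  refine (Finset.sum_le_sum h).trans ?_
  simp

lemma ConeC.mono {C : Set E3} {r t c r' t' c' : ℝ} (h : ConeC C r t c) (hr : r' ≤ r) (ht : t' ≤ t) (hc : c' ≤ c) :
    ConeC C r' t' c' := by
  intro P hP
  obtain ⟨ν, h1, h2⟩ := h P hP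
  refine ⟨ν, h1, fun y hy hd s h0 h1 z hz => h2 y hy (by linarith) s h0 (by linarith) z (hz.trans_le ?_)⟩
  gcongr

theorem Qineq {D r t0 c : ℝ} (hD : 1 < D) (hr : 0 < r) (ht0 : 0 < t0) (hc : 0 < c) :
    ∃ K : ℝ≥0∞, K ≠ ⊤ ∧ ∀ C, Adm D C → ConeC C r t0 c → ∀ F : E3 → ℝ, ContDiffOn ℝ 1 F (Om C) →
      ∫⁻ x in Om C ∩ closedBall 0 (6*D), ‖F x‖ₑ ^ 2 ≤ K * (WI C F + ∫⁻ x in Far D ∩ closedBall 0 (6*D), ‖F x‖ₑ ^ 2) := by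
  wlog hw : r ≤ D/4 ∧ c ≤ 1/2 generalizing r c
  · obtain ⟨K, h1, h2⟩ := this (r := min r (D/4)) (c := min c (1/2)) (by positivity) (by positivity) ⟨min_le_right _ _, min_le_right _ _⟩
    exact ⟨K, h1, fun C hC h => h2 C hC (h.mono (min_le_left _ _) le_rfl (min_le_left _ _))⟩
  obtain ⟨hrD, hc2⟩ := hw
  set B := min (min (r/8) (t0/2)) 1 with hB
  have hB0 : 0 < B := by positivity
  have hBr : B ≤ r/8 := (min_le_left _ _).trans (min_le_left _ _)
  have hBt : B ≤ t0/2 := (min_le_left _ _).trans (min_le_right _ _)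
  have hB1 : B ≤ 1 := min_le_right _ _
  set τ := c*B/8 with hτ
  have hτ0 : 0 < τ := by positivity
  have hτB : τ ≤ B/16 := by rw [hτ]; nlinarith
  set η := c*τ/10 with hη
  have hη0 : 0 < η := by positivity
  have hητ : η ≤ τ/20 := by rw [hη]; nlinarith
  obtain ⟨Γ1, hΓ1⟩ := net (6*D) (r/4) (by positivity)
  obtain ⟨Γ, hΓ⟩ := net (9*D) (η/4) (by positivity)
  set z0 : E3 := (-(5*D)) • EuclideanSpace.single 2 (1:ℝ) with hz0
  have z0n : ‖z0‖ = 5*D := by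
    rw [hz0, norm_smul]; simp only [norm_neg, PiLp.norm_single, norm_one, mul_one]
    rw [Real.norm_of_nonneg (by linarith)]
  have z02 : z0 2 = -(5*D) := by simp [hz0]
  obtain ⟨γ0, hγ0, hz0γ⟩ := hΓ z0 (by rw [mem_closedBall_zero_iff, z0n]; linarith)
  set M0 : ℝ≥0∞ := 2 * ENNReal.ofReal ((2*η)⁻¹) ^ 2 with hM0
  have hM0t : M0 ≠ ⊤ := by finiteness
  set K2 : ℝ≥0∞ := (Γ.card : ℝ≥0∞) * (2 ^ (Fintype.card Γ) * (1 + M0)) with hK2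
  have hK2t : K2 ≠ ⊤ := by finiteness
  refine ⟨(Γ1.card : ℝ≥0∞) * (12 * K2 + ENNReal.ofReal (12 * c⁻¹ ^ 2)), by finiteness, ?_⟩
  intro C hC hcone F hF
  set J := ∫⁻ x in Far D ∩ closedBall 0 (6*D), ‖F x‖ₑ ^ 2 with hJ
  -- interior bound
  have hint : ∫⁻ x in {x | c * B ≤ dd C x} ∩ closedBall 0 (7*D), ‖F x‖ₑ ^ 2 ≤ K2 * (WI C F + J) := by
    classical
    set N : Set E3 := {x | 2*η < dd C x} with hN
    have hNo : IsOpen N := isOpen_lt continuous_const (dd_cont C)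
    have hNO : N ⊆ Om C := fun x hx => mem_Om_of_dd (lt_trans (by positivity) hx)
    have hNI : 2 * ∫⁻ x in N, gsq F x ≤ M0 * WI C F := by
      rw [hM0, mul_assoc]
      gcongr
      unfold WI
      rw [← lintegral_const_mul' _ _ (by finiteness)]
      refine le_trans ?_ (lintegral_mono_set hNO)
      refine setLIntegral_mono_ae' hNo.measurableSet (Eventually.of_forall fun x hx => ?_)
      rw [← mul_assoc, ← mul_pow, ← ENNReal.ofReal_mul (by positivity)]
      have h1 : 1 ≤ (2*η)⁻¹ * mm C x := by
        rw [inv_mul_eq_div, one_le_div (by positivity)]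
        exact le_min (le_of_lt hx) (by linarith)
      conv_lhs => rw [← one_mul (gsq F x)]
      gcongr
      exact one_le_pow₀ (by simpa using h1)
    have hadj : ∀ u v : Γ, (gr C Γ η).Adj u v → ∫⁻ x in ball (u:E3) η, ‖F x‖ₑ ^ 2 ≤ 
        2 * (∫⁻ x in ball (v:E3) η, ‖F x‖ₑ ^ 2) + M0 * WI C F := by
      rintro u v ⟨_, h1, h2, h3⟩
      rw [dist_comm, dist_eq_norm] at h1
      have := nbr hNo (hF.mono hNO) (γ := (u:E3)) (v := (v:E3) - u) (η := η) ?_ (by linarith)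
      · rw [add_sub_cancel] at this
        refine this.trans ?_
        gcongr
      · intro x hx t ht
        show 2*η < dd C _
        have h4 := dd_lip C u (x + t • ((v:E3) - u))
        have h5 : dist (u:E3) (x + t • ((v:E3) - u)) < 2*η := by
          have := dist_triangle (u:E3) x (x + t • ((v:E3) - u))
          rw [dist_self_add_right, norm_smul, Real.norm_of_nonneg ht.1] at this
          rw [mem_ball, dist_comm] at hx
          have := ht.2
          nlinarith [norm_nonneg ((v:E3) - u)]
        linarith
    set Γ' := Γ.attach.filter (fun γ : Γ => (gr C Γ η).Reachable γ ⟨γ0, hγ0⟩) with hΓ'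
    have hc1 := cover_bound Γ' (fun γ => ball (γ:E3) η) (A := {x | c * B ≤ dd C x} ∩ closedBall 0 (7*D))
      (g := fun x => ‖F x‖ₑ ^ 2) (K := 2 ^ (Fintype.card Γ) * ((1 + M0) * (WI C F + J))) ?_ ?_
    · refine hc1.trans ?_
      have hcard : Γ'.card ≤ Γ.card := (Finset.card_filter_le _ _).trans (by simp)
      rw [hK2, mul_assoc, mul_assoc]
      gcongr
    · rintro x ⟨hx1, hx2⟩
      rw [mem_closedBall_zero_iff] at hx2
      obtain ⟨γ, hγ, hd⟩ := hΓ x (by rw [mem_closedBall_zero_iff]; linarith)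
      have hz0d : 8*τ ≤ dd C z0 := by
        refine dd_low (s := 8*τ) ?_ (by linarith)
        intro z hz hzC
        have h1 := hC.bd z (subset_closure hzC)
        have h2 := norm_le_norm_add_norm_sub' z0 z
        rw [dist_comm, dist_eq_norm] at hz
        linarith
      have hlk : Lk C Γ η x z0 := conn hD hr hrD hc hc2 hτ0 (by linarith) (by linarith) rfl hC hcone hΓ 
        (by have h : c*B ≤ dd C x := hx1
            have h8 : 8*τ = c*B := by rw [hτ]; ring
            linarith) (by linarith) hz0d (by linarith)
      simp only [mem_iUnion]
      refine ⟨⟨γ, hγ⟩, ?_, ?_⟩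
      · simp only [hΓ', Finset.mem_filter, Finset.mem_attach, true_and]
        exact hlk ⟨γ, hγ⟩ ⟨γ0, hγ0⟩ hd hz0γ
      · rw [mem_ball]; simp only; linarith
    · intro γ hγ
      have hre := (Finset.mem_filter.1 hγ).2
      refine (walk_bound (gr C Γ η) (fun γ => ∫⁻ x in ball (γ:E3) η, ‖F x‖ₑ ^ 2) (M0 * WI C F) hadj hre).trans ?_
      gcongr
      have hJ0 : ∫⁻ x in ball γ0 η, ‖F x‖ₑ ^ 2 ≤ J := by
        refine lintegral_mono_set ?_
        intro x hx
        rw [mem_ball] at hx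
        have h1 := dist_triangle x γ0 z0
        rw [dist_comm γ0 z0] at h1
        have h2 := coord_dist x z0
        rw [dist_eq_norm] at h1
        rw [dist_eq_norm] at h2
        refine ⟨⟨by linarith, ?_⟩, by rw [mem_closedBall_zero_iff]; have := norm_le_norm_add_norm_sub' x z0; linarith⟩
        have h3 := norm_le_norm_add_norm_sub' z0 x
        rw [norm_sub_rev] at h3
        linarith
      simp only
      calc _ ≤ J + M0 * WI C F := by gcongr
        _ ≤ (J + WI C F + M0 * J) + M0 * WI C F := by gcongr; rw [add_assoc]; exact le_self_add
        _ = _ := by ring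
  have hc1 := cover_bound Γ1 (fun γ => Om C ∩ ball γ (r/4) ∩ {x | ‖γ‖ ≤ 6*D + r/4}) (A := Om C ∩ closedBall 0 (6*D))
      (g := fun x => ‖F x‖ₑ ^ 2) (K := (12 * K2 + ENNReal.ofReal (12 * c⁻¹ ^ 2)) * (WI C F + J)) ?_ ?_
  · rw [mul_assoc]; exact hc1
  · rintro x ⟨hx1, hx2⟩
    obtain ⟨γ, hγ, hd⟩ := hΓ1 x hx2
    simp only [mem_iUnion]
    refine ⟨γ, hγ, ⟨hx1, hd⟩, ?_⟩
    rw [mem_closedBall_zero_iff] at hx2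
    have := norm_le_norm_add_norm_sub' γ x
    rw [dist_comm, dist_eq_norm] at hd
    show ‖γ‖ ≤ _
    linarith
  · intro γ hγ
    by_cases hγn : ‖γ‖ ≤ 6*D + r/4
    · refine (lintegral_mono_set inter_subset_left).trans ?_
      refine (near_bound hD hr hrD hc hc2 hB0 hBr hBt hB1 hC hcone hF hγn).trans ?_
      rw [add_mul, mul_assoc]
      gcongr
      exact le_self_add
    · simp [hγn]

end

section
open scoped ContDiff Topology ENNReal NNReal
open Filter

/-! ### Part 11 : far estimates -/

lemma isOpen_Far (D : ℝ) : IsOpen (Far D) := by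
  have h1 : IsOpen {x : E3 | x 2 < 0} := isOpen_lowerHalf
  exact h1.inter (isOpen_lt continuous_const continuous_norm)

lemma Far_sub {D : ℝ} (hD : 1 < D) {C : Set E3} (hC : Adm D C) : Far D ⊆ Om C := by
  intro x hx
  refine ⟨hx.1, fun h => ?_⟩
  have := hC.bd x h
  have := hx.2
  linarith

lemma dd_far {D : ℝ} (hD : 1 < D) {C : Set E3} (hC : Adm D C) {x : E3} (hx : x ∈ Far D) : - x 2 / 2 ≤ dd C x := by
  have h0 : x 2 < 0 := hx.1
  have h1 : 4*D < ‖x‖ := hx.2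
  have h2 : - x 2 ≤ ‖x‖ := by have := (abs_le.1 (coord_le_norm x 2)).1; linarith
  refine dd_low ?_ (by linarith)
  intro z hz hzC
  have h3 := hC.bd z (subset_closure hzC)
  have h4 := norm_le_norm_add_norm_sub' x z
  rw [dist_comm, dist_eq_norm] at hz
  linarith

/-- weighted Dirichlet integral with the full distance -/
def DI (C : Set E3) (F : E3 → ℝ) : ℝ≥0∞ := ∫⁻ x in Om C, ENNReal.ofReal (dd C x) ^ 2 * gsq F x

lemma WI_le_DI (C : Set E3) (F : E3 → ℝ) : WI C F ≤ DI C F := by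
  unfold WI DI
  gcongr
  exact min_le_left _ _

lemma WI_le_G (C : Set E3) (F : E3 → ℝ) : WI C F ≤ ∫⁻ x in Om C, gsq F x := by
  unfold WI
  refine lintegral_mono fun x => ?_
  have : ENNReal.ofReal (mm C x) ^ 2 ≤ 1 := by
    apply pow_le_one₀ (zero_le)
    rw [ENNReal.ofReal_le_one]
    exact min_le_right _ _
  calc _ ≤ 1 * gsq F x := by gcongr
    _ = _ := one_mul _

lemma far_down {D : ℝ} {y : E3} (hy : y ∈ Far D) {t : ℝ} (ht : 0 ≤ t) :
    y + t • (-EuclideanSpace.single 2 (1:ℝ)) ∈ Far D ∧ (y + t • (-EuclideanSpace.single 2 (1:ℝ)) : E3) 2 = y 2 - t := by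
  have ey : (y + t • (-EuclideanSpace.single 2 (1:ℝ)) : E3) 2 = y 2 - t := by simp; ring
  have h0 : y 2 < 0 := hy.1
  refine ⟨⟨?_, hy.2.trans_le ?_⟩, ey⟩
  · rw [ey]; linarith
  · apply le_of_sq_le_sq _ (norm_nonneg _)
    rw [norm_sq_E3, norm_sq_E3, ey]
    have e0 : (y + t • (-EuclideanSpace.single 2 (1:ℝ)) : E3) 0 = y 0 := by simp
    have e1 : (y + t • (-EuclideanSpace.single 2 (1:ℝ)) : E3) 1 = y 1 := by simp
    rw [e0, e1]
    nlinarith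

lemma far_L2 {D : ℝ} (hD : 1 < D) {C : Set E3} (hC : Adm D C) {F : E3 → ℝ} (hF : ContDiffOn ℝ 1 F (Om C))
    (hfin : ∫⁻ x in Om C, ‖F x‖ₑ ^ 2 ≠ ⊤) : ∫⁻ x in Far D, ‖F x‖ₑ ^ 2 ≤ 48 * DI C F := by
  have hsub := Far_sub hD hC
  set Z : ℕ → Set E3 := fun n => Far D ∩ {x | x 2 < -((n:ℝ)+1)} with hZ
  have mZ : ∀ n, MeasurableSet (Z n) := fun n =>
    (isOpen_Far D).measurableSet.inter (isOpen_lt (by fun_prop) continuous_const).measurableSet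
  have key : ∀ n : ℕ, ∫⁻ x in Far D, ‖F x‖ₑ ^ 2 ≤ 12 * (∫⁻ x in Z n, ‖F x‖ₑ ^ 2) + 48 * DI C F := by
    intro n
    have hn : (0:ℝ) < (n:ℝ)+1 := by positivity
    have := Hd (ν := -EuclideanSpace.single 2 (1:ℝ)) (B := (n:ℝ)+1) (c := 1/2) hn (by norm_num) (by simp)
      (A := Far D) (N := Far D) (Z := Z n) (isOpen_Far D).measurableSet (isOpen_Far D) (mZ n) inter_subset_left
      (hF.mono hsub) (w := dd C) (dd_cont C).measurable ?_ ?_ ?_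
    · refine this.trans ?_
      have e : ENNReal.ofReal (12 * (1/2:ℝ)⁻¹ ^ 2) = 48 := by norm_num
      rw [e]
      gcongr
      exact lintegral_mono_set hsub
    · intro y hy t ht
      exact (far_down hy ht.1).1
    · intro y hy t ht
      have := far_down hy (hn.trans ht.1).le
      refine ⟨this.1, ?_⟩
      rw [mem_ofPred_eq, this.2]
      have h0 : y 2 < 0 := hy.1
      linarith [ht.1]
    · intro y hy t ht
      have := far_down hy ht.1
      have h2 := dd_far hD hC this.1
      rw [this.2] at h2
      have h0 : y 2 < 0 := hy.1
      linarith
  have hlim : Tendsto (fun n => ∫⁻ x in Z n, ‖F x‖ₑ ^ 2) atTop (𝓝 0) := by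
    have h2 : ∀ n, (∫⁻ x in Z n, ‖F x‖ₑ ^ 2) = (volume.withDensity (fun x => ‖F x‖ₑ ^ 2)) (Z n) := fun n =>
      (withDensity_apply _ (mZ n)).symm
    simp_rw [h2]
    have h3 : ⋂ n, Z n = ∅ := by
      ext x
      simp only [mem_iInter, mem_empty_iff_false, iff_false, not_forall]
      obtain ⟨n, hn⟩ := exists_nat_gt (- x 2)
      refine ⟨n, fun h => ?_⟩
      have : x 2 < -((n:ℝ)+1) := h.2
      linarith
    have h4 := tendsto_measure_iInter_atTop (μ := volume.withDensity (fun x => ‖F x‖ₑ ^ 2)) (s := Z)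
      (fun n => (mZ n).nullMeasurableSet) ?_ ⟨0, ?_⟩
    · rw [h3] at h4
      simpa [Function.comp_def] using h4
    · intro m n hmn x hx
      refine ⟨hx.1, ?_⟩
      have : x 2 < -((n:ℝ)+1) := hx.2
      have h5 : (m:ℝ) ≤ n := by exact_mod_cast hmn
      show x 2 < -((m:ℝ)+1)
      linarith
    · rw [← h2]
      exact ne_top_of_le_ne_top hfin (lintegral_mono_set (inter_subset_left.trans hsub))
  have h5 : Tendsto (fun n => 12 * (∫⁻ x in Z n, ‖F x‖ₑ ^ 2) + 48 * DI C F) atTop (𝓝 (12 * 0 + 48 * DI C F)) :=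
    (ENNReal.Tendsto.const_mul hlim (Or.inr (by norm_num))).add_const _
  have := ge_of_tendsto' h5 key
  simpa using this

theorem L2_le_DI {D r t0 c : ℝ} (hD : 1 < D) (hr : 0 < r) (ht0 : 0 < t0) (hc : 0 < c) :
    ∃ K : ℝ≥0∞, K ≠ ⊤ ∧ ∀ C, Adm D C → ConeC C r t0 c → ∀ F : E3 → ℝ, ContDiffOn ℝ 1 F (Om C) →
      ∫⁻ x in Om C, ‖F x‖ₑ ^ 2 ≠ ⊤ → ∫⁻ x in Om C, ‖F x‖ₑ ^ 2 ≤ K * DI C F := by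
  obtain ⟨K, hK, h⟩ := Qineq hD hr ht0 hc
  refine ⟨K * 49 + 48, by finiteness, ?_⟩
  intro C hC hcone F hF hfin
  have h1 := h C hC hcone F hF
  have h2 := far_L2 hD hC hF hfin
  have h3 : Om C ⊆ (Om C ∩ closedBall 0 (6*D)) ∪ Far D := by
    intro x hx
    by_cases hn : ‖x‖ ≤ 6*D
    · exact Or.inl ⟨hx, by simpa using hn⟩
    · exact Or.inr ⟨hx.1, by linarith⟩
  calc ∫⁻ x in Om C, ‖F x‖ₑ ^ 2 ≤ _ := lintegral_mono_set h3
    _ ≤ _ := lintegral_union_le _ _ _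
    _ ≤ K * (DI C F + 48 * DI C F) + 48 * DI C F := by
      refine add_le_add (h1.trans ?_) h2
      gcongr
      · exact WI_le_DI C F
      · exact (lintegral_mono_set inter_subset_left).trans h2
    _ = _ := by ring


lemma int32 : ∫⁻ t in Ioi (1:ℝ), ENNReal.ofReal (t ^ (-(3/2):ℝ)) = 2 := by
  rw [← ofReal_integral_eq_lintegral_ofReal (integrableOn_Ioi_rpow_of_lt (by norm_num) zero_lt_one), 
      integral_Ioi_rpow_of_lt (by norm_num) zero_lt_one]
  · norm_num
  · filter_upwards [self_mem_ae_restrict measurableSet_Ioi] with t ht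
    have h0 : (0:ℝ) < t := lt_trans zero_lt_one ht
    positivity

lemma lint_smul {G : E3 → ℝ≥0∞} (hG : Measurable G) {t : ℝ} (ht : 0 < t) :
    ∫⁻ x, G (t • x) = ENNReal.ofReal (t^3)⁻¹ * ∫⁻ x, G x := by
  have h := lintegral_map (μ := (volume : Measure E3)) hG (measurable_const_smul t)
  rw [← h, Measure.map_addHaar_smul _ ht.ne', lintegral_smul_measure]
  simp [finrank_euclideanSpace, abs_of_pos ht]

lemma radial_pt {D : ℝ} (hD : 1 < D) {f : E3 → ℝ} (hf : ContDiff ℝ 1 f) {T : ℝ} (hT : 1 ≤ T)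
    (hs : ∀ x, T < ‖x‖ → f x = 0) {x : E3} (hx : x ∈ Far D) :
    ‖f x‖ₑ ^ 2 ≤ ENNReal.ofReal (‖x‖ ^ 2) * (2 * ∫⁻ t in Ioc 1 T, ENNReal.ofReal (t ^ (3/2:ℝ)) * gsq f (t • x)) := by
  have hx0 : 4*D < ‖x‖ := hx.2
  have hxp : 0 < ‖x‖ := by linarith
  have hder : ∀ t ∈ uIcc (1:ℝ) T, HasDerivAt (fun t : ℝ => f (t • x)) (fderiv ℝ f (t • x) x) t := by
    intro t ht
    have d1 : HasFDerivAt f (fderiv ℝ f (t • x)) (t • x) := (hf.differentiable (by simp) _).hasFDerivAt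
    have d2 : HasDerivAt (fun t : ℝ => t • x) x t := by
      simpa using ((hasDerivAt_id t).smul_const x)
    exact d1.comp_hasDerivAt t d2
  have hcont : Continuous (fun t : ℝ => fderiv ℝ f (t • x) x) := by
    have d0 := hf.continuous_fderiv (by simp)
    fun_prop
  have e := intervalIntegral.integral_eq_sub_of_hasDerivAt hder (hcont.intervalIntegrable _ _)
  have hz : f (T • x) = 0 := by
    apply hs
    rw [norm_smul, Real.norm_of_nonneg (by linarith)]
    nlinarith
  rw [hz, one_smul, zero_sub] at e
  rw [← enorm_neg, ← e, intervalIntegral.integral_of_le hT]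
  refine (pow_le_pow_left' (enorm_integral_le_lintegral_enorm _) 2).trans ?_
  have pw : ∀ t : ℝ, 0 < t → ‖fderiv ℝ f (t • x) x‖ₑ = ENNReal.ofReal (t ^ (-(3/4):ℝ)) * (ENNReal.ofReal (t ^ (3/4:ℝ)) * ‖fderiv ℝ f (t • x) x‖ₑ) := by
    intro t ht
    rw [← mul_assoc, ← ENNReal.ofReal_mul (by positivity), ← Real.rpow_add ht]
    norm_num
  have e2 : ∫⁻ t in Ioc 1 T, ‖fderiv ℝ f (t • x) x‖ₑ = ∫⁻ t in Ioc 1 T, ENNReal.ofReal (t ^ (-(3/4):ℝ)) * (ENNReal.ofReal (t ^ (3/4:ℝ)) * ‖fderiv ℝ f (t • x) x‖ₑ) := 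
    setLIntegral_congr_fun measurableSet_Ioc fun t ht => pw t (by linarith [ht.1])
  rw [e2]
  refine (cs_lint (by fun_prop) (by fun_prop)).trans ?_
  have i1 : ∫⁻ t in Ioc 1 T, ENNReal.ofReal (t ^ (-(3/4):ℝ)) ^ 2 ≤ 2 := by
    refine (lintegral_mono_set (Ioc_subset_Ioi_self)).trans ?_
    have e3 : ∫⁻ t in Ioi (1:ℝ), ENNReal.ofReal (t ^ (-(3/4):ℝ)) ^ 2 = ∫⁻ t in Ioi (1:ℝ), ENNReal.ofReal (t ^ (-(3/2):ℝ)) := by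
      refine setLIntegral_congr_fun measurableSet_Ioi fun t ht => ?_
      have h0 : (0:ℝ) < t := lt_trans zero_lt_one ht
      rw [← ENNReal.ofReal_pow (by positivity), ← Real.rpow_natCast, ← Real.rpow_mul h0.le]
      norm_num
    rw [e3, int32]
  have i2 : ∫⁻ t in Ioc 1 T, (ENNReal.ofReal (t ^ (3/4:ℝ)) * ‖fderiv ℝ f (t • x) x‖ₑ) ^ 2 ≤ 
      ENNReal.ofReal (‖x‖ ^ 2) * ∫⁻ t in Ioc 1 T, ENNReal.ofReal (t ^ (3/2:ℝ)) * gsq f (t • x) := by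
    rw [← lintegral_const_mul' _ _ (by finiteness)]
    refine setLIntegral_mono_ae' measurableSet_Ioc (Eventually.of_forall fun t ht => ?_)
    have h0 : (0:ℝ) < t := lt_trans zero_lt_one ht.1
    have e4 : ENNReal.ofReal (t ^ (3/4:ℝ)) ^ 2 = ENNReal.ofReal (t ^ (3/2:ℝ)) := by
      rw [← ENNReal.ofReal_pow (by positivity), ← Real.rpow_natCast, ← Real.rpow_mul h0.le]
      norm_num
    have e5 : ‖fderiv ℝ f (t • x) x‖ₑ = ENNReal.ofReal ‖x‖ * ‖fderiv ℝ f (t • x) (‖x‖⁻¹ • x)‖ₑ := by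
      rw [map_smul, enorm_smul, ← mul_assoc, enorm_inv hxp.ne', enorm_norm, ofReal_norm, ENNReal.mul_inv_cancel, one_mul]
      · simpa using hxp
      · simp
    rw [mul_pow, e4, e5, mul_pow, ENNReal.ofReal_pow (norm_nonneg _), mul_left_comm]
    gcongr
    refine fderiv_le_gsq f _ ?_
    rw [norm_smul, norm_inv, norm_norm, inv_mul_cancel₀ hxp.ne']
  refine (mul_le_mul' i1 i2).trans ?_
  rw [mul_left_comm]

lemma radial_hardy {D : ℝ} (hD : 1 < D) {f : E3 → ℝ} (hf : ContDiff ℝ 1 f) (hc : HasCompactSupport f) :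
    ∫⁻ x in Far D, ENNReal.ofReal (1/‖x‖^2) * ‖f x‖ₑ ^ 2 ≤ 4 * ∫⁻ x in Far D, gsq f x := by
  obtain ⟨T, hT1, hT⟩ : ∃ T : ℝ, 1 ≤ T ∧ ∀ x, T < ‖x‖ → f x = 0 := by
    obtain ⟨R, hR⟩ := hc.isCompact.isBounded.exists_norm_le
    refine ⟨max R 1, le_max_right _ _, fun x hx => ?_⟩
    by_contra h
    have := hR x (subset_tsupport _ h)
    have := le_max_left R 1
    linarith
  have mg := meas_gsq f
  have h1 : ∀ x ∈ Far D, ENNReal.ofReal (1/‖x‖^2) * ‖f x‖ₑ ^ 2 ≤ 2 * ∫⁻ t in Ioc 1 T, ENNReal.ofReal (t ^ (3/2:ℝ)) * (Far D).indicator (gsq f) (t • x) := by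
    intro x hx
    have hx0 : 4*D < ‖x‖ := hx.2
    have hxp : 0 < ‖x‖ := by linarith
    refine (mul_le_mul_right (radial_pt hD hf hT1 hT hx) _).trans ?_
    rw [← mul_assoc, ← ENNReal.ofReal_mul (by positivity), one_div, inv_mul_cancel₀ (by positivity), ENNReal.ofReal_one, one_mul]
    gcongr 2 * ?_
    refine setLIntegral_mono_ae' measurableSet_Ioc (Eventually.of_forall fun t ht => ?_)
    have h2 : t • x ∈ Far D := by
      refine ⟨?_, ?_⟩
      · have h : x 2 < 0 := hx.1
        simp only [PiLp.smul_apply, smul_eq_mul]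
        nlinarith [ht.1]
      · rw [norm_smul, Real.norm_of_nonneg (by linarith [ht.1])]
        nlinarith [ht.1]
    rw [indicator_of_mem h2]
  refine (setLIntegral_mono_ae' (isOpen_Far D).measurableSet (Eventually.of_forall h1)).trans ?_
  refine (setLIntegral_le_lintegral _ _).trans ?_
  set G := (Far D).indicator (gsq f) with hG
  have mG : Measurable G := mg.indicator (isOpen_Far D).measurableSet
  rw [lintegral_const_mul' _ _ (by norm_num), lintegral_lintegral_swap (by fun_prop)]
  have h3 : ∀ t ∈ Ioc 1 T, ∫⁻ x, ENNReal.ofReal (t ^ (3/2:ℝ)) * G (t • x) = ENNReal.ofReal (t ^ (-(3/2):ℝ)) * ∫⁻ x, G x := by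
    intro t ht
    have h0 : (0:ℝ) < t := lt_trans zero_lt_one ht.1
    rw [lintegral_const_mul' _ _ (by finiteness)]
    rw [lint_smul mG h0, ← mul_assoc, ← ENNReal.ofReal_mul (by positivity)]
    congr 2
    rw [← Real.rpow_natCast, ← Real.rpow_neg h0.le, ← Real.rpow_add h0]
    norm_num
  rw [setLIntegral_congr_fun measurableSet_Ioc h3, lintegral_mul_const _ (by fun_prop)]
  have h4 : ∫⁻ t in Ioc (1:ℝ) T, ENNReal.ofReal (t ^ (-(3/2):ℝ)) ≤ 2 := by
    rw [← int32]; exact lintegral_mono_set Ioc_subset_Ioi_self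
  rw [hG, lintegral_indicator (isOpen_Far D).measurableSet, ← mul_assoc]
  gcongr
  calc _ ≤ (2:ℝ≥0∞) * 2 := by gcongr
    _ = 4 := by norm_num

/-- weighted Hardy inequality -/
theorem Hardy {D r t0 c : ℝ} (hD : 1 < D) (hr : 0 < r) (ht0 : 0 < t0) (hc : 0 < c) :
    ∃ K : ℝ≥0∞, K ≠ ⊤ ∧ ∀ C, Adm D C → ConeC C r t0 c → ∀ f : E3 → ℝ, ContDiff ℝ 1 f → HasCompactSupport f →
      ∫⁻ x in Om C, ENNReal.ofReal (1/(1+‖x‖^2)) * ‖f x‖ₑ ^ 2 ≤ K * ∫⁻ x in Om C, gsq f x := by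
  obtain ⟨K, hK, h⟩ := Qineq hD hr ht0 hc
  set q := ENNReal.ofReal (36*D^2) with hq
  refine ⟨K * (1 + q * 4) + 4, by finiteness, ?_⟩
  intro C hC hcone f hf hcs
  have h1 := h C hC hcone f hf.contDiffOn
  have h2 := radial_hardy hD hf hcs
  set G := ∫⁻ x in Om C, gsq f x with hG
  have h2' : ∫⁻ x in Far D, ENNReal.ofReal (1/‖x‖^2) * ‖f x‖ₑ ^ 2 ≤ 4 * G := by
    refine h2.trans ?_
    gcongr
    exact lintegral_mono_set (Far_sub hD hC)
  have h3 : Om C ⊆ (Om C ∩ closedBall 0 (6*D)) ∪ Far D := by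
    intro x hx
    by_cases hn : ‖x‖ ≤ 6*D
    · exact Or.inl ⟨hx, by simpa using hn⟩
    · exact Or.inr ⟨hx.1, by linarith⟩
  have h4 : ∫⁻ x in Om C ∩ closedBall 0 (6*D), ENNReal.ofReal (1/(1+‖x‖^2)) * ‖f x‖ₑ ^ 2 ≤ 
      ∫⁻ x in Om C ∩ closedBall 0 (6*D), ‖f x‖ₑ ^ 2 := by
    gcongr with x
    conv_rhs => rw [← one_mul (‖f x‖ₑ ^ 2)]
    gcongr
    rw [ENNReal.ofReal_le_one]
    rw [div_le_one (by positivity)]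
    nlinarith [sq_nonneg ‖x‖]
  have h5 : ∫⁻ x in Far D, ENNReal.ofReal (1/(1+‖x‖^2)) * ‖f x‖ₑ ^ 2 ≤ 
      ∫⁻ x in Far D, ENNReal.ofReal (1/‖x‖^2) * ‖f x‖ₑ ^ 2 := by
    refine setLIntegral_mono_ae' (isOpen_Far D).measurableSet (Eventually.of_forall fun x hx => ?_)
    have hx0 : 4*D < ‖x‖ := hx.2
    have hxp : 0 < ‖x‖ := by linarith
    gcongr
    linarith
  have h6 : ∫⁻ x in Far D ∩ closedBall 0 (6*D), ‖f x‖ₑ ^ 2 ≤ q * (4 * G) := by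
    refine le_trans ?_ (mul_le_mul_right h2' q)
    rw [← lintegral_const_mul' _ _ (by finiteness)]
    refine le_trans ?_ (lintegral_mono_set (inter_subset_left (t := closedBall 0 (6*D))))
    refine setLIntegral_mono_ae' ((isOpen_Far D).measurableSet.inter measurableSet_closedBall) (Eventually.of_forall fun x hx => ?_)
    have hx0 : 4*D < ‖x‖ := hx.1.2
    have hxp : 0 < ‖x‖ := by linarith
    have hx1 : ‖x‖ ≤ 6*D := by simpa using hx.2
    rw [← mul_assoc, ← ENNReal.ofReal_mul (by positivity)]
    conv_lhs => rw [← one_mul (‖f x‖ₑ ^ 2)]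
    gcongr
    rw [ENNReal.one_le_ofReal, mul_one_div, one_le_div (by positivity)]
    nlinarith
  calc ∫⁻ x in Om C, ENNReal.ofReal (1/(1+‖x‖^2)) * ‖f x‖ₑ ^ 2 ≤ _ := lintegral_mono_set h3
    _ ≤ _ := lintegral_union_le _ _ _
    _ ≤ K * (G + q * (4 * G)) + 4 * G := by
      refine add_le_add (h4.trans (h1.trans ?_)) (h5.trans h2')
      gcongr
      exact WI_le_G C f
    _ = _ := by ring

end

section
open scoped ContDiff Topology ENNReal NNReal
open Filter

/-! ### Part 12 : Hilbert space framework -/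

abbrev muO (C : Set E3) : Measure E3 := volume.restrict (Om C)
abbrev LL (C : Set E3) := Lp ℝ 2 (muO C)
abbrev Ix := Fin 3 × Fin 3
abbrev MM (C : Set E3) := PiLp 2 (fun _ : Ix => LL C)

open Classical in
def lq (C : Set E3) (f : E3 → ℝ) : LL C := if h : MemLp f 2 (muO C) then h.toLp f else 0

variable {C : Set E3}

lemma lq_ae {f : E3 → ℝ} (h : MemLp f 2 (muO C)) : lq C f =ᵐ[muO C] f := by
  rw [lq, dif_pos h]; exact h.coeFn_toLp

lemma lq_coe (a : LL C) : lq C (a : E3 → ℝ) = a := by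
  have h : MemLp (a : E3 → ℝ) 2 (muO C) := Lp.memLp a
  rw [lq, dif_pos h]; exact Lp.toLp_coeFn a h

lemma lq_congr {f g : E3 → ℝ} (h : f =ᵐ[muO C] g) : lq C f = lq C g := by
  by_cases hf : MemLp f 2 (muO C)
  · have hg := hf.ae_eq h
    rw [lq, dif_pos hf, lq, dif_pos hg, MemLp.toLp_eq_toLp_iff]; exact h
  · have hg : ¬ MemLp g 2 (muO C) := fun hg => hf (hg.ae_eq h.symm)
    rw [lq, dif_neg hf, lq, dif_neg hg]

lemma lq_add {f g : E3 → ℝ} (hf : MemLp f 2 (muO C)) (hg : MemLp g 2 (muO C)) :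
    lq C (fun x => f x + g x) = lq C f + lq C g := by
  have h : MemLp (fun x => f x + g x) 2 (muO C) := hf.add hg
  rw [lq, dif_pos h, lq, dif_pos hf, lq, dif_pos hg]; rfl

lemma lq_smul {f : E3 → ℝ} (hf : MemLp f 2 (muO C)) (c : ℝ) :
    lq C (fun x => c * f x) = c • lq C f := by
  rw [lq, dif_pos (hf.const_mul c), lq, dif_pos hf]; rfl

lemma inner_LL (a b : LL C) : inner ℝ a b = ∫ x in Om C, a x * b x := by
  rw [L2.inner_def]; simp [mul_comm]

lemma inner_lq {f : E3 → ℝ} (hf : MemLp f 2 (muO C)) (a : LL C) :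
    inner ℝ a (lq C f) = ∫ x in Om C, a x * f x := by
  rw [inner_LL]
  apply integral_congr_ae
  filter_upwards [lq_ae hf] with x hx
  rw [hx]

lemma inner_lq2 {f g : E3 → ℝ} (hf : MemLp f 2 (muO C)) (hg : MemLp g 2 (muO C)) :
    inner ℝ (lq C f) (lq C g) = ∫ x in Om C, f x * g x := by
  rw [inner_lq hg]
  apply integral_congr_ae
  filter_upwards [lq_ae hf] with x hx
  rw [hx]

lemma normsq_LL (a : LL C) : ENNReal.ofReal (‖a‖ ^ 2) = ∫⁻ x in Om C, ‖a x‖ₑ ^ 2 := by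
  have h := Lp.enorm_def a
  rw [eLpNorm_eq_lintegral_rpow_enorm_toReal (by norm_num) (by norm_num)] at h
  rw [ENNReal.ofReal_pow (norm_nonneg _), ofReal_norm, h, ← ENNReal.rpow_natCast, ← ENNReal.rpow_mul]
  simp

lemma normsq_lq {f : E3 → ℝ} (hf : MemLp f 2 (muO C)) :
    ENNReal.ofReal (‖lq C f‖ ^ 2) = ∫⁻ x in Om C, ‖f x‖ₑ ^ 2 := by
  rw [normsq_LL]
  apply lintegral_congr_ae
  filter_upwards [lq_ae hf] with x hx
  rw [hx]

lemma memLp_iff {f : E3 → ℝ} (hf : AEStronglyMeasurable f (muO C)) (h : ∫⁻ x in Om C, ‖f x‖ₑ ^ 2 ≠ ⊤) :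
    MemLp f 2 (muO C) := by
  refine ⟨hf, ?_⟩
  rw [eLpNorm_lt_top_iff_lintegral_rpow_enorm_lt_top (by norm_num) (by norm_num)]
  simpa using lt_top_iff_ne_top.2 h

lemma memLp_cs {f : E3 → ℝ} (hf : Continuous f) (hc : HasCompactSupport f) : MemLp f 2 (muO C) :=
  (hf.memLp_of_hasCompactSupport (p := 2) (μ := volume) hc).restrict _

lemma memLp_pd {O : Set E3} {f : E3 → ℝ} (hf : TestOn O f) (k : Fin 3) : MemLp (pd f k) 2 (muO C) :=
  memLp_cs (hf.pd k).sm.continuous (hf.pd k).cs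

lemma memLp_test {O : Set E3} {f : E3 → ℝ} (hf : TestOn O f) : MemLp f 2 (muO C) :=
  memLp_cs hf.sm.continuous hf.cs

def Ex (C : Set E3) (a : E3 → ℝ) : E3 → ℝ := (Om C).indicator a

lemma meas_Om (C : Set E3) : MeasurableSet (Om C) := (isOpen_Om C).measurableSet

lemma Ex_li {f : E3 → ℝ} (h : MemLp f 2 (muO C)) : LocallyIntegrable (Ex C f) volume := by
  have : MemLp (Ex C f) 2 volume := (memLp_indicator_iff_restrict (meas_Om C)).2 h
  exact this.locallyIntegrable (by norm_num)

lemma Ex_int (f φ : E3 → ℝ) : ∫ x, Ex C f x * φ x = ∫ x in Om C, f x * φ x := by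
  rw [← integral_indicator (meas_Om C)]
  congr 1; funext x
  by_cases h : x ∈ Om C <;> simp [Ex, h]

lemma test_int {φ : E3 → ℝ} (g : E3 → ℝ) (h : TestOn (Om C) φ) :
    ∫ x in Om C, g x * φ x = ∫ x, g x * φ x := by
  apply setIntegral_eq_integral_of_forall_compl_eq_zero
  intro x hx
  rw [image_eq_zero_of_notMem_tsupport (fun h' => hx (h.ts h')), mul_zero]

lemma inner_test {φ : E3 → ℝ} (h : TestOn (Om C) φ) (a : LL C) :
    inner ℝ a (lq C φ) = ∫ x, Ex C a x * φ x := by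
  rw [inner_lq (memLp_test h), Ex_int]

def grad (C : Set E3) (v : Fin 3 → E3 → ℝ) : MM C := WithLp.toLp 2 (fun p => lq C (pd (v p.1) p.2))

@[simp] lemma grad_apply (v : Fin 3 → E3 → ℝ) (p : Ix) : grad C v p = lq C (pd (v p.1) p.2) := rfl

lemma TestOn.add {O : Set E3} {f g : E3 → ℝ} (hf : TestOn O f) (hg : TestOn O g) :
    TestOn O (fun x => f x + g x) :=
  ⟨hf.sm.add hg.sm, hf.cs.add hg.cs, (tsupport_add f g).trans (union_subset hf.ts hg.ts)⟩

lemma TestOn.cmul {O : Set E3} {f : E3 → ℝ} (hf : TestOn O f) (c : ℝ) :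
    TestOn O (fun x => c * f x) :=
  ⟨contDiff_const.mul hf.sm, hf.cs.mul_left, (tsupport_mul_subset_right).trans hf.ts⟩

lemma TestOn.zero {O : Set E3} : TestOn O (fun _ => (0:ℝ)) :=
  ⟨contDiff_const, HasCompactSupport.zero, by simp [tsupport]⟩

lemma TestOn.univ {O : Set E3} {f : E3 → ℝ} (hf : TestOn O f) : TestOn univ f := ⟨hf.sm, hf.cs, subset_univ _⟩

def VO (C O : Set E3) : Submodule ℝ (MM C) where
  carrier := {G | ∃ v : Fin 3 → E3 → ℝ, (∀ i, TestOn O (v i)) ∧ G = grad C v}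
  add_mem' := by
    rintro _ _ ⟨v, hv, rfl⟩ ⟨w, hw, rfl⟩
    refine ⟨fun i x => v i x + w i x, fun i => (hv i).add (hw i), ?_⟩
    ext1 p
    simp only [PiLp.add_apply, grad_apply]
    rw [pd_add (hv _).sm (hw _).sm, lq_add (memLp_pd (hv _) _) (memLp_pd (hw _) _)]
  zero_mem' := by
    refine ⟨fun i x => 0, fun i => TestOn.zero, ?_⟩
    ext1 p
    have h : pd (fun _ => (0:ℝ)) p.2 = fun x => 0 * (0:ℝ) := by funext x; simp [pd]
    simp only [grad_apply, h]
    rw [lq_smul (f := fun _ => (0:ℝ)) (by simp)]; simp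
  smul_mem' := by
    rintro c _ ⟨v, hv, rfl⟩
    refine ⟨fun i x => c * v i x, fun i => (hv i).cmul c, ?_⟩
    ext1 p
    simp only [PiLp.smul_apply, grad_apply]
    rw [pd_const_mul (hv _).sm, lq_smul (memLp_pd (hv _) _)]

def VV (C : Set E3) : Submodule ℝ (MM C) := (VO C univ).topologicalClosure
def V0 (C : Set E3) : Submodule ℝ (MM C) := (VO C (Om C)).topologicalClosure

instance : CompleteSpace (VV C) := by unfold VV; infer_instance
instance : CompleteSpace (V0 C) := by unfold V0; infer_instance

lemma VO_le : VO C (Om C) ≤ VO C univ := by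
  rintro _ ⟨v, hv, rfl⟩
  exact ⟨v, fun i => (hv i).univ, rfl⟩

lemma V0_le : V0 C ≤ VV C := Submodule.topologicalClosure_mono VO_le

lemma VV_ind {P : MM C → Prop} (hc : IsClosed {G | P G})
    (h : ∀ v : Fin 3 → E3 → ℝ, (∀ i, TestOn univ (v i)) → P (grad C v)) : ∀ G ∈ VV C, P G := by
  intro G hG
  have : closure (VO C univ : Set (MM C)) ⊆ {G | P G} := by
    apply closure_minimal _ hc
    rintro _ ⟨v, hv, rfl⟩
    exact h v hv
  exact this hG

lemma V0_ind {P : MM C → Prop} (hc : IsClosed {G | P G})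
    (h : ∀ v : Fin 3 → E3 → ℝ, (∀ i, TestOn (Om C) (v i)) → P (grad C v)) : ∀ G ∈ V0 C, P G := by
  intro G hG
  have : closure (VO C (Om C) : Set (MM C)) ⊆ {G | P G} := by
    apply closure_minimal _ hc
    rintro _ ⟨v, hv, rfl⟩
    exact h v hv
  exact this hG

/-- transpose -/
def Tt (C : Set E3) : MM C ≃ₗᵢ[ℝ] MM C := LinearIsometryEquiv.piLpCongrLeft 2 ℝ (LL C) (Equiv.prodComm _ _)

@[simp] lemma Tt_apply (G : MM C) (p : Ix) : Tt C G p = G p.swap := rfl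

def tr (C : Set E3) : MM C →L[ℝ] LL C := ∑ i : Fin 3, PiLp.proj 2 (fun _ : Ix => LL C) (i, i)

@[simp] lemma tr_apply (G : MM C) : tr C G = ∑ i : Fin 3, G (i, i) := by
  simp [tr]

lemma normsq_MM (G : MM C) : ‖G‖ ^ 2 = ∑ i, ∑ j, ‖G (i, j)‖ ^ 2 := by
  rw [PiLp.norm_sq_eq_of_L2, Fintype.sum_prod_type]

lemma inner_MM (G H : MM C) : inner ℝ G H = ∑ i, ∑ j, inner ℝ (G (i, j)) (H (i, j)) := by
  rw [PiLp.inner_apply, Fintype.sum_prod_type]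

lemma tr_le (G : MM C) : ‖tr C G‖ ^ 2 ≤ 3 * ‖G‖ ^ 2 := by
  rw [tr_apply, normsq_MM]
  have h1 : ‖∑ i : Fin 3, G (i, i)‖ ≤ ∑ i : Fin 3, ‖G (i,i)‖ := norm_sum_le _ _
  simp only [Fin.sum_univ_three] at *
  have h2 := norm_nonneg (G (0,0) + G (1,1) + G (2,2))
  nlinarith [sq_nonneg (‖G (0,0)‖ - ‖G (1,1)‖), sq_nonneg (‖G (0,0)‖ - ‖G (2,2)‖), sq_nonneg (‖G (2,2)‖ - ‖G (1,1)‖), sq_nonneg ‖G (0,1)‖, sq_nonneg ‖G (0,2)‖, sq_nonneg ‖G (1,0)‖, sq_nonneg ‖G (1,2)‖, sq_nonneg ‖G (2,0)‖, sq_nonneg ‖G (2,1)‖]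

end

section
open scoped ContDiff Topology ENNReal NNReal
open Filter

/-! ### Part 13 : Korn inequality -/
variable {C : Set E3}

lemma sw {v φ : E3 → ℝ} (hv : TestOn univ v) (hφ : TestOn (Om C) φ) (i j : Fin 3) :
    inner ℝ (lq C (pd v i)) (lq C (pd φ j)) = inner ℝ (lq C (pd v j)) (lq C (pd φ i)) := by
  rw [inner_lq2 (memLp_pd hv _) (memLp_pd hφ _), inner_lq2 (memLp_pd hv _) (memLp_pd hφ _),
    test_int _ (hφ.pd j), test_int _ (hφ.pd i),
    ibp isOpen_univ ((hv.pd i).sm.of_le (by simp)).contDiffOn hφ.univ j,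
    ibp isOpen_univ ((hv.pd j).sm.of_le (by simp)).contDiffOn hφ.univ i, pd_comm hv.sm i j]

lemma VV_V0 {G Φ : MM C} (hG : G ∈ VV C) (hΦ : Φ ∈ V0 C) :
    inner ℝ (Tt C G) Φ = inner ℝ (tr C G) (tr C Φ) := by
  revert Φ
  apply V0_ind
  · exact isClosed_eq (by fun_prop) (by fun_prop)
  intro φ hφ
  revert G
  apply VV_ind
  · exact isClosed_eq (by fun_prop) (by fun_prop)
  intro v hv
  rw [inner_MM, tr_apply, tr_apply, sum_inner, Finset.sum_comm]
  simp only [inner_sum, Tt_apply, grad_apply, Prod.swap]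
  refine Finset.sum_congr rfl fun j _ => Finset.sum_congr rfl fun i _ => ?_
  exact sw (hv j) (hφ i) i j

lemma VV_curl {G : MM C} (hG : G ∈ VV C) {φ : E3 → ℝ} (hφ : TestOn (Om C) φ) (i j k : Fin 3) :
    inner ℝ (G (i, j)) (lq C (pd φ k)) = inner ℝ (G (i, k)) (lq C (pd φ j)) := by
  revert G
  apply VV_ind
  · exact isClosed_eq (by fun_prop) (by fun_prop)
  intro v hv
  exact sw (hv i) hφ j k

lemma V0_mem {φ : Fin 3 → E3 → ℝ} (hφ : ∀ i, TestOn (Om C) (φ i)) : grad C φ ∈ V0 C :=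
  Submodule.le_topologicalClosure _ ⟨φ, hφ, rfl⟩

lemma VV_mem {φ : Fin 3 → E3 → ℝ} (hφ : ∀ i, TestOn univ (φ i)) : grad C φ ∈ VV C :=
  Submodule.le_topologicalClosure _ ⟨φ, hφ, rfl⟩

lemma lq_zero_pd (k : Fin 3) : lq C (pd (fun _ => (0:ℝ)) k) = 0 := by
  have h : pd (fun _ => (0:ℝ)) k = fun x => 0 * (0:ℝ) := by funext x; simp [pd]
  rw [h, lq_smul (f := fun _ => (0:ℝ)) (by simp)]; simp

/-- a single-row test field -/
def rowf (i : Fin 3) (φ : E3 → ℝ) : Fin 3 → E3 → ℝ := fun m => if m = i then φ else fun _ => 0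

lemma rowf_test {O : Set E3} {φ : E3 → ℝ} (h : TestOn O φ) (i m : Fin 3) : TestOn O (rowf i φ m) := by
  unfold rowf; split_ifs
  · exact h
  · exact TestOn.zero

lemma inner_rowf (H : MM C) (i : Fin 3) (φ : E3 → ℝ) :
    inner ℝ H (grad C (rowf i φ)) = ∑ j, inner ℝ (H (i, j)) (lq C (pd φ j)) := by
  rw [inner_MM, Finset.sum_eq_single i]
  · simp [rowf]
  · intro m _ hm
    simp [rowf, hm, lq_zero_pd]
  · simp

lemma perp_div {H : MM C} (hH : ∀ Φ ∈ V0 C, inner ℝ H Φ = 0) {φ : E3 → ℝ} (hφ : TestOn (Om C) φ) (i : Fin 3) :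
    ∑ j, inner ℝ (H (i, j)) (lq C (pd φ j)) = 0 := by
  rw [← inner_rowf]
  exact hH _ (V0_mem fun m => rowf_test hφ i m)

lemma lq_lap {φ : E3 → ℝ} (hφ : TestOn (Om C) φ) : lq C (lap φ) = ∑ k, lq C (pd (pd φ k) k) := by
  have e : lap φ = fun x => (pd (pd φ 0) 0 x + pd (pd φ 1) 1 x) + pd (pd φ 2) 2 x := by
    funext x; simp [lap, Fin.sum_univ_three]
  have m := fun k => memLp_pd (C := C) (hφ.pd k) k
  have h01 : MemLp (fun x => pd (pd φ 0) 0 x + pd (pd φ 1) 1 x) 2 (muO C) := (m 0).add (m 1)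
  rw [e, lq_add h01 (m 2), lq_add (m 0) (m 1), Fin.sum_univ_three]

lemma harm_lap {H : MM C} (hV : H ∈ VV C) (hH : ∀ Φ ∈ V0 C, inner ℝ H Φ = 0) (i j : Fin 3)
    {φ : E3 → ℝ} (hφ : TestOn (Om C) φ) : inner ℝ (H (i, j)) (lq C (lap φ)) = 0 := by
  rw [lq_lap hφ, inner_sum, ← perp_div hH (hφ.pd j) i]
  refine Finset.sum_congr rfl fun k _ => ?_
  rw [VV_curl hV (hφ.pd k), pd_comm hφ.sm]

lemma biharm_of {a : LL C} (h : ∀ φ, TestOn (Om C) φ → inner ℝ a (lq C (lap φ)) = 0) :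
    Biharm (Om C) (Ex C a) := by
  intro φ hφ
  rw [← inner_test hφ.lap.lap]
  exact h _ hφ.lap

/-- smooth representative -/
def rp (a : LL C) : E3 → ℝ := wrep (Om C) (Ex C a)

lemma rp_sm {a : LL C} (h : Biharm (Om C) (Ex C a)) : ContDiffOn ℝ ∞ (rp a) (Om C) :=
  wrep_sm (isOpen_Om C) (Ex_li (Lp.memLp a)) h

lemma rp_sm1 {a : LL C} (h : Biharm (Om C) (Ex C a)) : ContDiffOn ℝ 1 (rp a) (Om C) :=
  (rp_sm h).of_le (by simp)

lemma rp_ae {a : LL C} (h : Biharm (Om C) (Ex C a)) : a =ᵐ[muO C] rp a := by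
  rw [Filter.EventuallyEq, ae_restrict_iff' (meas_Om C)]
  filter_upwards [wrep_ae (isOpen_Om C) (Ex_li (Lp.memLp a)) h] with x hx hxO
  have := hx hxO
  rw [Ex, indicator_of_mem hxO] at this; exact this

lemma rp_test {a : LL C} (h : Biharm (Om C) (Ex C a)) {φ : E3 → ℝ} (hφ : TestOn (Om C) φ) :
    ∫ x, rp a x * φ x = inner ℝ a (lq C φ) := by
  rw [← test_int _ hφ, inner_lq (memLp_test hφ)]
  apply integral_congr_ae
  filter_upwards [rp_ae h] with x hx
  rw [hx]

lemma rp_curl {a b : LL C} (ha : Biharm (Om C) (Ex C a)) (hb : Biharm (Om C) (Ex C b)) (j k : Fin 3)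
    (h : ∀ φ, TestOn (Om C) φ → inner ℝ a (lq C (pd φ k)) = inner ℝ b (lq C (pd φ j))) :
    ∀ x ∈ Om C, pd (rp a) k x = pd (rp b) j x := by
  have hO := isOpen_Om C
  have ca := pd_contOn hO (rp_sm1 ha) k
  have cb := pd_contOn hO (rp_sm1 hb) j
  have := zero_of_test hO (g := fun x => pd (rp a) k x - pd (rp b) j x) (ca.sub cb) (by
    intro φ hφ
    have h1 := ibp hO (rp_sm1 ha) hφ k
    have h2 := ibp hO (rp_sm1 hb) hφ j
    rw [rp_test ha (hφ.pd k)] at h1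
    rw [rp_test hb (hφ.pd j)] at h2
    have h3 := h φ hφ
    simp only [sub_mul]
    rw [integral_sub (mul_test_int hO ca hφ) (mul_test_int hO cb hφ)]
    linarith)
  intro x hx
  exact sub_eq_zero.1 (this x hx)

lemma biharm_add {a b : LL C} (ha : Biharm (Om C) (Ex C a)) (hb : Biharm (Om C) (Ex C b)) :
    Biharm (Om C) (Ex C (a + b : LL C)) := by
  intro φ hφ
  have h1 := ha φ hφ
  have h2 := hb φ hφ
  rw [← inner_test hφ.lap.lap] at *
  rw [inner_add_left, h1, h2, add_zero]

lemma rp_add {a b : LL C} (ha : Biharm (Om C) (Ex C a)) (hb : Biharm (Om C) (Ex C b)) (k : Fin 3) :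
    ∀ x ∈ Om C, pd (rp (a + b)) k x = pd (rp a) k x + pd (rp b) k x := by
  have hO := isOpen_Om C
  have hab := biharm_add ha hb
  have h : ∀ x ∈ Om C, rp (a + b) x - (rp a x + rp b x) = 0 := by
    apply zero_of_ae hO
    · exact (rp_sm hab).continuousOn.sub ((rp_sm ha).continuousOn.add (rp_sm hb).continuousOn)
    · rw [← ae_restrict_iff' (meas_Om C)]
      filter_upwards [rp_ae ha, rp_ae hb, rp_ae hab, Lp.coeFn_add a b] with x h1 h2 h3 h4
      rw [← h1, ← h2, ← h3, h4]; simp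
  intro x hx
  have da := ((rp_sm1 ha).contDiffAt (hO.mem_nhds hx)).differentiableAt (by simp)
  have db := ((rp_sm1 hb).contDiffAt (hO.mem_nhds hx)).differentiableAt (by simp)
  rw [pd_congr (g := fun y => rp a y + rp b y) _ k]
  · simp only [pd]; rw [fderiv_fun_add da db]; simp
  · filter_upwards [hO.mem_nhds hx] with y hy
    linarith [h y hy]

lemma rp_lint {a : LL C} (h : Biharm (Om C) (Ex C a)) :
    ∫⁻ x in Om C, ‖rp a x‖ₑ ^ 2 = ENNReal.ofReal (‖a‖ ^ 2) := by
  rw [normsq_LL]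
  apply lintegral_congr_ae
  filter_upwards [rp_ae h] with x hx
  rw [hx]

lemma Ex_lint (a : LL C) : ∫⁻ x in Om C, ‖Ex C a x‖ₑ ^ 2 = ENNReal.ofReal (‖a‖ ^ 2) := by
  rw [normsq_LL]
  apply setLIntegral_congr_fun (meas_Om C)
  intro x hx
  simp [Ex, hx]

lemma three_sq {a b c d : ℝ} (h : 2 * a = b + c - d) : ‖a‖ₑ ^ 2 ≤ ‖b‖ₑ ^ 2 + ‖c‖ₑ ^ 2 + ‖d‖ₑ ^ 2 := by
  simp only [enorm_sq_eq]
  rw [← ENNReal.ofReal_add (by positivity) (by positivity), ← ENNReal.ofReal_add (by positivity) (by positivity)]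
  apply ENNReal.ofReal_le_ofReal
  have : a = (b + c - d)/2 := by linarith
  rw [this]
  nlinarith [sq_nonneg (b - c), sq_nonneg (b + d), sq_nonneg (c + d)]

lemma entry_le (G : MM C) (i j : Fin 3) : ‖G (i, j)‖ ^ 2 ≤ ‖G‖ ^ 2 :=
  pow_le_pow_left₀ (norm_nonneg _) (PiLp.norm_apply_le G (i, j)) 2

theorem korn_harm {D r t0 c : ℝ} (hD : 1 < D) (hr : 0 < r) (ht0 : 0 < t0) (hc : 0 < c) :
    ∃ K : ℝ, 0 ≤ K ∧ ∀ C, Adm D C → ConeC C r t0 c → ∀ H ∈ VV C, (∀ Φ ∈ V0 C, inner ℝ H Φ = 0) →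
      ‖H‖ ^ 2 ≤ K * ‖H + Tt C H‖ ^ 2 := by
  obtain ⟨K, hK, hL⟩ := L2_le_DI hD hr ht0 hc
  obtain ⟨M, hM, hJ⟩ := JJ
  refine ⟨9 * (K.toReal * (3 * (3 * M))), by positivity, ?_⟩
  intro C hC hcone H hV hp
  have hO := isOpen_Om C
  set S := H + Tt C H with hS
  have hb : ∀ i j, Biharm (Om C) (Ex C (H (i, j))) := fun i j =>
    biharm_of fun φ hφ => harm_lap hV hp i j hφ
  have hSe : ∀ i j, S (i, j) = H (i, j) + H (j, i) := fun i j => rfl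
  have hbS : ∀ i j, Biharm (Om C) (Ex C (S (i, j))) := fun i j => biharm_add (hb i j) (hb j i)
  have hcurl : ∀ i j k, ∀ x ∈ Om C, pd (rp (H (i, j))) k x = pd (rp (H (i, k))) j x := fun i j k =>
    rp_curl (hb i j) (hb i k) j k fun φ hφ => VV_curl hV hφ i j k
  have hSp : ∀ i j k, ∀ x ∈ Om C, pd (rp (S (i, j))) k x = pd (rp (H (i, j))) k x + pd (rp (H (j, i))) k x :=
    fun i j k => rp_add (hb i j) (hb j i) k
  set Q := ENNReal.ofReal (M * ‖S‖ ^ 2) with hQ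
  have hJS : ∀ i j k, ∫⁻ x in Om C, ENNReal.ofReal (dd C x) ^ 2 * ‖pd (rp (S (i, j))) k x‖ₑ ^ 2 ≤ Q := by
    intro i j k
    refine (hJ (Om C) _ hO (Om_compl_ne C) (Ex_li (Lp.memLp _)) (hbS i j) k).trans ?_
    rw [Ex_lint, hQ, ← ENNReal.ofReal_mul hM]
    apply ENNReal.ofReal_le_ofReal
    gcongr
    exact PiLp.norm_apply_le S (i, j)
  have hJH : ∀ i j k, ∫⁻ x in Om C, ENNReal.ofReal (dd C x) ^ 2 * ‖pd (rp (H (i, j))) k x‖ₑ ^ 2 ≤ 3 * Q := by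
    intro i j k
    have m : ∀ i j k, Measurable fun x => ENNReal.ofReal (dd C x) ^ 2 * ‖pd (rp (S (i, j))) k x‖ₑ ^ 2 :=
      fun i j k => ((dd_cont C).measurable.ennreal_ofReal.pow_const 2).mul ((meas_pd _ k).enorm.pow_const 2)
    have m2 : Measurable fun x => ENNReal.ofReal (dd C x) ^ 2 * ‖pd (rp (S (i, j))) k x‖ₑ ^ 2 +
          ENNReal.ofReal (dd C x) ^ 2 * ‖pd (rp (S (i, k))) j x‖ₑ ^ 2 := (m i j k).add (m i k j)
    calc _ ≤ ∫⁻ x in Om C, (ENNReal.ofReal (dd C x) ^ 2 * ‖pd (rp (S (i, j))) k x‖ₑ ^ 2 +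
          ENNReal.ofReal (dd C x) ^ 2 * ‖pd (rp (S (i, k))) j x‖ₑ ^ 2) +
          ENNReal.ofReal (dd C x) ^ 2 * ‖pd (rp (S (j, k))) i x‖ₑ ^ 2 := by
            apply setLIntegral_mono_ae' (meas_Om C) (Eventually.of_forall _)
            intro x hx
            rw [← mul_add, ← mul_add]
            gcongr
            apply three_sq
            rw [hSp i j k x hx, hSp i k j x hx, hSp j k i x hx, hcurl i j k x hx, hcurl j i k x hx, hcurl k i j x hx]
            ring
      _ ≤ 3 * Q := by
            rw [lintegral_add_left m2, lintegral_add_left (m i j k)]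
            calc _ ≤ Q + Q + Q := add_le_add (add_le_add (hJS _ _ _) (hJS _ _ _)) (hJS _ _ _)
              _ = 3 * Q := by ring
  have hDI : ∀ i j, DI C (rp (H (i, j))) ≤ 3 * (3 * Q) := by
    intro i j
    unfold DI gsq
    simp only [Finset.mul_sum]
    have m : ∀ k, Measurable fun x => ENNReal.ofReal (dd C x) ^ 2 * ‖pd (rp (H (i, j))) k x‖ₑ ^ 2 :=
      fun k => ((dd_cont C).measurable.ennreal_ofReal.pow_const 2).mul ((meas_pd _ k).enorm.pow_const 2)
    rw [lintegral_finsetSum _ fun k _ => m k]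
    calc _ ≤ ∑ k : Fin 3, 3 * Q := Finset.sum_le_sum fun k _ => hJH i j k
      _ = _ := by simp
  have hE : ∀ i j, ‖H (i, j)‖ ^ 2 ≤ K.toReal * (3 * (3 * M)) * ‖S‖ ^ 2 := by
    intro i j
    have h1 := hL C hC hcone (rp (H (i, j))) (rp_sm1 (hb i j)) (by rw [rp_lint (hb i j)]; finiteness)
    rw [rp_lint (hb i j)] at h1
    have h2 := h1.trans (mul_le_mul_right (hDI i j) K)
    rw [← ENNReal.ofReal_toReal hK, hQ] at h2
    rw [show (3:ℝ≥0∞) = ENNReal.ofReal 3 by simp, ← ENNReal.ofReal_mul (by norm_num), ← ENNReal.ofReal_mul (by norm_num),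
      ← ENNReal.ofReal_mul (by positivity), ENNReal.ofReal_le_ofReal_iff (by positivity)] at h2
    linarith
  rw [normsq_MM]
  simp only [Fin.sum_univ_three]
  linarith [hE 0 0, hE 0 1, hE 0 2, hE 1 0, hE 1 1, hE 1 2, hE 2 0, hE 2 1, hE 2 2]

theorem korn {D r t0 c : ℝ} (hD : 1 < D) (hr : 0 < r) (ht0 : 0 < t0) (hc : 0 < c) :
    ∃ K : ℝ, 0 < K ∧ ∀ C, Adm D C → ConeC C r t0 c → ∀ G ∈ VV C, ‖G‖ ≤ K * ‖G + Tt C G‖ := by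
  obtain ⟨K, hK, h⟩ := korn_harm hD hr ht0 hc
  refine ⟨3 + 7 * √K, by positivity, ?_⟩
  intro C hC hcone G hG
  set S := G + Tt C G with hS
  set G0 : MM C := (V0 C).starProjection G with hG0
  have m0 : G0 ∈ V0 C := Submodule.starProjection_apply_mem _ _
  have hperp : ∀ Φ ∈ V0 C, inner ℝ (G - G0) Φ = 0 := fun Φ hΦ =>
    Submodule.starProjection_inner_eq_zero G Φ hΦ
  have e1 : inner ℝ G G0 = ‖G0‖ ^ 2 := by
    have := hperp G0 m0
    rw [inner_sub_left, real_inner_self_eq_norm_sq] at this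
    linarith
  have e2 := VV_V0 hG m0
  have e3 : tr C S = (2:ℝ) • tr C G := by
    rw [hS, map_add, two_smul]
    congr 1
  have e4 : inner ℝ S G0 = ‖G0‖ ^ 2 + inner ℝ (tr C S) (tr C G0) / 2 := by
    rw [hS, inner_add_left, e1, e2, ← hS, e3, inner_smul_left]
    simp
  have b1 : inner ℝ S G0 ≤ ‖S‖ * ‖G0‖ := real_inner_le_norm _ _
  have b2 : |inner ℝ (tr C S) (tr C G0)| ≤ ‖tr C S‖ * ‖tr C G0‖ := abs_real_inner_le_norm _ _
  have b3 : ‖tr C S‖ * ‖tr C G0‖ ≤ 3 * (‖S‖ * ‖G0‖) := by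
    apply le_of_sq_le_sq _ (by positivity)
    have h1 := tr_le S
    have h2 := tr_le G0
    calc _ = ‖tr C S‖ ^ 2 * ‖tr C G0‖ ^ 2 := by ring
      _ ≤ (3 * ‖S‖ ^ 2) * (3 * ‖G0‖ ^ 2) := by gcongr
      _ = _ := by ring
  have g0 : ‖G0‖ ≤ 3 * ‖S‖ := by
    by_contra hcon
    push Not at hcon
    have h1 := (abs_le.1 b2).1
    have h2 := norm_nonneg S
    nlinarith [norm_nonneg G0]
  set H := G - G0 with hH
  have hHV : H ∈ VV C := sub_mem hG (V0_le m0)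
  have h1 := h C hC hcone H hHV hperp
  have h2 : ‖H + Tt C H‖ ≤ 7 * ‖S‖ := by
    have : H + Tt C H = S - G0 - Tt C G0 := by rw [hH, hS, map_sub]; abel
    rw [this]
    calc _ ≤ ‖S‖ + ‖G0‖ + ‖Tt C G0‖ := (norm_sub_le _ _).trans (add_le_add_left (norm_sub_le _ _) _)
      _ ≤ _ := by rw [LinearIsometryEquiv.norm_map]; linarith
  have h3 : ‖H‖ ≤ √K * (7 * ‖S‖) := by
    apply le_of_sq_le_sq _ (by positivity)
    rw [mul_pow, Real.sq_sqrt hK]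
    refine h1.trans ?_
    gcongr
  calc ‖G‖ = ‖G0 + H‖ := by rw [hH]; congr 1; abel
    _ ≤ ‖G0‖ + ‖H‖ := norm_add_le _ _
    _ ≤ _ := by nlinarith

end

section
open scoped ContDiff Topology ENNReal NNReal
open Filter

/-! ### Part 14 : Lax-Milgram -/
variable {C : Set E3}

def aa (lam mu : ℝ) (G H : MM C) : ℝ :=
  lam * inner ℝ (tr C G) (tr C H) + mu / 2 * inner ℝ (G + Tt C G) (H + Tt C H)

lemma aa_bd (lam mu : ℝ) (G H : MM C) : ‖aa lam mu G H‖ ≤ (|lam| * 3 + |mu / 2| * 4) * ‖G‖ * ‖H‖ := by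
  have b2 : |inner ℝ (tr C G) (tr C H)| ≤ ‖tr C G‖ * ‖tr C H‖ := abs_real_inner_le_norm _ _
  have b3 : ‖tr C G‖ * ‖tr C H‖ ≤ 3 * (‖G‖ * ‖H‖) := by
    apply le_of_sq_le_sq _ (by positivity)
    have h1 := tr_le G
    have h2 := tr_le H
    calc _ = ‖tr C G‖ ^ 2 * ‖tr C H‖ ^ 2 := by ring
      _ ≤ (3 * ‖G‖ ^ 2) * (3 * ‖H‖ ^ 2) := by gcongr
      _ = _ := by ring
  have b4 : |inner ℝ (G + Tt C G) (H + Tt C H)| ≤ 4 * (‖G‖ * ‖H‖) := by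
    refine (abs_real_inner_le_norm _ _).trans ?_
    have h1 := norm_add_le G (Tt C G)
    have h2 := norm_add_le H (Tt C H)
    rw [LinearIsometryEquiv.norm_map] at h1 h2
    calc _ ≤ (‖G‖ + ‖G‖) * (‖H‖ + ‖H‖) := by gcongr
      _ = _ := by ring
  rw [aa, Real.norm_eq_abs]
  refine (abs_add_le _ _).trans ?_
  rw [abs_mul, abs_mul]
  calc _ ≤ |lam| * (3 * (‖G‖ * ‖H‖)) + |mu / 2| * (4 * (‖G‖ * ‖H‖)) := by
        gcongr; exact b2.trans b3
    _ = _ := by ring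

lemma aa_add_left (lam mu : ℝ) (G G' H : MM C) : aa lam mu (G + G') H = aa lam mu G H + aa lam mu G' H := by
  unfold aa
  rw [map_add, map_add, show G + G' + (Tt C G + Tt C G') = (G + Tt C G) + (G' + Tt C G') by abel,
    inner_add_left, inner_add_left]; ring

lemma aa_comm (lam mu : ℝ) (G H : MM C) : aa lam mu G H = aa lam mu H G := by
  unfold aa; rw [real_inner_comm, real_inner_comm (H + Tt C H)]

lemma aa_add_right (lam mu : ℝ) (G H H' : MM C) : aa lam mu G (H + H') = aa lam mu G H + aa lam mu G H' := by
  rw [aa_comm, aa_add_left, aa_comm, aa_comm lam mu H']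

lemma aa_smul_left (lam mu : ℝ) (c : ℝ) (G H : MM C) : aa lam mu (c • G) H = c * aa lam mu G H := by
  unfold aa
  rw [map_smul, map_smul, ← smul_add, real_inner_smul_left, real_inner_smul_left]; ring

lemma aa_smul_right (lam mu : ℝ) (c : ℝ) (G H : MM C) : aa lam mu G (c • H) = c * aa lam mu G H := by
  rw [aa_comm, aa_smul_left, aa_comm]

def aaL (lam mu : ℝ) (C : Set E3) : VV C →L[ℝ] VV C →L[ℝ] ℝ :=
  LinearMap.mkContinuous₂ (LinearMap.mk₂ ℝ (fun G H : VV C => aa lam mu (G : MM C) (H : MM C))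
    (fun G G' H => aa_add_left lam mu _ _ _) (fun c G H => aa_smul_left lam mu c _ _)
    (fun G H H' => aa_add_right lam mu _ _ _) (fun c G H => aa_smul_right lam mu c _ _))
    (|lam| * 3 + |mu / 2| * 4) (fun G H => by
      rw [LinearMap.mk₂_apply]
      exact aa_bd lam mu (G : MM C) (H : MM C))

lemma aaL_apply (lam mu : ℝ) (G H : VV C) : aaL lam mu C G H = aa lam mu (G : MM C) H := rfl

theorem coer {lam mu D r t0 c : ℝ} (hmu : 0 < mu) (hlam : 0 < 3*lam + 2*mu)
    (hD : 1 < D) (hr : 0 < r) (ht0 : 0 < t0) (hc : 0 < c) :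
    ∃ κ : ℝ, 0 < κ ∧ ∀ C, Adm D C → ConeC C r t0 c → ∀ G ∈ VV C, κ * ‖G‖ ^ 2 ≤ aa lam mu G G := by
  obtain ⟨K, hK, h⟩ := korn hD hr ht0 hc
  obtain ⟨m, hm, hm1, hm2⟩ : ∃ m : ℝ, 0 < m ∧ m ≤ mu / 2 ∧ m ≤ (3 * lam + 2 * mu) / 4 :=
    ⟨min (mu/2) ((3 * lam + 2 * mu) / 4), by positivity, min_le_left _ _, min_le_right _ _⟩
  refine ⟨m / K ^ 2, by positivity, ?_⟩
  intro C hC hcone G hG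
  have h1 := h C hC hcone G hG
  have h2 : ‖G‖ ^ 2 ≤ K ^ 2 * ‖G + Tt C G‖ ^ 2 := by rw [← mul_pow]; gcongr
  have e3 : tr C (G + Tt C G) = (2:ℝ) • tr C G := by
    rw [map_add, two_smul]
    congr 1
  have h3 := tr_le (G + Tt C G)
  rw [e3, norm_smul, mul_pow, show ‖(2:ℝ)‖ ^ 2 = 4 by norm_num] at h3
  unfold aa
  rw [real_inner_self_eq_norm_sq, real_inner_self_eq_norm_sq]
  have h4 : m / K ^ 2 * ‖G‖ ^ 2 ≤ m * ‖G + Tt C G‖ ^ 2 := by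
    rw [div_mul_eq_mul_div, div_le_iff₀ (by positivity)]
    nlinarith
  refine h4.trans ?_
  rcases le_total 0 lam with hl | hl
  · nlinarith [sq_nonneg ‖tr C G‖, sq_nonneg ‖G + Tt C G‖]
  · nlinarith [sq_nonneg ‖tr C G‖, sq_nonneg ‖G + Tt C G‖]

theorem lax {lam mu κ : ℝ} (hκ : 0 < κ) (h : ∀ G ∈ VV C, κ * ‖G‖ ^ 2 ≤ aa lam mu G G) (S : MM C) :
    ∃ G ∈ VV C, (∀ H ∈ VV C, aa lam mu G H = inner ℝ S H) ∧ ‖G‖ ≤ κ⁻¹ * ‖S‖ := by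
  have hco : IsCoercive (aaL lam mu C) := ⟨κ, hκ, fun u => by
    have := h u u.2
    rw [aaL_apply]
    calc _ = κ * ‖(u : MM C)‖ ^ 2 := by rw [Submodule.coe_norm]; ring
      _ ≤ _ := this⟩
  set S0 : VV C := (VV C).orthogonalProjectionOnto S
  set G : VV C := hco.continuousLinearEquivOfBilin.symm S0 with hG
  have hsol : ∀ H ∈ VV C, aa lam mu (G : MM C) H = inner ℝ S H := by
    intro H hH
    have h1 := hco.continuousLinearEquivOfBilin_apply G ⟨H, hH⟩
    rw [hG, ContinuousLinearEquiv.apply_symm_apply, aaL_apply] at h1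
    rw [← h1, Submodule.coe_inner]
    have := Submodule.starProjection_inner_eq_zero (K := VV C) S H hH
    rw [inner_sub_left] at this
    exact (sub_eq_zero.1 this).symm
  refine ⟨G, G.2, hsol, ?_⟩
  have h1 := h G G.2
  rw [hsol G G.2] at h1
  have h2 := real_inner_le_norm S (G : MM C)
  rw [inv_mul_eq_div, le_div_iff₀ hκ]
  by_contra hcon
  push Not at hcon
  have h0 : 0 < ‖(G : MM C)‖ := by
    by_contra h0
    have h0 : ‖(G : MM C)‖ = 0 := le_antisymm (not_lt.1 h0) (norm_nonneg _)
    rw [h0] at hcon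
    linarith [norm_nonneg S]
  nlinarith

end

section
open scoped ContDiff Topology ENNReal NNReal
open Filter

/-! ### Part 15 : the pressure functional -/
variable {C : Set E3}

lemma swU {v φ : E3 → ℝ} (hv : TestOn univ v) (hφ : TestOn univ φ) (i j : Fin 3) :
    ∫ x, pd v i x * pd φ j x = ∫ x, pd v j x * pd φ i x := by
  rw [ibp isOpen_univ ((hv.pd i).sm.of_le (by simp)).contDiffOn hφ j,
    ibp isOpen_univ ((hv.pd j).sm.of_le (by simp)).contDiffOn hφ i, pd_comm hv.sm i j]

lemma TestOn.muls {O : Set E3} {f g : E3 → ℝ} (hf : TestOn O f) (hg : Sm g) :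
    TestOn O (fun x => f x * g x) :=
  ⟨hf.sm.mul hg, hf.cs.mul_right, (tsupport_mul_subset_left).trans hf.ts⟩

lemma TestOn.int {O : Set E3} {f g : E3 → ℝ} (hf : TestOn O f) (hg : Sm g) : Integrable (fun x => f x * g x) :=
  (hf.muls hg).sm.continuous.integrable_of_hasCompactSupport (hf.muls hg).cs

theorem Sfield {D : ℝ} (hD : 1 < D) : ∃ S : Fin 3 → Fin 3 → E3 → ℝ, (∀ i j, TestOn univ (S i j)) ∧
    ∀ C, Adm D C → volume (frontier C) = 0 → ∀ v : Fin 3 → E3 → ℝ, (∀ i, TestOn univ (v i)) →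
      ∫ x in Om C, (∑ i, ∑ j, S i j x * pd (v i) j x) = - ∫ x in C, ∑ i, pd (v i) i x := by
  set c : E3 := EuclideanSpace.single 2 (-4*D) with hc
  let b : ContDiffBump c := ⟨7/2*D, 15/4*D, by positivity, by linarith⟩
  have hb : TestOn lowerHalf b := by
    refine ⟨b.contDiff, b.hasCompactSupport, ?_⟩
    rw [b.tsupport_eq]
    intro x hx
    have h1 : dist x c ≤ 15/4*D := hx
    have h2 : ‖(x - c : E3) 2‖ ≤ ‖x - c‖ := PiLp.norm_apply_le _ _
    rw [← dist_eq_norm] at h2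
    have h3 := (abs_le.1 (h2.trans h1)).2
    have h4 : (x - c : E3) 2 = x 2 + 4 * D := by simp [hc]
    rw [h4] at h3
    show x 2 < 0
    linarith
  set B : Fin 3 → E3 → ℝ := fun i x => b x * x i with hB
  have tB : ∀ i, TestOn lowerHalf (B i) := fun i => hb.muls (sm_coord i)
  have hin : ∀ C, Adm D C → ∀ x ∈ C, ∀ i j, pd (B j) i x = if i = j then 1 else 0 := by
    intro C hC x hx i j
    have h1 := hC.bd x (subset_closure hx)
    have h2 := hC.dp x (subset_closure hx)
    have h3 : x ∈ ball c (7/2*D) := by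
      rw [mem_ball, dist_eq_norm]
      apply lt_of_pow_lt_pow_left₀ 2 (by positivity)
      have e1 := norm_sq_E3 x
      have e2 := norm_sq_E3 (x - c)
      have c0 : (x - c : E3) 0 = x 0 := by simp [hc]
      have c1 : (x - c : E3) 1 = x 1 := by simp [hc]
      have c2 : (x - c : E3) 2 = x 2 + 4 * D := by simp [hc]
      rw [c0, c1, c2] at e2
      have : ‖x‖^2 ≤ (2*D)^2 := by gcongr
      rw [e2]
      nlinarith
    rw [pd_congr (g := fun x => x j) _ i]
    · rw [pd_coord]; simp only [eq_comm]
    · filter_upwards [isOpen_ball.mem_nhds h3] with y hy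
      have : b y = 1 := b.one_of_mem_closedBall (ball_subset_closedBall hy)
      simp [hB, this]
  refine ⟨fun i j x => (1/2) * ((if i = j then 1 else 0) * (pd (B 0) 0 x + pd (B 1) 1 x + pd (B 2) 2 x) + (-1) * pd (B j) i x),
    fun i j => ((((((tB 0).pd 0).add ((tB 1).pd 1)).add ((tB 2).pd 2)).cmul _).add (((tB j).pd i).cmul _)).cmul _ |>.univ, ?_⟩
  intro C hC hfr v hv
  set J : E3 → ℝ := fun x => ∑ i, ∑ k, (pd (B k) k x * pd (v i) i x - pd (B k) i x * pd (v i) k x) with hJ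
  have e1 : ∀ x, (∑ i, ∑ j, (1/2) * ((if i = j then 1 else 0) * (pd (B 0) 0 x + pd (B 1) 1 x + pd (B 2) 2 x) + (-1) * pd (B j) i x) * pd (v i) j x) = 1/2 * J x := by
    intro x
    simp only [hJ, Fin.sum_univ_three]
    simp
    ring
  have hint : ∀ i k l m, Integrable (fun x => pd (B k) l x * pd (v i) m x) := fun i k l m =>
    ((tB k).pd l).int ((hv i).pd m).sm
  have hs : ∀ i k, Integrable (fun x => pd (B k) k x * pd (v i) i x - pd (B k) i x * pd (v i) k x) :=
    fun i k => (hint _ _ _ _).sub (hint _ _ _ _)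
  have hs2 : ∀ i, Integrable (fun x => ∑ k, (pd (B k) k x * pd (v i) i x - pd (B k) i x * pd (v i) k x)) :=
    fun i => integrable_finsetSum _ fun k _ => hs i k
  have hJi : Integrable J := integrable_finsetSum _ fun i _ => hs2 i
  have hJ0 : ∫ x, J x = 0 := by
    simp only [hJ]
    rw [integral_finsetSum _ fun i _ => hs2 i]
    refine Finset.sum_eq_zero fun i _ => ?_
    rw [integral_finsetSum _ fun k _ => hs i k]
    refine Finset.sum_eq_zero fun k _ => ?_
    rw [integral_sub (hint _ _ _ _) (hint _ _ _ _), swU (tB k).univ (hv i), sub_self]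
  simp only [e1]
  have hJC : ∀ x ∈ C, J x = 2 * ∑ i, pd (v i) i x := by
    intro x hx
    simp only [hJ, hin C hC x hx, Fin.sum_univ_three]
    simp; ring
  have hz : ∀ x, x ∉ Om C ∪ C ∪ frontier C → J x = 0 := by
    intro x hx
    have hlow : x ∉ lowerHalf := by
      intro hl
      apply hx
      by_cases h : x ∈ closure C
      · by_cases h' : x ∈ C
        · exact Or.inl (Or.inr h')
        · right; rw [hC.op.frontier_eq]; exact ⟨h, h'⟩
      · exact Or.inl (Or.inl ⟨hl, h⟩)
    simp only [hJ]
    refine Finset.sum_eq_zero fun i _ => Finset.sum_eq_zero fun k _ => ?_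
    rw [pd_zero_of_notMem (fun h => hlow ((tB k).ts h)), pd_zero_of_notMem (fun h => hlow ((tB k).ts h))]
    ring
  have h3 : ∫ x, J x = (∫ x in Om C, J x) + ∫ x in C, J x := by
    rw [← setIntegral_union, ← setIntegral_eq_integral_of_forall_compl_eq_zero hz]
    · rw [← Measure.restrict_congr_set (s := Om C ∪ C)]
      refine (union_ae_eq_left_of_ae_eq_empty ?_).symm
      exact ae_eq_empty.2 hfr
    · exact disjoint_left.2 fun x hx hx' => hx.2 (subset_closure hx')
    · exact hC.op.measurableSet
    · exact hJi.integrableOn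
    · exact hJi.integrableOn
  rw [setIntegral_congr_fun hC.op.measurableSet hJC, integral_const_mul, hJ0] at h3
  rw [integral_const_mul]
  linarith

def Sm' (C : Set E3) (S : Fin 3 → Fin 3 → E3 → ℝ) : MM C := WithLp.toLp 2 (fun p => lq C (S p.1 p.2))

lemma inner_Sm' {S : Fin 3 → Fin 3 → E3 → ℝ} (hS : ∀ i j, TestOn univ (S i j)) {v : Fin 3 → E3 → ℝ}
    (hv : ∀ i, TestOn univ (v i)) :
    inner ℝ (Sm' C S) (grad C v) = ∫ x in Om C, (∑ i, ∑ j, S i j x * pd (v i) j x) := by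
  have hi : ∀ i j, Integrable (fun x => S i j x * pd (v i) j x) (muO C) := fun i j =>
    ((hS i j).int ((hv i).pd j).sm).integrableOn
  rw [inner_MM, integral_finsetSum _ fun i _ => integrable_finsetSum _ fun j _ => hi i j]
  refine Finset.sum_congr rfl fun i _ => ?_
  rw [integral_finsetSum _ fun j _ => hi i j]
  refine Finset.sum_congr rfl fun j _ => ?_
  exact inner_lq2 (memLp_test (hS i j)) (memLp_pd (hv i) j)

lemma norm_Sm' {S : Fin 3 → Fin 3 → E3 → ℝ} (hS : ∀ i j, TestOn univ (S i j)) :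
    ∃ K : ℝ, 0 < K ∧ ∀ C, ‖Sm' C S‖ ≤ K := by
  have h : ∀ i j, ∃ k : ℝ, 0 ≤ k ∧ ∀ C, ‖Sm' C S (i, j)‖ ^ 2 ≤ k := by
    intro i j
    have hm : MemLp (S i j) 2 volume := (hS i j).sm.continuous.memLp_of_hasCompactSupport (hS i j).cs
    have ht := hm.2
    rw [eLpNorm_lt_top_iff_lintegral_rpow_enorm_lt_top (by norm_num) (by norm_num)] at ht
    have ht : ∫⁻ x, ‖S i j x‖ₑ ^ 2 < ⊤ := by simpa using ht
    refine ⟨(∫⁻ x, ‖S i j x‖ₑ ^ 2).toReal, ENNReal.toReal_nonneg, fun C => ?_⟩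
    have h1 := normsq_lq (C := C) (memLp_test (hS i j))
    have h2 : ENNReal.ofReal (‖lq C (S i j)‖ ^ 2) ≤ ∫⁻ x, ‖S i j x‖ₑ ^ 2 := by
      rw [h1]; exact setLIntegral_le_lintegral _ _
    have h3 := ENNReal.toReal_mono ht.ne h2
    rwa [ENNReal.toReal_ofReal (by positivity)] at h3
  choose k hk0 hk using h
  have h0 : 0 ≤ ∑ i, ∑ j, k i j := Finset.sum_nonneg fun i _ => Finset.sum_nonneg fun j _ => hk0 i j
  refine ⟨√(∑ i, ∑ j, k i j) + 1, by positivity, fun C => ?_⟩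
  have h1 : ‖Sm' C S‖ ≤ √(∑ i, ∑ j, k i j) := by
    apply Real.le_sqrt_of_sq_le
    rw [normsq_MM]
    exact Finset.sum_le_sum fun i _ => Finset.sum_le_sum fun j _ => hk i j C
  linarith

end

section
open scoped ContDiff Topology ENNReal NNReal
open Filter

/-! ### Part 16 : recovering the displacement -/
variable {C : Set E3}

def rho (x : E3) : ℝ := √(1 + ‖x‖ ^ 2)

lemma rho_pos (x : E3) : 0 < rho x := Real.sqrt_pos.2 (by positivity)
lemma rho_sq (x : E3) : rho x ^ 2 = 1 + ‖x‖ ^ 2 := Real.sq_sqrt (by positivity)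

lemma rho_sm : Sm rho := by
  unfold rho
  apply ContDiff.sqrt
  · exact contDiff_const.add (contDiff_norm_sq ℝ)
  · intro x; positivity

lemma rhoi_sm : Sm (fun x => (rho x)⁻¹) := rho_sm.inv fun x => (rho_pos x).ne'

theorem hardy_grad {D r t0 c : ℝ} (hD : 1 < D) (hr : 0 < r) (ht0 : 0 < t0) (hc : 0 < c) :
    ∃ K : ℝ, 0 < K ∧ ∀ C, Adm D C → ConeC C r t0 c → ∀ v : Fin 3 → E3 → ℝ, (∀ i, TestOn univ (v i)) →
      ∀ i, ‖lq C (fun x => v i x * (rho x)⁻¹)‖ ≤ K * ‖grad C v‖ := by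
  obtain ⟨K, hK, h⟩ := Hardy hD hr ht0 hc
  refine ⟨√K.toReal + 1, by positivity, ?_⟩
  intro C hC hcone v hv i
  have h1 := h C hC hcone (v i) ((hv i).sm.of_le (by simp)) (hv i).cs
  have e1 := normsq_lq (C := C) (memLp_test ((hv i).muls rhoi_sm))
  have e2 : ∫⁻ x in Om C, ‖v i x * (rho x)⁻¹‖ₑ ^ 2 = ∫⁻ x in Om C, ENNReal.ofReal (1/(1+‖x‖^2)) * ‖v i x‖ₑ ^ 2 := by
    congr 1; funext x
    rw [enorm_sq_eq, enorm_sq_eq, ← ENNReal.ofReal_mul (by positivity), mul_pow, inv_pow, rho_sq]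
    congr 1; ring
  have e3 : ∫⁻ x in Om C, gsq (v i) x ≤ ENNReal.ofReal (‖grad C v‖ ^ 2) := by
    unfold gsq
    rw [lintegral_finsetSum _ fun k _ => (meas_pd _ k).enorm.pow_const 2]
    calc _ = ∑ k, ENNReal.ofReal (‖grad C v (i, k)‖ ^ 2) := by
          refine Finset.sum_congr rfl fun k _ => ?_
          rw [grad_apply, normsq_lq (memLp_pd (hv i) k)]
      _ = ENNReal.ofReal (∑ k, ‖grad C v (i, k)‖ ^ 2) := (ENNReal.ofReal_sum_of_nonneg fun k _ => by positivity).symm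
      _ ≤ _ := by
          apply ENNReal.ofReal_le_ofReal
          rw [normsq_MM]
          exact Finset.single_le_sum (f := fun i => ∑ k, ‖grad C v (i, k)‖ ^ 2)
            (fun i _ => Finset.sum_nonneg fun k _ => by positivity) (Finset.mem_univ i)
  have h2 := h1.trans (mul_le_mul_right e3 K)
  rw [← e2, ← e1, ← ENNReal.ofReal_toReal hK, ← ENNReal.ofReal_mul (by positivity),
    ENNReal.ofReal_le_ofReal_iff (by positivity)] at h2
  have h3 : ‖lq C (fun x => v i x * (rho x)⁻¹)‖ ≤ √K.toReal * ‖grad C v‖ := by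
    apply le_of_sq_le_sq _ (by positivity)
    rw [mul_pow, Real.sq_sqrt (by positivity)]; exact h2
  nlinarith [norm_nonneg (grad C v)]

theorem recover {K : ℝ} (hK : 0 < K)
    (h : ∀ v : Fin 3 → E3 → ℝ, (∀ i, TestOn univ (v i)) →
      ∀ i, ‖lq C (fun x => v i x * (rho x)⁻¹)‖ ≤ K * ‖grad C v‖) {G : MM C} (hG : G ∈ VV C) :
    ∃ w : Fin 3 → LL C, (∀ i, ‖w i‖ ≤ K * ‖G‖) ∧ ∀ i j φ, TestOn (Om C) φ →
      inner ℝ (w i) (lq C (fun x => pd φ j x * rho x)) = - inner ℝ (G (i, j)) (lq C φ) := by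
  obtain ⟨g, hg, hlim⟩ := mem_closure_iff_seq_limit.1 (show G ∈ closure (VO C univ : Set (MM C)) from hG)
  choose v hv hgv using hg
  obtain rfl : g = fun n => grad C (v n) := funext hgv
  have hcau : CauchySeq fun n => grad C (v n) := hlim.cauchySeq
  have hw : ∀ i, ∃ w : LL C, Tendsto (fun n => lq C (fun x => v n i x * (rho x)⁻¹)) atTop (𝓝 w) := by
    intro i
    apply cauchySeq_tendsto_of_complete
    rw [Metric.cauchySeq_iff] at hcau ⊢
    intro ε hε
    obtain ⟨N, hN⟩ := hcau (ε / K) (by positivity)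
    refine ⟨N, fun m hm n hn => ?_⟩
    have h1 := hN m hm n hn
    have h2 := h (fun i x => v m i x + (-1) * v n i x) (fun i => (hv m i).add ((hv n i).cmul _)) i
    have e1 : lq C (fun x => (v m i x + (-1) * v n i x) * (rho x)⁻¹) =
        lq C (fun x => v m i x * (rho x)⁻¹) - lq C (fun x => v n i x * (rho x)⁻¹) := by
      have e : (fun x => (v m i x + (-1) * v n i x) * (rho x)⁻¹) =
        fun x => v m i x * (rho x)⁻¹ + (-1) * (v n i x * (rho x)⁻¹) := by funext x; ring
      have m1 := memLp_test (C := C) ((hv n i).muls rhoi_sm)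
      rw [e, lq_add (memLp_test ((hv m i).muls rhoi_sm)) (m1.const_mul _), lq_smul m1]
      simp [sub_eq_add_neg]
    have e2 : grad C (fun i x => v m i x + (-1) * v n i x) = grad C (v m) - grad C (v n) := by
      ext1 p
      simp only [PiLp.sub_apply, grad_apply]
      rw [pd_add (hv m _).sm ((hv n _).cmul _).sm, pd_const_mul (hv n _).sm,
        lq_add (memLp_pd (hv m _) _) ((memLp_pd (hv n _) _).const_mul _), lq_smul (memLp_pd (hv n _) _)]
      simp [sub_eq_add_neg]
    rw [e1, e2, ← dist_eq_norm, ← dist_eq_norm] at h2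
    calc _ ≤ _ := h2
      _ < K * (ε / K) := by gcongr
      _ = ε := by field_simp
  choose w hw using hw
  refine ⟨w, fun i => ?_, fun i j φ hφ => ?_⟩
  · exact le_of_tendsto_of_tendsto' (hw i).norm (hlim.norm.const_mul K) fun n => h (v n) (hv n) i
  · have l1 := (hw i).inner (𝕜 := ℝ) (tendsto_const_nhds (x := lq C (fun x => pd φ j x * rho x)))
    have hcp : Tendsto (fun n => (grad C (v n)) (i, j)) atTop (𝓝 (G (i, j))) :=
      ((PiLp.continuous_apply 2 (fun _ : Ix => LL C) (i, j)).tendsto G).comp hlim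
    have l2 := (hcp.inner (𝕜 := ℝ) (tendsto_const_nhds (x := lq C φ))).neg
    refine tendsto_nhds_unique l1 (l2.congr fun n => ?_)
    rw [grad_apply, inner_lq2 (memLp_pd (hv n i) j) (memLp_test hφ),
      inner_lq2 (memLp_test ((hv n i).muls rhoi_sm)) (memLp_test ((hφ.pd j).muls rho_sm)),
      test_int _ hφ, ← ibp isOpen_univ ((hv n i).sm.of_le (by simp)).contDiffOn hφ.univ j, ← test_int _ (hφ.pd j)]
    congr 1; funext x
    have := (rho_pos x).ne'
    field_simp

/-- the displacement as a locally integrable function -/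
def fu (w : LL C) : E3 → ℝ := Ex C (fun x => w x * rho x)

lemma fu_li (w : LL C) : LocallyIntegrable (fu w) volume := by
  have h := Ex_li (Lp.memLp w)
  have e : fu w = fun x => Ex C w x * rho x := by
    funext x; by_cases hx : x ∈ Om C <;> simp [fu, Ex, hx]
  rw [e, ← locallyIntegrableOn_univ]
  exact (locallyIntegrableOn_univ.2 h).mul_continuousOn rho_sm.continuous.continuousOn isClosed_univ.isLocallyClosed

lemma fu_test (w : LL C) {φ : E3 → ℝ} (hφ : TestOn (Om C) φ) :
    ∫ x, fu w x * φ x = inner ℝ w (lq C (fun x => φ x * rho x)) := by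
  rw [fu, Ex_int, inner_lq (memLp_test (hφ.muls rho_sm))]
  congr 1; funext x; ring

lemma fu_lap (w : LL C) {φ : E3 → ℝ} (hφ : TestOn (Om C) φ) :
    ∫ x, fu w x * lap φ x = ∑ k, ∫ x, fu w x * pd (pd φ k) k x := by
  unfold lap
  simp only [Finset.mul_sum]
  exact integral_finsetSum _ fun k _ =>
    integrable_mul_cs (fu_li w) ((hφ.pd k).pd k).sm.continuous ((hφ.pd k).pd k).cs

theorem fu_biharm {lam mu : ℝ} (hmu : 0 < mu) (hlam : 0 < 3*lam + 2*mu) {G : MM C} (hG : G ∈ VV C)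
    (hsol : ∀ H ∈ V0 C, aa lam mu G H = 0) {w : Fin 3 → LL C}
    (hw : ∀ i j φ, TestOn (Om C) φ →
      inner ℝ (w i) (lq C (fun x => pd φ j x * rho x)) = - inner ℝ (G (i, j)) (lq C φ)) (m : Fin 3) :
    Biharm (Om C) (fu (w m)) := by
  have hw' : ∀ i j φ, TestOn (Om C) φ → inner ℝ (G (i, j)) (lq C φ) = - ∫ x, fu (w i) x * pd φ j x := by
    intro i j φ hφ
    rw [fu_test _ (hφ.pd j), hw i j φ hφ, neg_neg]
  have E : ∀ χ, TestOn (Om C) χ → ∀ m, (lam + mu) * (∑ i, ∫ x, fu (w i) x * pd (pd χ m) i x)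
      + mu * ∫ x, fu (w m) x * lap χ x = 0 := by
    intro χ hχ m
    have hm := V0_mem fun i => rowf_test hχ m i
    have h1 := hsol _ hm
    have h2 := VV_V0 hG hm
    have e1 : inner ℝ (G + Tt C G) (grad C (rowf m χ) + Tt C (grad C (rowf m χ))) =
        2 * (inner ℝ G (grad C (rowf m χ)) + inner ℝ (Tt C G) (grad C (rowf m χ))) := by
      have a1 : inner ℝ (Tt C G) (Tt C (grad C (rowf m χ))) = inner ℝ G (grad C (rowf m χ)) :=
        LinearIsometryEquiv.inner_map_map _ _ _
      have a2 : inner ℝ G (Tt C (grad C (rowf m χ))) = inner ℝ (Tt C G) (grad C (rowf m χ)) := by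
        rw [← LinearIsometryEquiv.inner_map_map (Tt C)]; rfl
      rw [inner_add_left, inner_add_right, inner_add_right, a1, a2]; ring
    have e2 : tr C (grad C (rowf m χ)) = lq C (pd χ m) := by
      rw [tr_apply, Finset.sum_eq_single m]
      · simp [rowf]
      · intro i _ hi; simp [rowf, hi, lq_zero_pd]
      · simp
    rw [aa, e1, h2, e2, inner_rowf, tr_apply, sum_inner] at h1
    rw [fu_lap _ hχ]
    have e3 : ∀ i, inner ℝ (G (i, i)) (lq C (pd χ m)) = - ∫ x, fu (w i) x * pd (pd χ m) i x := fun i =>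
      hw' i i _ (hχ.pd m)
    have e4 : ∀ j, inner ℝ (G (m, j)) (lq C (pd χ j)) = - ∫ x, fu (w m) x * pd (pd χ j) j x := fun j =>
      hw' m j _ (hχ.pd j)
    simp only [e3, e4, Finset.sum_neg_distrib] at h1
    linarith
  have F : ∀ ψ, TestOn (Om C) ψ → ∑ i, ∫ x, fu (w i) x * pd (lap ψ) i x = 0 := by
    intro ψ hψ
    have h1 : ∑ m, ((lam + mu) * (∑ i, ∫ x, fu (w i) x * pd (pd (pd ψ m) m) i x)
      + mu * ∫ x, fu (w m) x * lap (pd ψ m) x) = 0 := Finset.sum_eq_zero fun m _ => E _ (hψ.pd m) m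
    rw [Finset.sum_add_distrib, ← Finset.mul_sum, ← Finset.mul_sum, Finset.sum_comm] at h1
    have e1 : ∀ i, ∑ m, ∫ x, fu (w i) x * pd (pd (pd ψ m) m) i x = ∫ x, fu (w i) x * pd (lap ψ) i x := by
      intro i
      rw [pd_lap hψ.sm, fu_lap _ (hψ.pd i)]
      refine Finset.sum_congr rfl fun m _ => ?_
      rw [pd_comm (hψ.sm.pd m) m i, pd_comm hψ.sm m i]
    simp only [e1, ← pd_lap hψ.sm] at h1
    have : (lam + 2 * mu) * ∑ i, ∫ x, fu (w i) x * pd (lap ψ) i x = 0 := by linarith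
    rcases mul_eq_zero.1 this with h | h
    · nlinarith
    · exact h
  intro ψ hψ
  have h1 := E _ hψ.lap m
  rw [pd_lap hψ.sm] at h1
  rw [F _ (hψ.pd m)] at h1
  simpa [hmu.ne'] using h1

/-- the smooth displacement -/
def uu (w : LL C) : E3 → ℝ := wrep (Om C) (fu w)

lemma uu_sm {w : LL C} (h : Biharm (Om C) (fu w)) : ContDiffOn ℝ 1 (uu w) (Om C) :=
  (wrep_sm (isOpen_Om C) (fu_li w) h).of_le (by simp)

lemma uu_ae {w : LL C} (h : Biharm (Om C) (fu w)) : (fun x => uu w x * (rho x)⁻¹) =ᵐ[muO C] w := by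
  rw [Filter.EventuallyEq, ae_restrict_iff' (meas_Om C)]
  filter_upwards [wrep_ae (isOpen_Om C) (fu_li w) h] with x hx hxO
  have h1 := hx hxO
  rw [fu, Ex, indicator_of_mem hxO] at h1
  unfold uu fu Ex
  rw [← h1, mul_assoc, mul_inv_cancel₀ (rho_pos x).ne', mul_one]

lemma uu_pd {w a : LL C} (h : Biharm (Om C) (fu w)) (j : Fin 3)
    (hw : ∀ φ, TestOn (Om C) φ → inner ℝ w (lq C (fun x => pd φ j x * rho x)) = - inner ℝ a (lq C φ)) :
    pd (uu w) j =ᵐ[muO C] a := by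
  have hO := isOpen_Om C
  have c1 := pd_contOn hO (uu_sm h) j
  rw [Filter.EventuallyEq, ae_restrict_iff' (meas_Om C)]
  have := ae_zero_of_test hO (g := fun x => pd (uu w) j x - Ex C a x)
    ((c1.locallyIntegrableOn hO.measurableSet).sub ((Ex_li (Lp.memLp a)).locallyIntegrableOn _)) (by
    intro φ hφ
    have h1 := ibp hO (uu_sm h) hφ j
    have h2 : ∫ x, uu w x * pd φ j x = ∫ x, fu w x * pd φ j x := by
      apply integral_congr_ae
      filter_upwards [wrep_ae hO (fu_li w) h] with x hx
      by_cases hxO : x ∈ Om C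
      · rw [hx hxO]; rfl
      · rw [pd_zero_of_notMem (fun h' => hxO (hφ.ts h'))]; simp
    rw [h2, fu_test _ (hφ.pd j), hw φ hφ, inner_test hφ] at h1
    simp only [sub_mul]
    rw [integral_sub (mul_test_int hO c1 hφ) (integrable_mul_cs (Ex_li (Lp.memLp a)) hφ.sm.continuous hφ.cs)]
    linarith)
  filter_upwards [this] with x hx hxO
  have h1 := hx hxO
  rw [Ex, indicator_of_mem hxO] at h1
  exact sub_eq_zero.1 h1

end

section
open scoped ContDiff Topology ENNReal NNReal
open Filter

/-! ### Part 17 : translation continuity -/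
variable {C : Set E3}

def AA (n h : E3 → ℝ) (z : E3) : ℝ := ∫ x, n x * h (x - z)

lemma AA_cont {n h : E3 → ℝ} (hn : MemLp n 2 volume) (hh : MemLp h 2 volume) : Continuous (AA n h) := by
  have : Fact ((2:ℝ≥0∞) ≠ ⊤) := ⟨by norm_num⟩
  have e : AA n h = fun z : E3 => inner ℝ (hn.toLp n) (((DomAddAct.mk (-z) : E3ᵈᵃᵃ)) +ᵥ hh.toLp h) := by
    funext z
    rw [DomAddAct.mk_vadd_toLp, L2.inner_def]
    unfold AA
    apply integral_congr_ae
    have h1 := hn.coeFn_toLp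
    have h2 := (hh.comp_measurePreserving <| measurePreserving_vadd (-z) volume).coeFn_toLp
    filter_upwards [h1, h2] with x h1 h2
    erw [h1, h2]
    simp only [Function.comp_apply, vadd_eq_add, RCLike.inner_apply, conj_trivial]
    rw [mul_comm, neg_add_eq_sub]
  rw [e]
  apply continuous_const.inner
  have h3 : Continuous fun z : E3 => (DomAddAct.mk (-z) : E3ᵈᵃᵃ) :=
    DomAddAct.continuous_mk.comp continuous_neg
  exact h3.vadd continuous_const

lemma AA_fub {n h k : E3 → ℝ} (hn : Integrable n) (hh : Integrable h) (hk : Continuous k)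
    (hc : HasCompactSupport k) : ∫ x, n x * cnv h k x = ∫ z, AA n h z * k z := by
  have h1 : Integrable (fun p : E3 × E3 => n p.2 * h (p.2 - p.1)) (volume.prod volume) := by
    have := Integrable.convolution_integrand (ContinuousLinearMap.mul ℝ ℝ) hn hh.comp_neg
    simpa [neg_sub] using this
  obtain ⟨M, hM⟩ := hk.bounded_above_of_compact_support hc
  have h2 : Integrable (fun p : E3 × E3 => n p.2 * h (p.2 - p.1) * k p.1) (volume.prod volume) := by
    refine h1.mul_bdd (c := M) ?_ (Eventually.of_forall fun p => hM p.1)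
    exact (hk.comp continuous_fst).aestronglyMeasurable
  have h3 := integral_integral_swap (f := fun z x => n x * h (x - z) * k z) h2
  simp only [AA, ← integral_mul_const]
  rw [h3]
  congr 1; funext x
  simp only [mul_assoc]
  rw [integral_const_mul]
  congr 1
  unfold cnv
  rw [← integral_sub_left_eq_self _ volume x]
  simp

end

section
open scoped ContDiff Topology ENNReal NNReal
open Filter

/-! ### Part 18 : density, local part -/
variable {C : Set E3}

def LC (C : Set E3) (Q : E3) : Prop := ∃ ρ t1 c : ℝ, ∃ ν : E3, 0 < ρ ∧ 0 < t1 ∧ 0 < c ∧ ‖ν‖ = 1 ∧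
  ∀ x ∈ Om C, dist x Q < ρ → ∀ t, 0 < t → t ≤ t1 → ball (x + t • ν) (c * t) ⊆ Om C

def TN (C : Set E3) (N : Fin 3 → LL C) (w : E3 → ℝ) : ℝ := ∑ j, ∫ x in Om C, N j x * pd w j x

lemma bint {g : E3 → ℝ} {Q : E3} {R : ℝ} (hg : MemLp g 2 volume) (h : ∀ x ∉ ball Q R, g x = 0) :
    Integrable g := by
  rw [← integrableOn_iff_integrable_of_support_subset (s := ball Q R)]
  · have : IsFiniteMeasure (volume.restrict (ball Q R)) := ⟨by
      rw [Measure.restrict_apply_univ]; exact measure_ball_lt_top⟩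
    exact (hg.restrict (ball Q R)).integrable (by norm_num)
  · intro x hx
    by_contra h'
    exact hx (h x h')

lemma cnv_cs {f k : E3 → ℝ} (hf : HasCompactSupport f) (hk : HasCompactSupport k) :
    HasCompactSupport (cnv f k) := by
  rw [cnv_eq]; exact HasCompactSupport.convolution (L := ContinuousLinearMap.mul ℝ ℝ) (μ := volume) hf hk

lemma refl_test {k : E3 → ℝ} (hk : Sm k) (x : E3) (j : Fin 3) :
    Sm (fun y => k (x - y)) ∧ ∀ y, pd (fun y => k (x - y)) j y = - pd k j (x - y) := by
  have e : (fun y => k (x - y)) = fun y => k ((-1:ℝ) • (y - x)) := by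
    funext y; congr 1; simp
  refine ⟨by rw [e]; exact hk.comp_aff _ _, fun y => ?_⟩
  rw [e, pd_aff hk]
  have : (-1:ℝ) • (y - x) = x - y := by simp
  simp only [this]; ring

lemma cnv_shift {Q ν : E3} {ρ t c : ℝ} (hν : ‖ν‖ = 1) (ht : 0 < t)
    (hcone : ∀ x ∈ Om C, dist x Q < ρ → ball (x + t • ν) (c * t) ⊆ Om C)
    (hsm : t + c * t < ρ / 2)
    {f k : E3 → ℝ} (hf : ContDiffOn ℝ 1 f (Om C)) (hfs : tsupport f ⊆ ball Q (ρ / 2))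
    (hk : TestOn (ball (-(t • ν)) (c * t)) k) (j : Fin 3) :
    (∀ x ∈ Om C, cnv (Ex C f) (pd k j) x = cnv (Ex C (pd f j)) k x) ∧
    (∀ x ∉ ball Q ρ, cnv (Ex C (pd f j)) k x = 0) := by
  have far : ∀ x ∉ ball Q ρ, ∀ y, x - y ∈ tsupport k → y ∉ tsupport f := by
    intro x hx y hy hyf
    have h1 := hk.ts hy
    have h2 := hfs hyf
    rw [mem_ball, dist_eq_norm] at h1 h2
    apply hx
    rw [mem_ball, dist_eq_norm]
    have : x - Q = (x - y - -(t • ν)) - t • ν + (y - Q) := by abel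
    rw [this]
    have h3 : ‖t • ν‖ = t := by rw [norm_smul, hν, Real.norm_of_nonneg ht.le, mul_one]
    linarith [norm_add_le ((x - y - -(t • ν)) - t • ν) (y - Q), norm_sub_le (x - y - -(t • ν)) (t • ν)]
  have z1 : ∀ x ∉ ball Q ρ, cnv (Ex C (pd f j)) k x = 0 := by
    intro x hx
    unfold cnv
    rw [← integral_zero E3 ℝ]
    congr 1; funext y
    by_cases hy : x - y ∈ tsupport k
    · have := pd_zero_of_notMem (far x hx y hy) j
      simp [Ex, indicator, this]
    · rw [image_eq_zero_of_notMem_tsupport hy, mul_zero]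
  refine ⟨fun x hx => ?_, z1⟩
  by_cases hxQ : x ∈ ball Q ρ
  · obtain ⟨s1, s2⟩ := refl_test hk.sm x j
    have T : TestOn (Om C) (fun y => k (x - y)) := by
      refine ⟨s1, shift_cs hk.cs x, ?_⟩
      intro y hy
      have h1 : x - y ∈ tsupport k := tsupport_comp_subset_preimage k (f := fun y => x - y) (by fun_prop) hy
      have h2 := hk.ts h1
      apply hcone x hx hxQ
      rw [mem_ball, dist_eq_norm] at h2 ⊢
      have e0 : y - (x + t • ν) = -(x - y - -(t • ν)) := by abel
      rwa [e0, norm_neg]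
    have h1 := ibp (isOpen_Om C) hf T j
    unfold cnv
    have e1 : ∀ y, Ex C f y * pd k j (x - y) = - (f y * pd (fun y => k (x - y)) j y) := by
      intro y
      rw [s2]
      by_cases hy : y ∈ Om C
      · simp [Ex, hy]
      · have : pd k j (x - y) = 0 := by
          have := pd_zero_of_notMem (fun h => hy (T.ts h)) j (x := y)
          rw [s2] at this; linarith
        simp [this]
    have e2 : ∀ y, Ex C (pd f j) y * k (x - y) = pd f j y * k (x - y) := by
      intro y
      by_cases hy : y ∈ Om C
      · simp [Ex, hy]
      · have : k (x - y) = 0 := image_eq_zero_of_notMem_tsupport (f := fun y => k (x - y)) (fun h => hy (T.ts h))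
        simp [this]
    simp only [e1, e2]
    rw [integral_neg, h1, neg_neg]
  · rw [z1 x hxQ]
    unfold cnv
    rw [← integral_zero E3 ℝ]
    congr 1; funext y
    by_cases hy : x - y ∈ tsupport k
    · have := image_eq_zero_of_notMem_tsupport (far x hxQ y hy)
      simp [Ex, indicator, this]
    · rw [pd_zero_of_notMem hy, mul_zero]

lemma TN_local {Q : E3} (hQ : LC C Q) {N : Fin 3 → LL C} (hN : ∀ v, TestOn univ v → TN C N v = 0) :
    ∃ ρ : ℝ, 0 < ρ ∧ ∀ f : E3 → ℝ, ContDiffOn ℝ 1 f (Om C) → MemLp f 2 (muO C) →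
      (∀ j, MemLp (pd f j) 2 (muO C)) → tsupport f ⊆ ball Q ρ → TN C N f = 0 := by
  obtain ⟨ρ, t1, c, ν, hρ, ht1, hc, hν, hcone⟩ := hQ
  refine ⟨ρ / 2, by positivity, fun f hf hf2 hfj hfs => ?_⟩
  set h : Fin 3 → E3 → ℝ := fun j => Ex C (pd f j) with hh
  set n : Fin 3 → E3 → ℝ := fun j => (ball Q ρ).indicator (Ex C (N j)) with hn
  have mh : ∀ j, MemLp (h j) 2 volume := fun j => (memLp_indicator_iff_restrict (meas_Om C)).2 (hfj j)
  have mn : ∀ j, MemLp (n j) 2 volume := fun j =>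
    ((memLp_indicator_iff_restrict (meas_Om C)).2 (Lp.memLp (N j))).indicator measurableSet_ball
  have ih : ∀ j, Integrable (h j) := fun j => bint (Q := Q) (R := ρ / 2) (mh j) fun x hx => by
    have := pd_zero_of_notMem (fun h' => hx (hfs h')) j
    simp [hh, Ex, indicator, this]
  have iN : ∀ j, Integrable (n j) := fun j => bint (Q := Q) (R := ρ) (mn j) fun x hx => by
    simp [hn, hx]
  have key : ∀ t, 0 < t → t ≤ t1 → t + c * t < ρ / 2 → ∑ j, AA (n j) (h j) (-(t • ν)) = 0 := by
    intro t ht htt hts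
    have cA : Continuous fun z => ∑ j, AA (n j) (h j) z :=
      continuous_finsetSum _ fun j _ => AA_cont (mn j) (mh j)
    apply zero_of_test (isOpen_ball (x := -(t • ν)) (ε := c * t)) cA.continuousOn
    · intro k hk
      have hsh := fun j => cnv_shift hν ht (fun x hx hxq => hcone x hx hxq t ht htt) hts hf hfs hk j
      have li : LocallyIntegrable (Ex C f) volume := Ex_li hf2
      have hF : TestOn univ (cnv (Ex C f) k) := by
        refine ⟨cnv_sm li hk.sm hk.cs, cnv_cs ?_ hk.cs, subset_univ _⟩
        apply HasCompactSupport.of_support_subset_isCompact (isCompact_closedBall Q (ρ/2))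
        intro x hx
        apply ball_subset_closedBall
        apply hfs
        apply subset_tsupport
        intro h0; apply hx; simp [Ex, indicator, h0]
      have h0 := hN _ hF
      unfold TN at h0
      have e : ∀ j, ∫ x in Om C, N j x * pd (cnv (Ex C f) k) j x = ∫ z, AA (n j) (h j) z * k z := by
        intro j
        rw [← AA_fub (iN j) (ih j) hk.sm.continuous hk.cs, cnv_pd li hk.sm hk.cs, ← integral_indicator (meas_Om C)]
        congr 1; funext x
        by_cases hx : x ∈ Om C
        · rw [indicator_of_mem hx, (hsh j).1 x hx]
          by_cases hxq : x ∈ ball Q ρ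
          · simp only [hn, indicator_of_mem hxq, Ex, indicator_of_mem hx, hh]
          · rw [(hsh j).2 x hxq, mul_zero, mul_zero]
        · simp [hx, hn, Ex, indicator]
      simp only [e] at h0
      rw [← h0]
      simp only [Finset.sum_mul]
      rw [integral_finsetSum]
      intro j _
      exact ((AA_cont (mn j) (mh j)).mul hk.sm.continuous).integrable_of_hasCompactSupport hk.cs.mul_left
    · rw [mem_ball, dist_self]; positivity
  have lim : ∑ j, AA (n j) (h j) 0 = 0 := by
    have cA : Continuous fun t : ℝ => ∑ j, AA (n j) (h j) (-(t • ν)) :=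
      continuous_finsetSum _ fun j _ => (AA_cont (mn j) (mh j)).comp (by fun_prop)
    have l1 := (cA.tendsto 0).mono_left (nhdsWithin_le_nhds (s := Ioi 0))
    have l2 : (fun t : ℝ => ∑ j, AA (n j) (h j) (-(t • ν))) =ᶠ[𝓝[>] 0] fun _ => 0 := by
      have s1 : ∀ᶠ t : ℝ in 𝓝[>] 0, t < t1 := nhdsWithin_le_nhds (eventually_lt_nhds ht1)
      have s2 : ∀ᶠ t : ℝ in 𝓝[>] 0, t + c * t < ρ / 2 := by
        apply nhdsWithin_le_nhds
        have : Continuous fun t : ℝ => t + c * t := by fun_prop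
        exact (this.tendsto 0).eventually_lt_const (by simp; positivity)
      filter_upwards [s1, s2, self_mem_nhdsWithin] with t a b d
      exact key t d a.le b
    have := tendsto_nhds_unique l1 (tendsto_const_nhds.congr' l2.symm)
    simpa using this
  rw [← lim]
  unfold TN AA
  congr 1; funext j
  rw [← integral_indicator (meas_Om C)]
  congr 1; funext x
  simp only [sub_zero]
  by_cases hx : x ∈ Om C
  · by_cases hxq : x ∈ ball Q ρ
    · simp only [hn, indicator_of_mem hxq, Ex, indicator_of_mem hx, hh]
    · have : x ∉ tsupport f := fun h' => hxq (ball_subset_ball (by linarith) (hfs h'))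
      simp [hn, hxq, hx, pd_zero_of_notMem this j]
  · simp [hx, hn, Ex, indicator]

end

section
open scoped ContDiff Topology ENNReal NNReal
open Filter

/-! ### Part 19 : density, global part -/
variable {C : Set E3}

lemma LC_all {D r t0 c : ℝ} (hD : 1 < D) (hr : 0 < r) (ht0 : 0 < t0) (hc : 0 < c) (hC : Adm D C)
    (hcone : ConeC C r t0 c) (Q : E3) : LC C Q := by
  have nv : ‖(EuclideanSpace.single 2 (-1) : E3)‖ = 1 := by rw [PiLp.norm_single]; simp
  by_cases hQ : Q ∈ closure C
  · by_cases hQC : Q ∈ C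
    · obtain ⟨s, hs, h⟩ := Metric.isOpen_iff.1 hC.op Q hQC
      exact ⟨s, 1, 1, _, hs, one_pos, one_pos, nv, fun x hx hxs => absurd (subset_closure (h hxs)) hx.2⟩
    · have hf : Q ∈ frontier C := ⟨hQ, by rwa [hC.op.interior_eq]⟩
      obtain ⟨ν, hν, h⟩ := hcone Q hf
      refine ⟨min r (1/2), min t0 (1 / (2 * (1 + c))), c, ν, by positivity, by positivity, hc, hν, ?_⟩
      intro x hx hxQ t ht htt z hz
      have h1 : x ∉ C := fun h' => hx.2 (subset_closure h')
      refine ⟨?_, disj_closure (h x h1 (hxQ.trans_le (min_le_left _ _)) t ht (htt.trans (min_le_left _ _))) z hz⟩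
      change z 2 < 0
      have h2 := hC.dp Q hQ
      have h3 := coord_le_norm (z - Q) 2
      have h4 := hxQ.trans_le (min_le_right _ _)
      rw [mem_ball, dist_eq_norm] at hz
      rw [dist_eq_norm] at h4
      have h5 : ‖z - Q‖ ≤ ‖z - (x + t • ν)‖ + ‖t • ν‖ + ‖x - Q‖ := by
        have : z - Q = (z - (x + t • ν)) + t • ν + (x - Q) := by abel
        rw [this]; exact norm_add₃_le
      have h6 : ‖t • ν‖ = t := by rw [norm_smul, hν, Real.norm_of_nonneg ht.le, mul_one]
      have h7 : t * (2 * (1 + c)) ≤ 1 := by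
        have := htt.trans (min_le_right _ _)
        rwa [le_div_iff₀ (by positivity)] at this
      have h8 : z 2 - Q 2 ≤ ‖z - Q‖ := (le_abs_self _).trans h3
      nlinarith
  · obtain ⟨s, hs, h⟩ := Metric.isOpen_iff.1 isClosed_closure.isOpen_compl Q hQ
    refine ⟨s/3, s/3, 1, _, by positivity, by positivity, one_pos, nv, ?_⟩
    intro x hx hxQ t ht htt z hz
    rw [mem_ball, dist_eq_norm, one_mul] at hz
    rw [dist_eq_norm] at hxQ
    refine ⟨?_, h ?_⟩
    · change z 2 < 0
      have h3 := (le_abs_self _).trans (coord_le_norm (z - (x + t • (EuclideanSpace.single 2 (-1) : E3))) 2)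
      have h4 : x 2 < 0 := hx.1
      have h5 : (z - (x + t • (EuclideanSpace.single 2 (-1) : E3))) 2 = z 2 - (x 2 - t) := by
        simp; ring
      rw [h5] at h3; linarith
    · rw [mem_ball, dist_eq_norm]
      have : z - Q = (z - (x + t • (EuclideanSpace.single 2 (-1) : E3))) + t • (EuclideanSpace.single 2 (-1) : E3) + (x - Q) := by abel
      rw [this]
      have h6 : ‖t • (EuclideanSpace.single 2 (-1) : E3)‖ = t := by
        rw [norm_smul, nv, Real.norm_of_nonneg ht.le, mul_one]
      have := norm_add₃_le (a := z - (x + t • (EuclideanSpace.single 2 (-1) : E3))) (b := t • (EuclideanSpace.single 2 (-1) : E3)) (c := x - Q)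
      linarith

structure Good (C : Set E3) (w : E3 → ℝ) : Prop where
  c1 : ContDiffOn ℝ 1 w (Om C)
  l2 : MemLp (fun x => w x * (rho x)⁻¹) 2 (muO C)
  g2 : ∀ j, MemLp (pd w j) 2 (muO C)

lemma TN_inner {N : Fin 3 → LL C} {w : E3 → ℝ} (h : ∀ j, MemLp (pd w j) 2 (muO C)) :
    TN C N w = ∑ j, inner ℝ (N j) (lq C (pd w j)) := by
  unfold TN
  congr 1; funext j
  rw [inner_lq (h j)]

lemma pd_mulOn {ζ w : E3 → ℝ} (hζ : Sm ζ) (hw : ContDiffOn ℝ 1 w (Om C)) {x : E3} (hx : x ∈ Om C) (j : Fin 3) :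
    pd (fun x => ζ x * w x) j x = pd ζ j x * w x + ζ x * pd w j x := by
  have d := (hw.differentiableOn (by simp)).differentiableAt ((isOpen_Om C).mem_nhds hx)
  have := (hζ.diff x).hasFDerivAt.mul d.hasFDerivAt
  simp only [pd]
  erw [this.fderiv]
  simp; ring

lemma test_bdd_mul {ζ g : E3 → ℝ} (hζ : TestOn univ ζ) (hg : MemLp g 2 (muO C)) :
    MemLp (fun x => ζ x * g x) 2 (muO C) := by
  obtain ⟨M, hM⟩ := hζ.sm.continuous.bounded_above_of_compact_support hζ.cs
  have : MemLp (fun x => ζ x) ⊤ (muO C) :=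
    memLp_top_of_bound hζ.sm.continuous.aestronglyMeasurable M (Eventually.of_forall hM)
  exact hg.mul this

lemma Good.l2mul {w ζ : E3 → ℝ} (hw : Good C w) (hζ : TestOn univ ζ) : MemLp (fun x => ζ x * w x) 2 (muO C) := by
  have := test_bdd_mul (hζ.muls rho_sm) hw.l2
  convert this using 2 with x
  field_simp [(rho_pos x).ne']

lemma Good.mul {w ζ : E3 → ℝ} (hw : Good C w) (hζ : TestOn univ ζ) :
    Good C (fun x => ζ x * w x) ∧ MemLp (fun x => ζ x * w x) 2 (muO C) := by
  refine ⟨⟨(hζ.sm.of_le (by simp)).contDiffOn.mul hw.c1, ?_, fun j => ?_⟩, hw.l2mul hζ⟩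
  · have := test_bdd_mul hζ hw.l2
    convert this using 2 with x
    ring
  · have h1 := (hw.l2mul (hζ.pd j)).add (test_bdd_mul hζ (hw.g2 j))
    refine (memLp_congr_ae ?_).1 h1
    rw [Filter.EventuallyEq, muO, ae_restrict_iff' (meas_Om C)]
    exact Eventually.of_forall fun x hx => (pd_mulOn hζ.sm hw.c1 hx j).symm

lemma TN_add {N : Fin 3 → LL C} {f g : E3 → ℝ} (hf : Good C f) (hg : Good C g) :
    TN C N (fun x => f x + g x) = TN C N f + TN C N g := by
  unfold TN
  rw [← Finset.sum_add_distrib]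
  congr 1; funext j
  rw [← integral_add]
  · apply setIntegral_congr_fun (meas_Om C)
    intro x hx
    have d := (hf.c1.differentiableOn (by simp)).differentiableAt ((isOpen_Om C).mem_nhds hx)
    have d' := (hg.c1.differentiableOn (by simp)).differentiableAt ((isOpen_Om C).mem_nhds hx)
    have := d.hasFDerivAt.add d'.hasFDerivAt
    have e : pd (fun x => f x + g x) j x = pd f j x + pd g j x := by
      simp only [pd]
      erw [this.fderiv]; simp
    simp only [e]; ring
  · exact (Lp.memLp (N j)).integrable_mul (hf.g2 j)
  · exact (Lp.memLp (N j)).integrable_mul (hg.g2 j)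

lemma TN_test (hlc : ∀ Q, LC C Q) {N : Fin 3 → LL C} (hN : ∀ v, TestOn univ v → TN C N v = 0)
    {w ζ : E3 → ℝ} (hw : Good C w) (hζ : TestOn univ ζ) : TN C N (fun x => ζ x * w x) = 0 := by
  have P : ∃ η : E3 → ℝ, Sm η ∧ (∀ x ∈ tsupport ζ, η x = 0) ∧ ∀ ξ, TestOn univ ξ →
      TN C N (fun x => ξ x * w x) = TN C N (fun x => (ξ x * η x) * w x) := by
    refine hζ.cs.isCompact.induction_on (p := fun s => ∃ η : E3 → ℝ, Sm η ∧ (∀ x ∈ s, η x = 0) ∧ ∀ ξ, TestOn univ ξ →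
      TN C N (fun x => ξ x * w x) = TN C N (fun x => (ξ x * η x) * w x)) ?_ ?_ ?_ ?_
    · exact ⟨fun _ => 1, contDiff_const, by simp, fun ξ _ => by simp⟩
    · rintro s t hst ⟨η, h1, h2, h3⟩
      exact ⟨η, h1, fun x hx => h2 x (hst hx), h3⟩
    · rintro s t ⟨η, h1, h2, h3⟩ ⟨η', h1', h2', h3'⟩
      refine ⟨fun x => η x * η' x, h1.mul h1', ?_, fun ξ hξ => ?_⟩
      · rintro x (hx | hx)
        · simp [h2 x hx]
        · simp [h2' x hx]
      · rw [h3 ξ hξ, h3' _ (hξ.muls h1)]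
        simp only [mul_assoc]
    · intro Q _
      obtain ⟨ρ, hρ, hl⟩ := TN_local (hlc Q) hN
      let b : ContDiffBump Q := ⟨ρ/3, ρ/2, by positivity, by linarith⟩
      have bs : Sm (fun x => b x) := b.contDiff
      have bt : tsupport (fun x => b x) ⊆ ball Q ρ := by
        have : tsupport (fun x => b x) = closedBall Q (ρ/2) := b.tsupport_eq
        rw [this]; exact closedBall_subset_ball (by linarith)
      refine ⟨closedBall Q (ρ/3), nhdsWithin_le_nhds (closedBall_mem_nhds Q (by positivity)), fun x => 1 - b x,
        contDiff_const.sub bs, fun x hx => ?_, fun ξ hξ => ?_⟩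
      · simp only [b.one_of_mem_closedBall hx, sub_self]
      · have t1 := hξ.muls bs
        have t2 := hξ.muls (contDiff_const.sub bs : Sm (fun x => 1 - b x))
        have e := TN_add (N := N) (hw.mul t1).1 (hw.mul t2).1
        have z := hl _ (hw.mul t1).1.c1 (hw.mul t1).2 (hw.mul t1).1.g2 (by
          refine subset_trans ?_ bt
          exact tsupport_mul_subset_left.trans tsupport_mul_subset_right)
        rw [z, zero_add] at e
        rw [← e]
        congr 1; funext x; ring
  obtain ⟨η, h1, h2, h3⟩ := P
  rw [h3 ζ hζ]
  have e : (fun x => ζ x * η x * w x) = fun _ => 0 := by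
    funext x
    by_cases hx : x ∈ tsupport ζ
    · simp [h2 x hx]
    · simp [image_eq_zero_of_notMem_tsupport hx]
  rw [e]
  exact hN _ TestOn.zero

lemma TN_zero (hlc : ∀ Q, LC C Q) {N : Fin 3 → LL C} (hN : ∀ v, TestOn univ v → TN C N v = 0)
    {w : E3 → ℝ} (hw : Good C w) : TN C N w = 0 := by
  let b : ContDiffBump (0 : E3) := ⟨1, 2, one_pos, one_lt_two⟩
  have bs : Sm (fun x => b x) := b.contDiff
  have bT : TestOn univ (fun x => b x) := ⟨bs, b.hasCompactSupport, subset_univ _⟩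
  have bt : tsupport (fun x => b x) = closedBall 0 2 := b.tsupport_eq
  set ζ : ℕ → E3 → ℝ := fun n x => b (((n:ℝ) + 1)⁻¹ • (x - 0)) with hζ
  have ζs : ∀ n, Sm (ζ n) := fun n => bs.comp_aff _ _
  have nz : ∀ n : ℕ, (0:ℝ) < ((n:ℝ) + 1)⁻¹ := fun n => by positivity
  have ζt : ∀ n, TestOn univ (ζ n) := by
    intro n
    refine ⟨ζs n, ?_, subset_univ _⟩
    have := bT.cs.comp_homeomorph (Homeomorph.smulOfNeZero (((n:ℝ) + 1)⁻¹) (nz n).ne' : E3 ≃ₜ E3)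
    simpa [hζ, Function.comp_def] using this
  have ζp : ∀ n j x, pd (ζ n) j x = ((n:ℝ)+1)⁻¹ * pd (fun x => b x) j (((n:ℝ) + 1)⁻¹ • x) := by
    intro n j x
    have := congrFun (pd_aff bs (((n:ℝ) + 1)⁻¹) 0 j) x
    simpa [hζ] using this
  have conv : ∀ j, Tendsto (fun n => ∫ x in Om C, N j x * pd (fun x => ζ n x * w x) j x) atTop
      (𝓝 (∫ x in Om C, N j x * pd w j x)) := by
    intro j
    obtain ⟨M, hM⟩ := (bs.pd j).continuous.bounded_above_of_compact_support (bT.pd j).cs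
    have hM0 : 0 ≤ M := (norm_nonneg _).trans (hM 0)
    apply tendsto_integral_of_dominated_convergence
      (fun x => ‖N j x‖ * (3 * M * ‖w x * (rho x)⁻¹‖ + ‖pd w j x‖))
    · intro n
      exact (Lp.memLp (N j)).aestronglyMeasurable.mul ((hw.mul (ζt n)).1.g2 j).aestronglyMeasurable
    · have := (Lp.memLp (N j)).norm.integrable_mul ((hw.l2.norm.const_mul (3 * M)).add (hw.g2 j).norm)
      exact this
    · intro n
      rw [ae_restrict_iff' (meas_Om C)]
      refine Eventually.of_forall fun x hx => ?_
      rw [pd_mulOn (ζs n) hw.c1 hx, norm_mul]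
      gcongr
      refine (norm_add_le _ _).trans ?_
      gcongr
      · rw [ζp, norm_mul, norm_mul, Real.norm_of_nonneg (nz n).le, norm_mul, norm_inv, Real.norm_of_nonneg (rho_pos x).le]
        by_cases hx2 : ((n:ℝ) + 1)⁻¹ • x ∈ tsupport (fun x => b x)
        · rw [bt, mem_closedBall, dist_zero_right, norm_smul, Real.norm_of_nonneg (nz n).le, inv_mul_le_iff₀ (by positivity)] at hx2
          have h1 : rho x ≤ 3 * ((n:ℝ) + 1) := by
            unfold rho
            apply Real.sqrt_le_iff.2 ⟨by positivity, ?_⟩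
            have : (0:ℝ) ≤ n := by positivity
            nlinarith [norm_nonneg x]
          have h2 : ((n:ℝ) + 1)⁻¹ ≤ 3 * (rho x)⁻¹ := by
            rw [← div_eq_mul_inv, inv_le_comm₀ (by positivity) (by have := rho_pos x; positivity), inv_div]
            linarith
          have h3 := hM (((n:ℝ) + 1)⁻¹ • x)
          calc _ ≤ 3 * (rho x)⁻¹ * M * ‖w x‖ := by
                have := rho_pos x
                gcongr
            _ = _ := by ring
        · rw [pd_zero_of_notMem hx2]
          have := rho_pos x
          simp; positivity
      · rw [norm_mul]
        have : ‖ζ n x‖ ≤ 1 := by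
          rw [Real.norm_of_nonneg b.nonneg]; exact b.le_one
        nlinarith [norm_nonneg (pd w j x)]
    · rw [ae_restrict_iff' (meas_Om C)]
      refine Eventually.of_forall fun x hx => ?_
      apply tendsto_const_nhds.congr'
      obtain ⟨n0, hn0⟩ := exists_nat_gt ‖x‖
      filter_upwards [eventually_ge_atTop n0] with n hn
      have hxn : ‖x‖ < (n:ℝ) + 1 := by
        have : (n0:ℝ) ≤ n := by exact_mod_cast hn
        linarith
      have : pd (fun x => ζ n x * w x) j x = pd w j x := by
        apply pd_congr
        have : ball (0:E3) ((n:ℝ)+1) ∈ 𝓝 x := isOpen_ball.mem_nhds (by simpa using hxn)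
        filter_upwards [this] with y hy
        have : ζ n y = 1 := by
          apply b.one_of_mem_closedBall
          rw [mem_closedBall, dist_zero_right, sub_zero, norm_smul, Real.norm_of_nonneg (nz n).le, inv_mul_le_iff₀ (by positivity), mul_one]
          exact (mem_ball_zero_iff.1 hy).le
        rw [this, one_mul]
      rw [this]
  have lim : Tendsto (fun n => TN C N (fun x => ζ n x * w x)) atTop (𝓝 (TN C N w)) :=
    tendsto_finsetSum _ fun j _ => conv j
  have h0 : ∀ n, TN C N (fun x => ζ n x * w x) = 0 := fun n => TN_test hlc hN hw (ζt n)
  simp only [h0] at lim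
  exact tendsto_nhds_unique lim tendsto_const_nhds |>.symm ▸ rfl

theorem Good_VV (hlc : ∀ Q, LC C Q) {w : Fin 3 → E3 → ℝ} (hw : ∀ i, Good C (w i)) : grad C w ∈ VV C := by
  have : IsClosed (VV C : Set (MM C)) := Submodule.isClosed_topologicalClosure _
  rw [← Submodule.orthogonal_orthogonal (VV C), Submodule.mem_orthogonal]
  intro H hH
  rw [Submodule.mem_orthogonal'] at hH
  rw [inner_MM]
  apply Finset.sum_eq_zero
  intro i _
  have h1 := TN_zero hlc (N := fun j => H (i, j)) (fun v hv => by
    rw [TN_inner fun j => memLp_pd hv j, ← inner_rowf]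
    exact hH _ (VV_mem fun m => rowf_test hv i m)) (hw i)
  rw [TN_inner (hw i).g2] at h1
  exact h1

end

section
open scoped ContDiff Topology ENNReal NNReal
open Filter

/-! ### Part 20 : weak formulation and uniqueness -/
variable {C : Set E3}

lemma aa_int {lam mu : ℝ} {u v : Fin 3 → E3 → ℝ} (hu : ∀ i j, MemLp (pd (u i) j) 2 (muO C))
    (hv : ∀ i j, MemLp (pd (v i) j) 2 (muO C)) :
    aa lam mu (grad C u) (grad C v) = ∫ x in Om C, (lam * (∑ i, pd (u i) i x) * (∑ i, pd (v i) i x) +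
      2 * mu * ∑ i, ∑ j, ((pd (u i) j x + pd (u j) i x) / 2) * ((pd (v i) j x + pd (v j) i x) / 2)) := by
  have mt : ∀ {u : Fin 3 → E3 → ℝ}, (∀ i j, MemLp (pd (u i) j) 2 (muO C)) →
      MemLp (fun x => ∑ i, pd (u i) i x) 2 (muO C) := fun h => memLp_finsetSum _ fun i _ => h i i
  have ms : ∀ {u : Fin 3 → E3 → ℝ}, (∀ i j, MemLp (pd (u i) j) 2 (muO C)) → ∀ i j,
      MemLp (fun x => pd (u i) j x + pd (u j) i x) 2 (muO C) := fun h i j => (h i j).add (h j i)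
  have et : ∀ {u : Fin 3 → E3 → ℝ}, (∀ i j, MemLp (pd (u i) j) 2 (muO C)) →
      tr C (grad C u) = lq C (fun x => ∑ i, pd (u i) i x) := by
    intro u h
    have e : (fun x => ∑ i, pd (u i) i x) = fun x => pd (u 0) 0 x + pd (u 1) 1 x + pd (u 2) 2 x := by
      funext x; rw [Fin.sum_univ_three]
    have m1 : MemLp (fun x => pd (u 0) 0 x + pd (u 1) 1 x) 2 (muO C) := (h 0 0).add (h 1 1)
    rw [e, lq_add m1 (h 2 2), lq_add (h 0 0) (h 1 1), tr_apply, Fin.sum_univ_three]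
    rfl
  have es : ∀ {u : Fin 3 → E3 → ℝ}, (∀ i j, MemLp (pd (u i) j) 2 (muO C)) → ∀ i j,
      (grad C u + Tt C (grad C u)) (i, j) = lq C (fun x => pd (u i) j x + pd (u j) i x) := by
    intro u h i j
    rw [lq_add (h i j) (h j i)]
    rfl
  have i1 : Integrable (fun x => (∑ i, pd (u i) i x) * (∑ i, pd (v i) i x)) (muO C) :=
    (mt hu).integrable_mul (mt hv)
  have i2 : ∀ i j, Integrable (fun x => (pd (u i) j x + pd (u j) i x) * (pd (v i) j x + pd (v j) i x)) (muO C) :=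
    fun i j => (ms hu i j).integrable_mul (ms hv i j)
  have e0 : ∀ x, lam * (∑ i, pd (u i) i x) * (∑ i, pd (v i) i x) +
      2 * mu * ∑ i, ∑ j, ((pd (u i) j x + pd (u j) i x) / 2) * ((pd (v i) j x + pd (v j) i x) / 2)
      = lam * ((∑ i, pd (u i) i x) * (∑ i, pd (v i) i x)) +
      mu / 2 * ∑ i, ∑ j, ((pd (u i) j x + pd (u j) i x) * (pd (v i) j x + pd (v j) i x)) := by
    intro x
    rw [mul_assoc lam]
    congr 1
    rw [Finset.mul_sum, Finset.mul_sum]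
    refine Finset.sum_congr rfl fun i _ => ?_
    rw [Finset.mul_sum, Finset.mul_sum]
    refine Finset.sum_congr rfl fun j _ => ?_
    ring
  simp only [e0]
  have i3 : ∀ i, Integrable (fun x => ∑ j, (pd (u i) j x + pd (u j) i x) * (pd (v i) j x + pd (v j) i x)) (muO C) :=
    fun i => integrable_finsetSum _ fun j _ => i2 i j
  have i4 : Integrable (fun x => ∑ i, ∑ j, (pd (u i) j x + pd (u j) i x) * (pd (v i) j x + pd (v j) i x)) (muO C) :=
    integrable_finsetSum _ fun i _ => i3 i
  have s := integral_add (i1.const_mul lam) (i4.const_mul (mu/2))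
  unfold muO at s
  rw [s, integral_const_mul, integral_const_mul]
  unfold aa
  rw [et hu, et hv, inner_lq2 (mt hu) (mt hv), inner_MM]
  congr 2
  have s2 := integral_finsetSum Finset.univ (fun i _ => i3 i)
  unfold muO at s2
  rw [s2]
  congr 1; funext i
  have s3 := integral_finsetSum Finset.univ (fun j _ => i2 i j)
  unfold muO at s3
  rw [s3]
  congr 1; funext j
  rw [es hu, es hv, inner_lq2 (ms hu i j) (ms hv i j)]

def cp (u : E3 → E3) (i : Fin 3) (x : E3) : ℝ := u x i

lemma cp_jac {u : E3 → E3} {x : E3} (h : DifferentiableAt ℝ u x) (i j : Fin 3) :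
    jac u x i j = pd (cp u i) j x := by
  have : HasFDerivAt (cp u i) ((PiLp.proj 2 (fun _ : Fin 3 => ℝ) i : E3 →L[ℝ] ℝ).comp (fderiv ℝ u x)) x :=
    (PiLp.proj 2 (fun _ : Fin 3 => ℝ) i : E3 →L[ℝ] ℝ).hasFDerivAt.comp x h.hasFDerivAt
  simp only [jac, pd, this.fderiv]
  rfl

lemma cp_test {v : E3 → E3} (h : ContDiff ℝ (⊤ : ℕ∞) v) (hc : HasCompactSupport v) (i : Fin 3) :
    TestOn univ (cp v i) := by
  refine ⟨(contDiff_piLp 2).1 h i, ?_, subset_univ _⟩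
  exact hc.comp_left (g := fun y : E3 => y i) rfl

lemma weak_eq {lam mu : ℝ} {u v : E3 → E3} (hu : ContDiffOn ℝ 1 u (Om C)) (hg : ∀ i, Good C (cp u i))
    (h : ContDiff ℝ (⊤ : ℕ∞) v) (hc : HasCompactSupport v) :
    ∫ x in Om C, (lam * divg u x * divg v x + 2 * mu * ∑ i, ∑ j, strain u x i j * strain v x i j) =
      aa lam mu (grad C (cp u)) (grad C (cp v)) := by
  rw [aa_int (fun i j => (hg i).g2 j) (fun i j => memLp_pd (cp_test h hc i) j)]
  apply setIntegral_congr_fun (meas_Om C)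
  intro x hx
  have d := (hu.differentiableOn (by simp)).differentiableAt ((isOpen_Om C).mem_nhds hx)
  have d' : DifferentiableAt ℝ v x := h.differentiable (by simp) x
  simp only [divg, strain, cp_jac d, cp_jac d']

lemma good_of {u : E3 → E3} (hu : ContDiffOn ℝ 1 u (Om C))
    (h1 : IntegrableOn (fun x => ‖u x‖^2 / (1 + ‖x‖^2)) (Om C))
    (h2 : IntegrableOn (fun x => frob2 (jac u x)) (Om C)) (i : Fin 3) : Good C (cp u i) := by
  have c1 : ContDiffOn ℝ 1 (cp u i) (Om C) := (contDiffOn_piLp 2).1 hu i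
  refine ⟨c1, ?_, fun j => ?_⟩
  · have m : AEStronglyMeasurable (fun x => cp u i x * (rho x)⁻¹) (muO C) :=
      (c1.continuousOn.mul rhoi_sm.continuous.continuousOn).aestronglyMeasurable (meas_Om C)
    rw [memLp_two_iff_integrable_sq m]
    refine Integrable.mono' h1 (m.pow 2) (Eventually.of_forall fun x => ?_)
    rw [Real.norm_of_nonneg (by positivity), mul_pow, inv_pow, rho_sq, div_eq_mul_inv]
    have : cp u i x ^ 2 ≤ ‖u x‖ ^ 2 := sq_le_sq' (by
      have := (abs_le.1 (coord_le_norm (u x) i)).1; exact this) ((le_abs_self _).trans (coord_le_norm (u x) i))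
    gcongr
  · have m : AEStronglyMeasurable (pd (cp u i) j) (muO C) := (meas_pd _ j).aestronglyMeasurable
    rw [memLp_two_iff_integrable_sq m]
    refine Integrable.mono' h2 (m.pow 2) ?_
    rw [ae_restrict_iff' (meas_Om C)]
    refine Eventually.of_forall fun x hx => ?_
    have d := (hu.differentiableOn (by simp)).differentiableAt ((isOpen_Om C).mem_nhds hx)
    rw [Real.norm_of_nonneg (by positivity), ← cp_jac d]
    unfold frob2
    calc _ ≤ ∑ j, jac u x i j ^ 2 := Finset.single_le_sum (f := fun j => jac u x i j ^ 2) (fun _ _ => by positivity) (Finset.mem_univ j)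
      _ ≤ _ := Finset.single_le_sum (f := fun i => ∑ j, jac u x i j ^ 2) (fun _ _ => by positivity) (Finset.mem_univ i)

lemma const_zero {D a : ℝ} (hD : 1 < D) (hC : Adm D C) (h : MemLp (fun x => a * (rho x)⁻¹) 2 (muO C)) : a = 0 := by
  by_contra ha
  set g : E3 → ℝ≥0∞ := fun x => ENNReal.ofReal (1 / (1 + ‖x‖ ^ 2)) with hg
  have gm : Measurable g := by
    apply ENNReal.measurable_ofReal.comp
    have : Continuous fun x : E3 => 1 / (1 + ‖x‖ ^ 2) := by
      apply continuous_const.div (by fun_prop); intro x; positivity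
    exact this.measurable
  have mF : MeasurableSet (Far D) := (isOpen_Far D).measurableSet
  set I := ∫⁻ x in Far D, g x with hI
  have fin : I ≠ ⊤ := by
    have h1 := normsq_lq h
    have h2 : ∫⁻ x in Far D, ‖a * (rho x)⁻¹‖ₑ ^ 2 ≤ ∫⁻ x in Om C, ‖a * (rho x)⁻¹‖ₑ ^ 2 :=
      lintegral_mono_set (Far_sub hD hC)
    have h3 : ∀ x, ‖a * (rho x)⁻¹‖ₑ ^ 2 = ENNReal.ofReal (a ^ 2) * g x := by
      intro x
      rw [enorm_sq_eq, hg, ← ENNReal.ofReal_mul (by positivity), mul_pow, inv_pow, rho_sq]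
      congr 1; ring
    rw [← h1] at h2
    simp only [h3] at h2
    rw [lintegral_const_mul _ gm] at h2
    intro htop
    rw [← hI, htop, ENNReal.mul_top (by simpa using ha)] at h2
    exact absurd h2 (by simp)
  have pos : 0 < I := by
    rw [hI, lintegral_pos_iff_support gm]
    have : Function.support g = univ := by
      ext x; simp only [hg, Function.mem_support, mem_univ, iff_true]
      have : 0 < 1 / (1 + ‖x‖ ^ 2) := by positivity
      simpa using this
    rw [this, Measure.restrict_apply_univ]
    refine (isOpen_Far D).measure_pos volume ?_
    refine ⟨EuclideanSpace.single 2 (-(4 * D + 1)), ?_, ?_⟩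
    · simp; linarith
    · rw [PiLp.norm_single, norm_neg, Real.norm_of_nonneg (by linarith)]; linarith
  have sc := lint_smul (G := (Far D).indicator g) (gm.indicator mF) (t := 2) two_pos
  rw [lintegral_indicator mF] at sc
  have low : ENNReal.ofReal (1/4) * I ≤ ∫⁻ x, (Far D).indicator g ((2:ℝ) • x) := by
    rw [hI, ← lintegral_const_mul _ gm, ← lintegral_indicator mF]
    apply lintegral_mono
    intro x
    show (Far D).indicator _ x ≤ (Far D).indicator g ((2:ℝ) • x)
    by_cases hx : x ∈ Far D
    · have hx2 : (2:ℝ) • x ∈ Far D := by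
        refine ⟨?_, ?_⟩
        · have := hx.1; simp; linarith
        · have := hx.2
          rw [norm_smul, Real.norm_of_nonneg zero_le_two]
          linarith [norm_nonneg x]
      rw [indicator_of_mem hx, indicator_of_mem hx2, hg, ← ENNReal.ofReal_mul (by norm_num)]
      apply ENNReal.ofReal_le_ofReal
      rw [norm_smul, Real.norm_of_nonneg zero_le_two, div_mul_div_comm, one_mul]
      apply div_le_div_of_nonneg_left <;> nlinarith [norm_nonneg x]
    · rw [indicator_of_notMem hx]; exact zero_le
  rw [sc] at low
  have := (ENNReal.mul_le_mul_iff_left pos.ne' fin).1 low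
  rw [ENNReal.ofReal_le_ofReal_iff (by positivity)] at this
  norm_num at this

lemma aa_cont (lam mu : ℝ) (G : MM C) : Continuous fun H => aa lam mu G H := by
  unfold aa
  have h1 : Continuous fun H : MM C => tr C H := (tr C).continuous
  have h2 : Continuous fun H : MM C => Tt C H := (Tt C).continuous
  fun_prop

lemma uniq_aux {lam mu κ D : ℝ} (hD : 1 < D) (hC : Adm D C) (hlc : ∀ Q, LC C Q) (hκ : 0 < κ)
    (hco : ∀ G ∈ VV C, κ * ‖G‖ ^ 2 ≤ aa lam mu G G)
    {u u' : Fin 3 → E3 → ℝ} (hu : ∀ i, Good C (u i)) (hu' : ∀ i, Good C (u' i))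
    (h : ∀ v : Fin 3 → E3 → ℝ, (∀ i, TestOn univ (v i)) →
      aa lam mu (grad C u) (grad C v) = aa lam mu (grad C u') (grad C v)) (i : Fin 3) :
    EqOn (u' i) (u i) (Om C) := by
  have V1 := Good_VV hlc hu
  have V2 := Good_VV hlc hu'
  have eG : ∀ H ∈ VV C, aa lam mu (grad C u) H = aa lam mu (grad C u') H :=
    VV_ind (isClosed_eq (aa_cont lam mu _) (aa_cont lam mu _)) h
  set W := grad C u' + (-1:ℝ) • grad C u with hW
  have VW : W ∈ VV C := (VV C).add_mem V2 ((VV C).smul_mem _ V1)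
  have h0 := hco W VW
  have h1 : aa lam mu W W = 0 := by
    rw [hW, aa_add_left, aa_smul_left, ← hW, eG W VW]; ring
  have h2 : ‖W‖ = 0 := by
    rw [h1] at h0
    have : ‖W‖ ^ 2 ≤ 0 := by nlinarith [sq_nonneg ‖W‖]
    exact pow_eq_zero_iff two_ne_zero |>.1 (le_antisymm this (sq_nonneg _))
  have h3 : grad C u' = grad C u := by
    rw [norm_eq_zero, hW] at h2
    simpa [← sub_eq_add_neg, sub_eq_zero] using h2
  have h4 : ∀ j, ∀ x ∈ Om C, pd (u' i) j x = pd (u i) j x := by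
    intro j
    have e : lq C (pd (u' i) j) = lq C (pd (u i) j) := congrArg (fun G : MM C => G (i, j)) h3
    have e2 : pd (u' i) j =ᵐ[muO C] pd (u i) j :=
      (lq_ae ((hu' i).g2 j)).symm.trans (e ▸ lq_ae ((hu i).g2 j))
    exact Measure.eqOn_open_of_ae_eq e2 (isOpen_Om C) (pd_contOn (isOpen_Om C) (hu' i).c1 j)
      (pd_contOn (isOpen_Om C) (hu i).c1 j)
  obtain ⟨a, ha⟩ := (isOpen_Om C).exists_eq_add_of_fderiv_eq (𝕜 := ℝ) hC.cn
    ((hu' i).c1.differentiableOn (by simp)) ((hu i).c1.differentiableOn (by simp)) (fun x hx => by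
      ext v
      rw [fderiv_eq_sum, fderiv_eq_sum]
      exact Finset.sum_congr rfl fun k _ => by rw [h4 k x hx])
  have a0 : a = 0 := by
    apply const_zero hD hC
    refine (memLp_congr_ae ?_).1 ((hu' i).l2.sub (hu i).l2)
    rw [Filter.EventuallyEq, muO, ae_restrict_iff' (meas_Om C)]
    refine Eventually.of_forall fun x hx => ?_
    simp only [Pi.sub_apply, ha hx]; ring
  intro x hx
  have := ha hx
  simpa [a0] using this

end

section
open scoped ContDiff Topology ENNReal NNReal
open Filter

/-! ### Part 21 : assembly -/
variable {C : Set E3}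

lemma int_sq {f : E3 → ℝ} (h : MemLp f 2 (muO C)) : ∫ x in Om C, f x ^ 2 = ‖lq C f‖ ^ 2 := by
  rw [← real_inner_self_eq_norm_sq, inner_lq2 h h]
  simp only [sq]

theorem exist_aux {lam mu κ D K : ℝ} (hmu : 0 < mu) (hlam : 0 < 3*lam + 2*mu) (hC : Adm D C)
    (hκ : 0 < κ) (hK : 0 < K)
    (hco : ∀ G ∈ VV C, κ * ‖G‖ ^ 2 ≤ aa lam mu G G)
    (hH : ∀ v : Fin 3 → E3 → ℝ, (∀ i, TestOn univ (v i)) →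
      ∀ i, ‖lq C (fun x => v i x * (rho x)⁻¹)‖ ≤ K * ‖grad C v‖)
    {S : Fin 3 → Fin 3 → E3 → ℝ} (hS : ∀ i j, TestOn univ (S i j))
    (hSC : ∀ v : Fin 3 → E3 → ℝ, (∀ i, TestOn univ (v i)) →
      ∫ x in Om C, (∑ i, ∑ j, S i j x * pd (v i) j x) = - ∫ x in C, ∑ i, pd (v i) i x) {p : ℝ} (hp : 0 < p) :
    ∃ u : E3 → E3, IsWeakSolution lam mu p C u ∧
      (∫ x in Om C, ‖u x‖^2 / (1 + ‖x‖^2)) + (∫ x in Om C, frob2 (jac u x)) ≤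
        (3 * K ^ 2 + 1) * (κ⁻¹ * (p * ‖Sm' C S‖)) ^ 2 := by
  obtain ⟨G, hG, hsol, hn⟩ := lax hκ hco (p • Sm' C S)
  have hrhs : ∀ v : Fin 3 → E3 → ℝ, (∀ i, TestOn univ (v i)) →
      aa lam mu G (grad C v) = -p * ∫ x in C, ∑ i, pd (v i) i x := by
    intro v hv
    rw [hsol _ (VV_mem hv), real_inner_smul_left, inner_Sm' hS hv, hSC v hv]; ring
  have hV0 : ∀ H ∈ V0 C, aa lam mu G H = 0 := by
    apply V0_ind (isClosed_eq (aa_cont lam mu G) continuous_const)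
    intro v hv
    rw [hrhs v fun i => (hv i).univ]
    have : ∫ x in C, ∑ i, pd (v i) i x = 0 := by
      apply setIntegral_eq_zero_of_forall_eq_zero
      intro x hx
      apply Finset.sum_eq_zero
      intro i _
      apply pd_zero_of_notMem
      intro h
      exact ((hv i).ts h).2 (subset_closure hx)
    rw [this, mul_zero]
  obtain ⟨w, hw1, hw2⟩ := recover hK hH hG
  have hb : ∀ m, Biharm (Om C) (fu (w m)) := fu_biharm hmu hlam hG hV0 hw2
  set u : E3 → E3 := fun x => WithLp.toLp 2 (fun i => uu (w i) x) with hu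
  have ecp : ∀ i, cp u i = uu (w i) := fun i => rfl
  have c1 : ContDiffOn ℝ 1 u (Om C) := (contDiffOn_piLp 2).2 fun i => uu_sm (hb i)
  have a1 : ∀ i, (fun x => cp u i x * (rho x)⁻¹) =ᵐ[muO C] w i := fun i => uu_ae (hb i)
  have a2 : ∀ i j, pd (cp u i) j =ᵐ[muO C] G (i, j) := fun i j => uu_pd (hb i) j (hw2 i j)
  have gd : ∀ i, Good C (cp u i) := fun i =>
    ⟨uu_sm (hb i), (memLp_congr_ae (a1 i)).2 (Lp.memLp _), fun j => (memLp_congr_ae (a2 i j)).2 (Lp.memLp _)⟩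
  have eg : grad C (cp u) = G := by
    ext1 q
    obtain ⟨i, j⟩ := q
    change lq C (pd (cp u i) j) = G (i, j)
    rw [lq_congr (a2 i j), lq_coe]
  have E1 : ∀ x, ‖u x‖^2 / (1 + ‖x‖^2) = ∑ i, (cp u i x * (rho x)⁻¹) ^ 2 := by
    intro x
    rw [EuclideanSpace.norm_sq_eq, div_eq_mul_inv, Finset.sum_mul]
    refine Finset.sum_congr rfl fun i _ => ?_
    rw [mul_pow, inv_pow, rho_sq, Real.norm_eq_abs, sq_abs]; rfl
  have E2 : ∀ x ∈ Om C, frob2 (jac u x) = ∑ i, ∑ j, (pd (cp u i) j x) ^ 2 := by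
    intro x hx
    have d := (c1.differentiableOn (by simp)).differentiableAt ((isOpen_Om C).mem_nhds hx)
    simp only [frob2, cp_jac d]
  have I1 : ∀ i, Integrable (fun x => (cp u i x * (rho x)⁻¹) ^ 2) (muO C) := fun i => (gd i).l2.integrable_sq
  have I2 : ∀ i j, Integrable (fun x => (pd (cp u i) j x) ^ 2) (muO C) := fun i j => ((gd i).g2 j).integrable_sq
  have I2' : ∀ i, Integrable (fun x => ∑ j, (pd (cp u i) j x) ^ 2) (muO C) :=
    fun i => integrable_finsetSum _ fun j _ => I2 i j
  have J1 : IntegrableOn (fun x => ‖u x‖^2 / (1 + ‖x‖^2)) (Om C) := by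
    simp only [E1]; exact integrable_finsetSum _ fun i _ => I1 i
  have J2 : IntegrableOn (fun x => frob2 (jac u x)) (Om C) := by
    have : IntegrableOn (fun x => ∑ i, ∑ j, (pd (cp u i) j x) ^ 2) (Om C) := integrable_finsetSum _ fun i _ => I2' i
    exact (integrableOn_congr_fun (fun x hx => E2 x hx) (meas_Om C)).2 this
  refine ⟨u, ⟨c1, J1, J2, ?_⟩, ?_⟩
  · intro v hv hvc
    have := weak_eq (lam := lam) (mu := mu) c1 gd hv hvc
    refine this.trans ?_
    rw [eg, hrhs _ fun i => cp_test hv hvc i]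
    congr 2; funext x
    have d' : DifferentiableAt ℝ v x := hv.differentiable (by simp) x
    simp only [divg, cp_jac d']
  · have s1 := integral_finsetSum Finset.univ (fun i _ => I1 i)
    have s2 := integral_finsetSum Finset.univ (fun i _ => I2' i)
    have s3 := fun i => integral_finsetSum Finset.univ (fun j _ => I2 i j)
    unfold muO at s1 s2 s3
    have B1 : ∫ x in Om C, ‖u x‖^2 / (1 + ‖x‖^2) ≤ 3 * K ^ 2 * ‖G‖ ^ 2 := by
      simp only [E1]
      rw [s1]
      calc _ ≤ ∑ i : Fin 3, (K * ‖G‖) ^ 2 := by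
            refine Finset.sum_le_sum fun i _ => ?_
            rw [int_sq (gd i).l2, lq_congr (a1 i), lq_coe]
            have := hw1 i
            gcongr
        _ = _ := by simp; ring
    have B2 : ∫ x in Om C, frob2 (jac u x) = ‖G‖ ^ 2 := by
      rw [setIntegral_congr_fun (meas_Om C) E2, s2, normsq_MM]
      refine Finset.sum_congr rfl fun i _ => ?_
      rw [s3]
      refine Finset.sum_congr rfl fun j _ => ?_
      rw [int_sq ((gd i).g2 j), lq_congr (a2 i j), lq_coe]
    rw [B2]
    rw [norm_smul, Real.norm_of_nonneg hp.le] at hn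
    calc _ ≤ (3 * K ^ 2 + 1) * ‖G‖ ^ 2 := by linarith
      _ ≤ _ := by gcongr

end

/-- Well-posedness of the direct problem: existence, uniqueness, and a quantitative
weighted-H¹ estimate `‖u‖²_{H¹_w} ≤ c² p²`. -/
theorem direct_problem_wellposed (lam mu r₀ E₀ D₀ : ℝ)
    (hmu : 0 < mu) (hlam : 0 < 3*lam + 2*mu) (hr₀ : 0 < r₀) (hE₀ : 0 < E₀) (hD₀ : 1 < D₀) :
    ∃ c : ℝ, 0 < c ∧ ∀ C : Set E3, IsLipschitzCavity r₀ E₀ D₀ C → ∀ p : ℝ, 0 < p →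
      ∃ u : E3 → E3, IsWeakSolution lam mu p C u ∧
        (∀ u' : E3 → E3, IsWeakSolution lam mu p C u' → Set.EqOn u' u (lowerHalf \ closure C)) ∧
        (∫ x in lowerHalf \ closure C, ‖u x‖^2 / (1 + ‖x‖^2)) +
          (∫ x in lowerHalf \ closure C, frob2 (jac u x)) ≤ c^2 * p^2 := by
  have hr : 0 < r₀ / 2 := by positivity
  have ht : 0 < r₀ / 4 := by positivity
  have hc : 0 < 1 / (2 * (1 + E₀)) := by positivity
  obtain ⟨κ, hκ, hco⟩ := coer hmu hlam hD₀ hr ht hc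
  obtain ⟨K, hK, hH⟩ := hardy_grad hD₀ hr ht hc
  obtain ⟨S, hS, hSC⟩ := Sfield hD₀
  obtain ⟨M, hM, hSM⟩ := norm_Sm' hS
  refine ⟨(2 * K + 1) * (κ⁻¹ * M), by positivity, fun C hCav p hp => ?_⟩
  have hA := Adm.of_cavity hCav.1
  have hcone := star_of_lip hr₀ hE₀ hCav.2
  have hfr := frontier_null hA.op hr ht hc hcone
  have hlc := LC_all hD₀ hr ht hc hA hcone
  obtain ⟨u, hu, hbd⟩ := exist_aux hmu hlam hA hκ hK (hco C hA hcone) (hH C hA hcone) hS (hSC C hA hfr) hp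
  refine ⟨u, hu, fun u' hu' => ?_, hbd.trans ?_⟩
  · have g1 := fun i => good_of (C := C) hu.1 hu.2.1 hu.2.2.1 i
    have g2 := fun i => good_of (C := C) hu'.1 hu'.2.1 hu'.2.2.1 i
    have key := uniq_aux hD₀ hA hlc hκ (hco C hA hcone) g1 g2 (fun v hv => by
      set V : E3 → E3 := fun x => WithLp.toLp 2 (fun i => v i x) with hV
      have sV : ContDiff ℝ (⊤ : ℕ∞) V := (contDiff_piLp 2).2 fun i => (hv i).sm
      have cV : HasCompactSupport V := by
        have : IsCompact (⋃ i, tsupport (v i)) := isCompact_iUnion fun i => (hv i).cs.isCompact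
        apply HasCompactSupport.of_support_subset_isCompact this
        intro x hx
        by_contra h
        apply hx
        ext i
        have : x ∉ tsupport (v i) := fun h' => h (mem_iUnion.2 ⟨i, h'⟩)
        exact (image_eq_zero_of_notMem_tsupport this : v i x = 0)
      have e : v = cp V := rfl
      rw [e, ← weak_eq hu.1 g1 sV cV, ← weak_eq hu'.1 g2 sV cV]
      exact (hu.2.2.2 V sV cV).trans (hu'.2.2.2 V sV cV).symm)
    intro x hx
    ext i
    exact key i hx
  · have h1 := hSM C
    calc _ ≤ (2 * K + 1) ^ 2 * (κ⁻¹ * (p * M)) ^ 2 := by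
          gcongr
          nlinarith
      _ = _ := by ring

end
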